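/- Let d ≥ 2 and k ≥ 1 be an integer. Suppose Ω : ℝ^d \ {0} → ℝ is homogeneous of degree zero, Ω|_{S^{d−1}} ∈ L^∞(S^{d−1}), and Ω satisfies the moment conditions ∫_{S^{d−1}} Ω(θ) θ^α dθ = 0 for every multi-index α ∈ ℤ₊^d with |α| = k. Let A : ℝ^d → ℝ be Lipschitz with Lipschitz constant ‖∇A‖_∞. Let the k-th order Calderón commutator be given for f ∈ C_c^∞(ℝ^d) by T^k_{Ω,A} f(x) = p.v. ∫_{ℝ^d} (Ω(x−y)/|x−y|^d) · ((A(x)−A(y))/|x−y|)^k · f(y) dy, assumed to exist a.e. for such f. Then there is a constant C depending only on d and k such that for all λ > 0 and f ∈ C_c^∞(ℝ^d), m({x ∈ ℝ^d : |T^k_{Ω,A} f(x)| > λ}) ≤ C λ^{−1} ‖Ω‖_{L^∞(S^{d−1})} ‖∇A‖_∞^k ‖f‖_{L¹}. -/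

import Mathlib

open MeasureTheory Metric Filter Topology ENNReal

noncomputable section

/-- The surface measure on the unit sphere `S^{d-1}` of `ℝ^d`. -/
def sphereMeasure (d : ℕ) :
    Measure (sphere (0 : EuclideanSpace ℝ (Fin d)) 1) :=
  (volume : Measure (EuclideanSpace ℝ (Fin d))).toSphere

/-- `‖Ω‖_{L^∞(S^{d-1})}` (essential supremum on the sphere). -/
def sphLinf (d : ℕ) (Ω : EuclideanSpace ℝ (Fin d) → ℝ) : ℝ≥0∞ :=
  eLpNorm (fun θ : sphere (0 : EuclideanSpace ℝ (Fin d)) 1 => Ω θ) ⊤ (sphereMeasure d)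

namespace CalderonCommutator

open scoped FourierTransform RealInnerProductSpace SchwartzMap

lemma fourier_ae_eq_of_integrable {d : ℕ} {f : EuclideanSpace ℝ (Fin d) → ℂ}
    (hf : Integrable f) (hf2 : MemLp f 2) :
    (𝓕 (hf2.toLp f) : Lp ℂ 2 (volume : Measure (EuclideanSpace ℝ (Fin d)))) =ᵐ[volume] 𝓕 f := by
  have hcont : Continuous (𝓕 f) :=
    VectorFourier.fourierIntegral_continuous Real.continuous_fourierChar
      (by exact continuous_inner) hf
  apply ae_eq_of_integral_contDiff_smul_eq
  · exact (Lp.memLp (𝓕 (hf2.toLp f))).locallyIntegrable (by norm_num)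
  · exact hcont.locallyIntegrable
  intro g hg hgs
  have hgc : HasCompactSupport (fun x => (g x : ℂ)) :=
    hgs.comp_left (g := fun r : ℝ => (r : ℂ)) (by simp)
  have hgd : ContDiff ℝ (⊤ : ℕ∞) (fun x => (g x : ℂ)) := Complex.ofRealCLM.contDiff.comp hg
  let φ : 𝓢(EuclideanSpace ℝ (Fin d), ℂ) := hgc.toSchwartzMap hgd
  have hφ : ∀ x, φ x = (g x : ℂ) := fun x => rfl
  have h1 := DFunLike.congr_fun (MeasureTheory.Lp.fourier_toTemperedDistribution_eq (hf2.toLp f)) φ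
  rw [TemperedDistribution.fourier_apply, Lp.toTemperedDistribution_apply,
    Lp.toTemperedDistribution_apply] at h1
  have h2 : ∫ x, (𝓕 φ) x • (hf2.toLp f) x = ∫ x, (𝓕 φ) x • f x := by
    apply integral_congr_ae
    filter_upwards [hf2.coeFn_toLp] with x hx
    rw [hx]
  have h3 : ∫ x, (𝓕 φ) x • f x = ∫ x, φ x • 𝓕 f x := by
    rw [SchwartzMap.fourier_coe]
    have := VectorFourier.integral_fourierIntegral_smul_eq_flip (μ := volume) (ν := volume)
      (L := innerₗ (EuclideanSpace ℝ (Fin d))) (f := φ) (g := f)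
      Real.continuous_fourierChar continuous_inner φ.integrable hf
    rw [flip_innerₗ] at this
    exact this
  have h4 : ∀ G : EuclideanSpace ℝ (Fin d) → ℂ, ∫ x, g x • G x = ∫ x, φ x • G x := by
    intro G
    rfl
  rw [h4, h4, ← h1, h2, h3]

/-- Plancherel's identity for integrable square integrable functions. -/
lemma lintegral_enorm_fourier_sq {d : ℕ} {f : EuclideanSpace ℝ (Fin d) → ℂ}
    (hf : Integrable f) (hf2 : MemLp f 2) :
    ∫⁻ ξ, ‖𝓕 f ξ‖ₑ ^ 2 = ∫⁻ x, ‖f x‖ₑ ^ 2 := by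
  have key : eLpNorm (𝓕 f) 2 volume = eLpNorm f 2 volume := by
    rw [← eLpNorm_congr_ae (fourier_ae_eq_of_integrable hf hf2), ← Lp.enorm_def,
      ← eLpNorm_congr_ae hf2.coeFn_toLp, ← Lp.enorm_def, ← ofReal_norm, ← ofReal_norm,
      Lp.norm_fourier_eq]
  have h : ∀ g : EuclideanSpace ℝ (Fin d) → ℂ,
      ∫⁻ x, ‖g x‖ₑ ^ 2 = (eLpNorm g 2 volume) ^ 2 := by
    intro g
    have := eLpNorm_nnreal_pow_eq_lintegral (f := g) (μ := volume) (p := 2) (by norm_num)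
    simpa using this.symm
  rw [h, h, key]

lemma measurable_fourier {d : ℕ} {f : EuclideanSpace ℝ (Fin d) → ℂ}
    (hf : Integrable f) : Measurable (𝓕 f) :=
  (VectorFourier.fourierIntegral_continuous Real.continuous_fourierChar
      (by exact continuous_inner) hf).measurable

lemma fourier_finset_sum {d : ℕ} {ι : Type*} (S : Finset ι)
    {f : ι → EuclideanSpace ℝ (Fin d) → ℂ}
    (hf : ∀ i ∈ S, Integrable (f i)) (ξ : EuclideanSpace ℝ (Fin d)) :
    𝓕 (fun x => ∑ i ∈ S, f i x) ξ = ∑ i ∈ S, 𝓕 (f i) ξ := by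
  simp only [Real.fourier_eq, Finset.smul_sum]
  rw [integral_finsetSum]
  intro i hi
  exact (Real.fourierIntegral_convergent_iff ξ).2 (hf i hi)

/-- Weighted Cauchy–Schwarz at a single frequency. -/
lemma sq_norm_sum_le_of_weight {ι : Type*} {d : ℕ} (S : Finset ι) (t : ι → ℝ) (W : ℝ)
    (hW : ∑ i ∈ S, (1 + (t i) ^ 2)⁻¹ ≤ W)
    (a : ι → ℂ) (b : ι → Fin d → ℂ) (u : Fin d → ℝ) (hu : ∑ j, (u j) ^ 2 = 1)
    (hab : ∀ i ∈ S, (t i : ℂ) * a i = ∑ j, (u j : ℂ) * b i j) :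
    ‖∑ i ∈ S, a i‖ ^ 2 ≤ W * ∑ i ∈ S, (‖a i‖ ^ 2 + ∑ j, ‖b i j‖ ^ 2) := by
  have h1 : ∀ i ∈ S, (t i) ^ 2 * ‖a i‖ ^ 2 ≤ ∑ j, ‖b i j‖ ^ 2 := by
    intro i hi
    have h2 : |t i| * ‖a i‖ ≤ ∑ j, |u j| * ‖b i j‖ := by
      have := norm_sum_le Finset.univ (fun j => (u j : ℂ) * b i j)
      rw [← hab i hi] at this
      simpa using this
    have h3 := Finset.sum_mul_sq_le_sq_mul_sq Finset.univ (fun j => |u j|) (fun j => ‖b i j‖)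
    simp only [sq_abs, hu, one_mul] at h3
    calc (t i) ^ 2 * ‖a i‖ ^ 2 = (|t i| * ‖a i‖) ^ 2 := by rw [mul_pow, sq_abs]
      _ ≤ (∑ j, |u j| * ‖b i j‖) ^ 2 := by gcongr
      _ ≤ _ := h3
  have h4 : ‖∑ i ∈ S, a i‖ ≤ ∑ i ∈ S, ‖a i‖ := norm_sum_le _ _
  have h5 := Finset.sum_sq_le_sum_mul_sum_of_sq_le_mul S (r := fun i => ‖a i‖)
    (f := fun i => (1 + (t i) ^ 2)⁻¹) (g := fun i => (1 + (t i) ^ 2) * ‖a i‖ ^ 2)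
    (fun i _ => by positivity) (fun i _ => by positivity)
    (fun i _ => by
      have : (1 + (t i) ^ 2) ≠ 0 := by positivity
      rw [inv_mul_cancel_left₀ this])
  calc ‖∑ i ∈ S, a i‖ ^ 2 ≤ (∑ i ∈ S, ‖a i‖) ^ 2 := by gcongr
    _ ≤ _ := h5
    _ ≤ W * ∑ i ∈ S, (1 + (t i) ^ 2) * ‖a i‖ ^ 2 := by gcongr
    _ ≤ _ := by
      have hW0 : 0 ≤ W := le_trans (Finset.sum_nonneg fun i _ => by positivity) hW
      gcongr with i hi
      linarith [h1 i hi]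

/-- Almost orthogonality: each `H i` is, in frequency, concentrated near the hyperplane
orthogonal to `a i`, as quantified by `a i · ∇ (H i) = div (G i)`. -/
lemma lintegral_sq_sum_le_of_divergence {ι : Type*} {d : ℕ} [NeZero d] (S : Finset ι)
    (a : ι → EuclideanSpace ℝ (Fin d)) (W : ℝ)
    (hW : ∀ u : EuclideanSpace ℝ (Fin d), ‖u‖ = 1 → ∑ i ∈ S, (1 + ⟪a i, u⟫ ^ 2)⁻¹ ≤ W)
    (H : ι → EuclideanSpace ℝ (Fin d) → ℂ) (G : ι → Fin d → EuclideanSpace ℝ (Fin d) → ℂ)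
    (hH : ∀ i ∈ S, Integrable (H i)) (hH2 : ∀ i ∈ S, MemLp (H i) 2)
    (hG : ∀ i ∈ S, ∀ j, Integrable (G i j)) (hG2 : ∀ i ∈ S, ∀ j, MemLp (G i j) 2)
    (hHG : ∀ i ∈ S, ∀ ξ : EuclideanSpace ℝ (Fin d),
      (⟪a i, ξ⟫ : ℂ) * 𝓕 (H i) ξ = ∑ j, (ξ j : ℂ) * 𝓕 (G i j) ξ) :
    ∫⁻ x, ‖∑ i ∈ S, H i x‖ₑ ^ 2 ≤
      ENNReal.ofReal W * ∑ i ∈ S, ((∫⁻ x, ‖H i x‖ₑ ^ 2) + ∑ j, ∫⁻ x, ‖G i j x‖ₑ ^ 2) := by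
  have hsum : Integrable (fun x => ∑ i ∈ S, H i x) := integrable_finsetSum _ hH
  have hsum2 : MemLp (fun x => ∑ i ∈ S, H i x) 2 := memLp_finsetSum _ hH2
  rw [← lintegral_enorm_fourier_sq hsum hsum2]
  have hR : ∑ i ∈ S, ((∫⁻ x, ‖H i x‖ₑ ^ 2) + ∑ j, ∫⁻ x, ‖G i j x‖ₑ ^ 2)
      = ∫⁻ ξ, ∑ i ∈ S, (‖𝓕 (H i) ξ‖ₑ ^ 2 + ∑ j, ‖𝓕 (G i j) ξ‖ₑ ^ 2) := by
    rw [lintegral_finsetSum']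
    · apply Finset.sum_congr rfl
      intro i hi
      rw [lintegral_add_left' , lintegral_finsetSum']
      · rw [lintegral_enorm_fourier_sq (hH i hi) (hH2 i hi)]
        congr 1
        exact Finset.sum_congr rfl fun j _ =>
          (lintegral_enorm_fourier_sq (hG i hi j) (hG2 i hi j)).symm
      · intro j _
        exact ((measurable_fourier (hG i hi j)).enorm.pow_const 2).aemeasurable
      · exact ((measurable_fourier (hH i hi)).enorm.pow_const 2).aemeasurable
    · intro i hi
      refine AEMeasurable.add ((measurable_fourier (hH i hi)).enorm.pow_const 2).aemeasurable ?_
      refine Finset.aemeasurable_fun_sum _ fun j _ => ?_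
      exact ((measurable_fourier (hG i hi j)).enorm.pow_const 2).aemeasurable
  rw [hR, ← lintegral_const_mul' _ _ ENNReal.ofReal_ne_top]
  have hne : ∀ᵐ ξ : EuclideanSpace ℝ (Fin d), ξ ≠ 0 := by
    have : Nonempty (Fin d) := ⟨0⟩
    rw [ae_iff]
    simp
  apply lintegral_mono_ae
  filter_upwards [hne] with ξ hξ
  rw [fourier_finset_sum S hH]
  have hξn : ‖ξ‖ ≠ 0 := norm_ne_zero_iff.2 hξ
  have hu : ‖(‖ξ‖⁻¹ • ξ)‖ = 1 := by rw [norm_smul, norm_inv, norm_norm, inv_mul_cancel₀ hξn]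
  have hW1 := hW _ hu
  have hu2 : ∑ j, ((‖ξ‖⁻¹ • ξ) j) ^ 2 = 1 := by
    have := EuclideanSpace.real_norm_sq_eq (‖ξ‖⁻¹ • ξ)
    rw [hu] at this
    simpa using this.symm
  have hfin := sq_norm_sum_le_of_weight S (fun i => ⟪a i, ‖ξ‖⁻¹ • ξ⟫) W hW1
    (fun i => 𝓕 (H i) ξ) (fun i j => 𝓕 (G i j) ξ) (fun j => (‖ξ‖⁻¹ • ξ) j) hu2 (by
      intro i hi
      have := congrArg (fun z => (‖ξ‖⁻¹ : ℂ) * z) (hHG i hi ξ)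
      simp only [Finset.mul_sum] at this
      simp only [inner_smul_right, PiLp.smul_apply, smul_eq_mul]
      push_cast
      simpa only [mul_assoc] using this)
  have hW0 : 0 ≤ W := le_trans (Finset.sum_nonneg fun i _ => by positivity) hW1
  have := ENNReal.ofReal_le_ofReal hfin
  rw [ENNReal.ofReal_mul hW0, ENNReal.ofReal_pow (norm_nonneg _), ofReal_norm,
    ENNReal.ofReal_sum_of_nonneg (fun i _ => by positivity)] at this
  refine this.trans (le_of_eq ?_)
  congr 1
  refine Finset.sum_congr rfl fun i _ => ?_
  rw [ENNReal.ofReal_add (by positivity) (by positivity), ENNReal.ofReal_pow (norm_nonneg _),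
    ofReal_norm, ENNReal.ofReal_sum_of_nonneg (fun i _ => by positivity)]
  simp [ENNReal.ofReal_pow]

lemma summable_int_inv_one_add_sq : Summable fun n : ℤ => (1 + (n : ℝ) ^ 2)⁻¹ := by
  have h : Summable fun n : ℤ => 1 / (n : ℝ) ^ 2 := Real.summable_one_div_int_pow.2 (by norm_num)
  refine Summable.of_norm_bounded_eventually h ?_
  have : ({0} : Set ℤ)ᶜ ∈ cofinite := (Set.finite_singleton 0).compl_mem_cofinite
  filter_upwards [this] with n hn
  have hn' : (n : ℝ) ≠ 0 := by simpa using hn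
  rw [Real.norm_of_nonneg (by positivity), one_div]
  have : 0 < (n : ℝ) ^ 2 := by positivity
  gcongr
  linarith

lemma exists_sum_int_inv_one_add_sq_le (b : ℝ) (hb : 0 < b) :
    ∃ C : ℝ, 0 < C ∧ ∀ (s : Finset ℤ) (α β : ℝ), b ≤ |β| →
      ∑ n ∈ s, (1 + (β * n + α) ^ 2)⁻¹ ≤ C := by
  have hT := summable_int_inv_one_add_sq
  refine ⟨(3 + 2 / b ^ 2) * ((∑' n : ℤ, (1 + (n : ℝ) ^ 2)⁻¹) + 1), ?_, ?_⟩
  · have : 0 ≤ ∑' n : ℤ, (1 + (n : ℝ) ^ 2)⁻¹ := tsum_nonneg fun n => by positivity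
    positivity
  intro s α β hβ
  have hβ0 : β ≠ 0 := fun h => by simp [h] at hβ; linarith
  set x := -α / β
  have hx : ∀ n : ℤ, β * n + α = β * (n - x) := fun n => by simp only [x]; field_simp; ring
  set n0 := ⌊x⌋
  have hp : ∀ n : ℤ, (1 + (β * n + α) ^ 2)⁻¹ ≤
      (3 + 2 / b ^ 2) * (1 + ((n - n0 : ℤ) : ℝ) ^ 2)⁻¹ := by
    intro n
    rw [hx]
    have h1 : (n0 : ℝ) ≤ x := Int.floor_le x
    have h2 : x < n0 + 1 := Int.lt_floor_add_one x
    have h3 : b ^ 2 ≤ β ^ 2 := by rw [← sq_abs β]; gcongr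
    have h4 : ((n - n0 : ℤ) : ℝ) ^ 2 ≤ 2 * (n - x) ^ 2 + 2 := by
      push_cast
      nlinarith [sq_nonneg ((n - x) - (x - n0)), h1, h2]
    rw [inv_le_iff_one_le_mul₀ (by positivity), mul_right_comm, ← div_eq_mul_inv,
      le_div_iff₀ (by positivity), one_mul]
    have h5 : b ^ 2 * (n - x) ^ 2 ≤ (β * (n - x)) ^ 2 := by
      rw [mul_pow]; gcongr
    have h6 : 2 / b ^ 2 * (b ^ 2 * (n - x) ^ 2) = 2 * (n - x) ^ 2 := by field_simp
    have h7 : 0 ≤ 2 / b ^ 2 := by positivity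
    have h8 := mul_le_mul_of_nonneg_left h5 h7
    nlinarith [sq_nonneg (β * (n - x))]
  calc ∑ n ∈ s, (1 + (β * n + α) ^ 2)⁻¹
      ≤ ∑ n ∈ s, (3 + 2 / b ^ 2) * (1 + ((n - n0 : ℤ) : ℝ) ^ 2)⁻¹ :=
        Finset.sum_le_sum fun n _ => hp n
    _ = (3 + 2 / b ^ 2) * ∑ n ∈ s, (1 + ((n - n0 : ℤ) : ℝ) ^ 2)⁻¹ := by rw [Finset.mul_sum]
    _ ≤ _ := by
      gcongr
      have h9 : ∑ n ∈ s, (1 + ((n - n0 : ℤ) : ℝ) ^ 2)⁻¹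
          = ∑ n ∈ s.map (Equiv.subRight n0).toEmbedding, (1 + (n : ℝ) ^ 2)⁻¹ := by
        rw [Finset.sum_map]; rfl
      rw [h9]
      have := hT.sum_le_tsum (s.map (Equiv.subRight n0).toEmbedding) (fun n _ => by positivity)
      linarith

lemma sum_piFinset_le_card_mul {d : ℕ} (t : Fin d → Finset ℤ) (j : Fin d) (f : (Fin d → ℤ) → ℝ)
    (hf : ∀ ν, 0 ≤ f ν) (B : ℝ)
    (hB : ∀ ν, ∑ n ∈ t j, f (Function.update ν j n) ≤ B) :
    ∑ ν ∈ Fintype.piFinset t, f ν ≤ (Fintype.piFinset (Function.update t j {0})).card * B := by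
  classical
  have hmaps : ∀ ν ∈ Fintype.piFinset t, Function.update ν j 0 ∈
      Fintype.piFinset (Function.update t j {0}) := by
    intro ν hν
    rw [Fintype.mem_piFinset] at hν ⊢
    intro i
    by_cases h : i = j
    · subst h; simp
    · simpa [h] using hν i
  rw [← Finset.sum_fiberwise_of_maps_to hmaps, ← nsmul_eq_mul, ← Finset.sum_const]
  apply Finset.sum_le_sum
  intro μ hμ
  refine le_trans ?_ (hB μ)
  have hfib : ∀ ν ∈ (Fintype.piFinset t).filter (fun ν => Function.update ν j 0 = μ),
      f ν = f (Function.update μ j (ν j)) := by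
    intro ν hν
    rw [← (Finset.mem_filter.1 hν).2]
    simp
  rw [Finset.sum_congr rfl hfib]
  have hinj : Set.InjOn (fun ν : Fin d → ℤ => ν j)
      ((Fintype.piFinset t).filter (fun ν => Function.update ν j 0 = μ) : Finset (Fin d → ℤ)) := by
    intro ν hν ν' hν' h
    have h1 := (Finset.mem_filter.1 hν).2
    have h2 := (Finset.mem_filter.1 hν').2
    have h3 : ν = Function.update μ j (ν j) := by rw [← h1]; simp
    have h4 : ν' = Function.update μ j (ν' j) := by rw [← h2]; simp
    rw [h3, h4]
    simp only at h
    rw [h]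
  rw [← Finset.sum_image (f := fun n => f (Function.update μ j n)) hinj]
  apply Finset.sum_le_sum_of_subset_of_nonneg
  · intro n hn
    obtain ⟨ν, hν, rfl⟩ := Finset.mem_image.1 hn
    exact (Fintype.mem_piFinset.1 (Finset.mem_filter.1 hν).1) j
  · intro n _ _
    exact hf _

/-- Integer points `ν` with `ν m = N` and `|ν j| ≤ N`; the vectors `ν / N` are the grid of
directions in the face `x m = 1` of the unit cube. -/
def dirGrid (d : ℕ) (m : Fin d) (N : ℕ) : Finset (Fin d → ℤ) :=
  Fintype.piFinset fun j => if j = m then {(N : ℤ)} else Finset.Icc (-(N : ℤ)) N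

lemma card_Icc_neg_nat (N : ℕ) : (Finset.Icc (-(N : ℤ)) N).card = 2 * N + 1 := by
  rw [Int.card_Icc]; omega

lemma card_dirGrid (d : ℕ) (m : Fin d) (N : ℕ) : (dirGrid d m N).card = (2 * N + 1) ^ (d - 1) := by
  rw [dirGrid, Fintype.card_piFinset]
  have : ∀ j, (if j = m then {(N : ℤ)} else Finset.Icc (-(N : ℤ)) N).card
      = if j = m then 1 else 2 * N + 1 := by
    intro j
    split_ifs
    · simp
    · exact card_Icc_neg_nat N
  simp only [this]
  rw [Finset.prod_ite]
  simp [Finset.filter_ne', Finset.card_erase_of_mem]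

lemma card_update_dirGrid (d : ℕ) (m j : Fin d) (hjm : j ≠ m) (N : ℕ) :
    (Fintype.piFinset (Function.update
      (fun j => if j = m then {(N : ℤ)} else Finset.Icc (-(N : ℤ)) N) j {0})).card
      = (2 * N + 1) ^ (d - 2) := by
  rw [Fintype.card_piFinset]
  have : ∀ i, (Function.update
      (fun j => if j = m then {(N : ℤ)} else Finset.Icc (-(N : ℤ)) N) j {0} i).card
      = if i = m ∨ i = j then 1 else 2 * N + 1 := by
    intro i
    by_cases hij : i = j
    · subst hij; simp
    · by_cases him : i = m
      · subst him; simp [hij]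
      · simp only [Function.update_of_ne hij, him, hij, if_false, or_self]
        exact card_Icc_neg_nat N
  simp only [this]
  rw [Finset.prod_ite]
  simp only [Finset.prod_const_one, one_mul, Finset.prod_const]
  congr 1
  have h : Finset.univ.filter (fun i : Fin d => ¬ (i = m ∨ i = j)) = (Finset.univ.erase m).erase j := by
    ext i; simp; tauto
  rw [h, Finset.card_erase_of_mem (by simp [hjm]), Finset.card_erase_of_mem (by simp)]
  simp; omega

/-- Summing over the grid of directions, only about `N ^ (d - 2)` of them are nearly
orthogonal to a given unit vector. -/
lemma exists_sum_dirGrid_weight_le (d : ℕ) (hd : 2 ≤ d) :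
    ∃ C : ℝ, 0 < C ∧ ∀ (m : Fin d) (N : ℕ), 1 ≤ N → ∀ u : EuclideanSpace ℝ (Fin d), ‖u‖ = 1 →
      ∑ ν ∈ dirGrid d m N, (1 + (∑ j, (ν j : ℝ) * u j) ^ 2)⁻¹ ≤ C * (N : ℝ) ^ (d - 2) := by
  have hd0 : (0 : ℝ) < d := by positivity
  obtain ⟨C₁, hC₁, h₁⟩ := exists_sum_int_inv_one_add_sq_le (1 / (4 * d)) (by positivity)
  refine ⟨3 ^ (d - 2) * C₁ + 16 * 3 ^ (d - 1), by positivity, ?_⟩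
  intro m N hN u hu
  have hN' : (1 : ℝ) ≤ N := by exact_mod_cast hN
  have h3 : ((2 * N + 1 : ℕ) : ℝ) ≤ 3 * N := by push_cast; linarith
  by_cases hj : ∃ j, j ≠ m ∧ 1 / (4 * d) ≤ |u j|
  · obtain ⟨j, hjm, hj⟩ := hj
    have := sum_piFinset_le_card_mul
      (fun j => if j = m then {(N : ℤ)} else Finset.Icc (-(N : ℤ)) N) j
      (fun ν => (1 + (∑ j, (ν j : ℝ) * u j) ^ 2)⁻¹) (fun ν => by positivity) C₁ (by
        intro ν
        refine le_trans (le_of_eq ?_) (h₁ (if j = m then {(N : ℤ)} else Finset.Icc (-(N : ℤ)) N)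
          (∑ i ∈ Finset.univ.erase j, (ν i : ℝ) * u i) (u j) hj)
        refine Finset.sum_congr rfl fun n _ => ?_
        rw [← Finset.add_sum_erase _ _ (Finset.mem_univ j)]
        simp only [Function.update_self]
        rw [mul_comm (n : ℝ)]
        congr 4
        refine Finset.sum_congr rfl fun i hi => ?_
        rw [Function.update_of_ne (Finset.ne_of_mem_erase hi)])
    rw [card_update_dirGrid d m j hjm] at this
    refine this.trans ?_
    have h4 : (((2 * N + 1) ^ (d - 2) : ℕ) : ℝ) ≤ (3 * N) ^ (d - 2) := by
      rw [Nat.cast_pow]; gcongr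
    calc (((2 * N + 1) ^ (d - 2) : ℕ) : ℝ) * C₁ ≤ (3 * N) ^ (d - 2) * C₁ := by gcongr
      _ = 3 ^ (d - 2) * C₁ * (N : ℝ) ^ (d - 2) := by rw [mul_pow]; ring
      _ ≤ _ := by gcongr; linarith [show (0 : ℝ) < 16 * 3 ^ (d - 1) by positivity]
  · push Not at hj
    have hsum : ∑ j, (u j) ^ 2 = 1 := by
      have := EuclideanSpace.real_norm_sq_eq u
      rw [hu] at this; simpa using this.symm
    have hsmall : ∀ j ∈ Finset.univ.erase m, |u j| ≤ 1 / (4 * d) := fun j hj' =>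
      (hj j (Finset.ne_of_mem_erase hj')).le
    have hE : ((Finset.univ.erase m).card : ℝ) ≤ d := by
      rw [Finset.card_erase_of_mem (by simp)]; simp
    have h5 : ∑ j ∈ Finset.univ.erase m, |u j| ≤ 1 / 4 := by
      calc ∑ j ∈ Finset.univ.erase m, |u j| ≤ ∑ j ∈ Finset.univ.erase m, 1 / (4 * (d : ℝ)) :=
            Finset.sum_le_sum hsmall
        _ = (Finset.univ.erase m).card * (1 / (4 * d)) := by simp
        _ ≤ d * (1 / (4 * d)) := by gcongr
        _ = 1 / 4 := by field_simp
    have h6 : 1 / 2 ≤ |u m| := by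
      have h7 : ∑ j ∈ Finset.univ.erase m, (u j) ^ 2 ≤ 1 / 4 := by
        refine le_trans (Finset.sum_le_sum fun j hj' => ?_) h5
        rw [← sq_abs]
        have : |u j| ≤ 1 := (hsmall j hj').trans (by
          rw [div_le_one (by positivity)]
          have : (2 : ℝ) ≤ d := by exact_mod_cast hd
          linarith)
        nlinarith [abs_nonneg (u j)]
      rw [← Finset.add_sum_erase _ _ (Finset.mem_univ m)] at hsum
      by_contra h8
      push Not at h8
      nlinarith [sq_abs (u m), abs_nonneg (u m)]
    have h9 : ∀ ν ∈ dirGrid d m N, (1 + (∑ j, (ν j : ℝ) * u j) ^ 2)⁻¹ ≤ 16 / (N : ℝ) ^ 2 := by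
      intro ν hν
      rw [dirGrid, Fintype.mem_piFinset] at hν
      have hm : ν m = N := by simpa using hν m
      have hb : ∀ j, |(ν j : ℝ)| ≤ N := by
        intro j
        by_cases hjm : j = m
        · subst hjm; rw [hm]; simp
        · have := hν j
          simp only [hjm, if_false, Finset.mem_Icc] at this
          rw [abs_le]; exact_mod_cast this
      have h10 : |∑ j ∈ Finset.univ.erase m, (ν j : ℝ) * u j| ≤ N * (1 / 4) := by
        calc _ ≤ ∑ j ∈ Finset.univ.erase m, |(ν j : ℝ) * u j| := Finset.abs_sum_le_sum_abs _ _
          _ ≤ ∑ j ∈ Finset.univ.erase m, N * |u j| :=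
              Finset.sum_le_sum fun j _ => by rw [abs_mul]; gcongr; exact hb j
          _ = N * ∑ j ∈ Finset.univ.erase m, |u j| := by rw [Finset.mul_sum]
          _ ≤ _ := by gcongr
      have h11 : (N : ℝ) / 4 ≤ |∑ j, (ν j : ℝ) * u j| := by
        rw [← Finset.add_sum_erase _ _ (Finset.mem_univ m), hm]
        have h12 : |((N : ℤ) : ℝ) * u m| ≥ N * (1 / 2) := by
          rw [abs_mul]; simp only [Int.cast_natCast, Nat.abs_cast]; gcongr
        have h13 := abs_sub_abs_le_abs_sub (((N : ℤ) : ℝ) * u m)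
          (-∑ j ∈ Finset.univ.erase m, (ν j : ℝ) * u j)
        rw [abs_neg, sub_neg_eq_add] at h13
        linarith
      have h14 : ((N : ℝ) / 4) ^ 2 ≤ (∑ j, (ν j : ℝ) * u j) ^ 2 := by
        rw [← sq_abs (∑ j, (ν j : ℝ) * u j)]; gcongr
      rw [inv_le_iff_one_le_mul₀ (by positivity), div_mul_eq_mul_div, le_div_iff₀ (by positivity)]
      nlinarith
    calc ∑ ν ∈ dirGrid d m N, (1 + (∑ j, (ν j : ℝ) * u j) ^ 2)⁻¹
        ≤ ∑ ν ∈ dirGrid d m N, 16 / (N : ℝ) ^ 2 := Finset.sum_le_sum h9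
      _ = (((2 * N + 1) ^ (d - 1) : ℕ) : ℝ) * (16 / (N : ℝ) ^ 2) := by
          rw [Finset.sum_const, card_dirGrid, nsmul_eq_mul]
      _ ≤ (3 * N) ^ (d - 1) * (16 / (N : ℝ) ^ 2) := by
          rw [Nat.cast_pow]; gcongr
      _ = 16 * 3 ^ (d - 1) * ((N : ℝ) ^ (d - 1) / (N : ℝ) ^ 2) := by rw [mul_pow]; ring
      _ ≤ 16 * 3 ^ (d - 1) * (N : ℝ) ^ (d - 2) := by
          gcongr
          rw [div_le_iff₀ (by positivity), ← pow_add]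
          exact pow_le_pow_right₀ hN' (by omega)
      _ ≤ _ := by gcongr; linarith [show (0 : ℝ) < 3 ^ (d - 2) * C₁ by positivity]

section

/-- The Euclidean space `ℝ^d`. -/
abbrev Euc (d : ℕ) := EuclideanSpace ℝ (Fin d)

section Superposition

variable {d : ℕ} {α : Type*} [MeasurableSpace α] {μ : Measure α} [SFinite μ]

lemma integrable_shear {φ : α → Euc d} (hφ : Measurable φ) {Φ : α → Euc d → ℂ}
    (hΦ : Integrable (Function.uncurry Φ) (μ.prod volume)) :
    Integrable (fun q : α × Euc d => Φ q.1 (q.2 - φ q.1)) (μ.prod volume) := by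
  have h : MeasurePreserving (fun q : α × Euc d => (q.1, q.2 - φ q.1)) (μ.prod volume)
      (μ.prod volume) := by
    refine (MeasurePreserving.id μ).skew_product (g := fun a x => x - φ a) ?_ ?_
    · exact measurable_snd.sub (hφ.comp measurable_fst)
    · exact ae_of_all _ fun a => (measurePreserving_sub_right volume (φ a)).map_eq
  exact h.integrable_comp_of_integrable hΦ

lemma integrable_superposition {φ : α → Euc d} (hφ : Measurable φ) {Φ : α → Euc d → ℂ}
    (hΦ : Integrable (Function.uncurry Φ) (μ.prod volume)) :
    Integrable (fun x => ∫ a, Φ a (x - φ a) ∂μ) :=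
  (integrable_shear hφ hΦ).integral_prod_right

/-- The Fourier transform of a superposition of translates. -/
lemma fourier_superposition {φ : α → Euc d} (hφ : Measurable φ) {Φ : α → Euc d → ℂ}
    (hΦ : Integrable (Function.uncurry Φ) (μ.prod volume)) (ξ : Euc d) :
    𝓕 (fun x => ∫ a, Φ a (x - φ a) ∂μ) ξ =
      ∫ a, Complex.exp (↑(-2 * Real.pi * ⟪φ a, ξ⟫) * Complex.I) * 𝓕 (Φ a) ξ ∂μ := by
  have h1 := integrable_shear hφ hΦ
  have h2 : Integrable (fun q : α × Euc d =>
      Complex.exp (↑(-2 * Real.pi * ⟪q.2, ξ⟫) * Complex.I) * Φ q.1 (q.2 - φ q.1))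
      (μ.prod volume) := by
    refine h1.bdd_mul (c := 1) ?_ ?_
    · have hc : Continuous fun x : Euc d =>
          Complex.exp (↑(-2 * Real.pi * ⟪x, ξ⟫) * Complex.I) := by fun_prop
      exact (hc.measurable.comp measurable_snd).aestronglyMeasurable
    · exact ae_of_all _ fun q => (Complex.norm_exp_ofReal_mul_I _).le
  simp only [Real.fourier_eq', smul_eq_mul]
  calc ∫ x, Complex.exp (↑(-2 * Real.pi * ⟪x, ξ⟫) * Complex.I) * ∫ a, Φ a (x - φ a) ∂μ
      = ∫ x, ∫ a, Complex.exp (↑(-2 * Real.pi * ⟪x, ξ⟫) * Complex.I) * Φ a (x - φ a) ∂μ := by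
        simp only [integral_const_mul]
    _ = ∫ a, (∫ x, Complex.exp (↑(-2 * Real.pi * ⟪x, ξ⟫) * Complex.I) * Φ a (x - φ a)) ∂μ :=
        (integral_integral_swap h2).symm
    _ = _ := by
      refine integral_congr_ae (ae_of_all _ fun a => ?_)
      simp only
      rw [← integral_add_right_eq_self _ (φ a), ← integral_const_mul]
      congr 1
      ext x
      rw [add_sub_cancel_right, inner_add_left, ← mul_assoc, ← Complex.exp_add]
      congr 2
      push_cast
      ring

lemma lintegral_enorm_superposition_le {φ : α → Euc d} (hφ : Measurable φ) {Φ : α → Euc d → ℂ}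
    (hΦ : Integrable (Function.uncurry Φ) (μ.prod volume)) :
    ∫⁻ x, ‖∫ a, Φ a (x - φ a) ∂μ‖ₑ ≤ ∫⁻ a, (∫⁻ x, ‖Φ a x‖ₑ) ∂μ := by
  have h1 := (integrable_shear hφ hΦ).aestronglyMeasurable.enorm
  calc ∫⁻ x, ‖∫ a, Φ a (x - φ a) ∂μ‖ₑ ≤ ∫⁻ x, ∫⁻ a, ‖Φ a (x - φ a)‖ₑ ∂μ :=
        lintegral_mono fun x => enorm_integral_le_lintegral_enorm _
    _ = ∫⁻ a, (∫⁻ x, ‖Φ a (x - φ a)‖ₑ) ∂μ := (lintegral_lintegral_swap h1).symm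
    _ = _ := by
      refine lintegral_congr fun a => ?_
      exact lintegral_sub_right_eq_self (fun x => ‖Φ a x‖ₑ) (φ a)

end Superposition

/-- Averages of translates of `g` by vectors of length at most `r`. -/
lemma norm_average_le {d : ℕ} {α : Type*} [MeasurableSpace α] {μ : Measure α}
    {g : Euc d → ℂ} {S S' : Set (Euc d)} {B c r : ℝ} (hB : 0 ≤ B)
    (hg : ∀ x, ‖g x‖ ≤ S.indicator (fun _ => B) x) {w : α → ℝ} (hw : Integrable w μ)
    (hc : ∫ a, |w a| ∂μ ≤ c) {φ : α → Euc d} (hφ : ∀ a, w a ≠ 0 → ‖φ a‖ ≤ r)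
    (hS : ∀ x ∈ S, ∀ h, ‖h‖ ≤ r → x + h ∈ S') (x : Euc d) :
    ‖∫ a, (w a : ℂ) * g (x - φ a) ∂μ‖ ≤ S'.indicator (fun _ => c * B) x := by
  have hle : ∀ a, ‖(w a : ℂ) * g (x - φ a)‖ ≤ |w a| * B := fun a => by
    rw [norm_mul, Complex.norm_real, Real.norm_eq_abs]
    gcongr
    exact (hg _).trans (Set.indicator_le_self' (fun _ _ => hB) _)
  by_cases hx : x ∈ S'
  · rw [Set.indicator_of_mem hx]
    calc ‖∫ a, (w a : ℂ) * g (x - φ a) ∂μ‖ ≤ ∫ a, |w a| * B ∂μ :=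
          norm_integral_le_of_norm_le (hw.abs.mul_const _) (ae_of_all _ hle)
      _ = (∫ a, |w a| ∂μ) * B := integral_mul_const _ _
      _ ≤ c * B := by gcongr
  · rw [Set.indicator_of_notMem hx]
    have : ∀ a, (w a : ℂ) * g (x - φ a) = 0 := by
      intro a
      by_cases ha : w a = 0
      · simp [ha]
      · have h1 : x - φ a ∉ S := fun h => hx (by simpa using hS _ h (φ a) (hφ a ha))
        have h2 := hg (x - φ a)
        rw [Set.indicator_of_notMem h1] at h2
        rw [norm_le_zero_iff.1 h2, mul_zero]
    simp [this]

/-- Euler's identity for functions homogeneous of degree zero, in weak form. -/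
lemma integral_homogeneous_mul_radial_deriv {d : ℕ} {ω : Euc d → ℝ} (hω : Measurable ω)
    {B : ℝ} (hωB : ∀ v, |ω v| ≤ B) (hhom : ∀ t : ℝ, 0 < t → ∀ v, v ≠ 0 → ω (t • v) = ω v)
    {ψ ψ' : Euc d → ℂ} (hψ : Continuous ψ) {ρ M : ℝ} (hM : 0 ≤ M) (hsupp : ∀ v, ρ < ‖v‖ → ψ v = 0)
    (hlip : ∀ v, ∀ t ∈ Set.Ioo (1 / 2 : ℝ) 2, ∀ t' ∈ Set.Ioo (1 / 2 : ℝ) 2,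
      ‖ψ (t • v) - ψ (t' • v)‖ ≤ M * |t - t'|) (hψ' : Measurable ψ')
    (hderiv : ∀ᵐ v, HasDerivAt (fun t : ℝ => ψ (t • v)) (ψ' v) 1) :
    ∫ v, (ω v : ℂ) * ψ' v = -(d : ℂ) * ∫ v, (ω v : ℂ) * ψ v := by
  have hB0 : 0 ≤ B := (abs_nonneg _).trans (hωB 0)
  have hmeas : ∀ t : ℝ, AEStronglyMeasurable (fun v => (ω v : ℂ) * ψ (t • v)) volume := fun t =>
    ((Complex.measurable_ofReal.comp hω).mul
      (hψ.measurable.comp (measurable_const_smul t))).aestronglyMeasurable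
  have hcs : HasCompactSupport ψ := by
    refine HasCompactSupport.of_support_subset_isCompact (isCompact_closedBall 0 ρ) fun v hv => ?_
    rw [mem_closedBall_zero_iff]
    by_contra h
    exact hv (hsupp v (not_le.1 h))
  have hbd : ∀ t : ℝ, ∀ v, ‖(ω v : ℂ) * ψ (t • v)‖ ≤ B * ‖ψ (t • v)‖ := fun t v => by
    rw [norm_mul, Complex.norm_real]
    gcongr
    exact hωB v
  have h_int : Integrable (fun v => (ω v : ℂ) * ψ v) := by
    have := hmeas 1
    simp only [one_smul] at this
    exact Integrable.mono' ((hψ.integrable_of_hasCompactSupport hcs).norm.const_mul B) this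
      (ae_of_all _ fun v => by simpa using hbd 1 v)
  have h1 : HasDerivAt (fun t : ℝ => ∫ v, (ω v : ℂ) * ψ (t • v)) (∫ v, (ω v : ℂ) * ψ' v) 1 := by
    refine (hasDerivAt_integral_of_dominated_loc_of_lip (s := Set.Ioo (1 / 2 : ℝ) 2)
      (bound := (closedBall (0 : Euc d) (2 * ρ)).indicator (fun _ => B * M))
      (Ioo_mem_nhds (by norm_num) (by norm_num))
      (Eventually.of_forall hmeas) (by simpa using h_int)
      ((Complex.measurable_ofReal.comp hω).mul hψ').aestronglyMeasurable ?_ ?_ ?_).2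
    · refine ae_of_all _ fun v => LipschitzOnWith.of_dist_le_mul fun t ht t' ht' => ?_
      rw [dist_eq_norm, ← mul_sub, norm_mul, Complex.norm_real, Real.dist_eq, Real.coe_nnabs]
      by_cases hv : v ∈ closedBall (0 : Euc d) (2 * ρ)
      · rw [Set.indicator_of_mem hv, abs_of_nonneg (mul_nonneg hB0 hM), mul_assoc]
        gcongr
        · exact hωB v
        · exact hlip v t ht t' ht'
      · rw [mem_closedBall_zero_iff, not_le] at hv
        have : ∀ t ∈ Set.Ioo (1 / 2 : ℝ) 2, ψ (t • v) = 0 := by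
          intro t ht
          apply hsupp
          rw [norm_smul, Real.norm_of_nonneg (by linarith [ht.1])]
          nlinarith [ht.1, norm_nonneg v]
        rw [this t ht, this t' ht']
        simp only [sub_zero, norm_zero, mul_zero]
        positivity
    · exact (integrable_indicator_iff measurableSet_closedBall).2
        (integrableOn_const (measure_closedBall_lt_top.ne))
    · filter_upwards [hderiv] with v hv
      exact hv.const_mul _
  have h2 : ∀ t : ℝ, 0 < t → ∫ v, (ω v : ℂ) * ψ (t • v) = ((t ^ d)⁻¹ : ℝ) * ∫ v, (ω v : ℂ) * ψ v := by
    intro t ht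
    have h3 := Measure.integral_comp_smul (volume : Measure (Euc d)) (fun v => (ω v : ℂ) * ψ v) t
    rw [finrank_euclideanSpace_fin, abs_of_nonneg (by positivity), Complex.real_smul] at h3
    rw [← h3]
    by_cases hd : d = 0
    · subst hd
      congr 1
      ext v
      rw [Subsingleton.elim (t • v) v]
    have : NeZero d := ⟨hd⟩
    have hne : ∀ᵐ v : Euc d, v ≠ 0 := by
      have : Nonempty (Fin d) := ⟨0⟩
      rw [ae_iff]
      simp
    refine integral_congr_ae ?_
    filter_upwards [hne] with v hv
    rw [hhom t ht v hv]
  have h4 : HasDerivAt (fun t : ℝ => (((t ^ d)⁻¹ : ℝ) : ℂ) * ∫ v, (ω v : ℂ) * ψ v)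
      (-(d : ℂ) * ∫ v, (ω v : ℂ) * ψ v) 1 := by
    have h5 : HasDerivAt (fun t : ℝ => (t ^ d)⁻¹) (-(d : ℝ)) 1 := by
      have := (hasDerivAt_pow d (1 : ℝ)).fun_inv (by simp)
      simpa using this
    simpa using h5.ofReal_comp.mul_const (∫ v, (ω v : ℂ) * ψ v)
  have h6 : (fun t : ℝ => ∫ v, (ω v : ℂ) * ψ (t • v)) =ᶠ[𝓝 1]
      fun t : ℝ => (((t ^ d)⁻¹ : ℝ) : ℂ) * ∫ v, (ω v : ℂ) * ψ v := by
    filter_upwards [lt_mem_nhds (show (0 : ℝ) < 1 by norm_num)] with t ht using h2 t ht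
  exact h1.unique (h4.congr_of_eventuallyEq h6)

end

section

/-- The operator with kernel `κ y (x - y)`. -/
def kerOp {d : ℕ} (κ : Euc d → Euc d → ℝ) (b : Euc d → ℂ) (x : Euc d) : ℂ :=
  ∫ y, (κ y (x - y) : ℂ) * b y

/-- A bounded measurable kernel supported in `‖v‖ ≤ ρ`. -/
structure IsBddKernel {d : ℕ} (κ : Euc d → Euc d → ℝ) (B ρ : ℝ) : Prop where
  measurable : Measurable (Function.uncurry κ)
  bound : ∀ y v, |κ y v| ≤ B
  supp : ∀ y v, ρ < ‖v‖ → κ y v = 0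

section kerOp

variable {d : ℕ} {κ : Euc d → Euc d → ℝ} {B ρ : ℝ} {b : Euc d → ℂ}

lemma IsBddKernel.nonneg (hκ : IsBddKernel κ B ρ) : 0 ≤ B := (abs_nonneg _).trans (hκ.bound 0 0)

lemma IsBddKernel.integrable_uncurry (hκ : IsBddKernel κ B ρ) (hb : Integrable b) :
    Integrable (Function.uncurry fun y v => (κ y v : ℂ) * b y) (volume.prod volume) := by
  have h1 : Integrable (fun q : Euc d × Euc d =>
      b q.1 * (closedBall (0 : Euc d) ρ).indicator (fun _ => (1 : ℂ)) q.2)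
      (volume.prod volume) := by
    refine hb.mul_prod ?_
    exact (integrable_indicator_iff measurableSet_closedBall).2
      (integrableOn_const measure_closedBall_lt_top.ne)
  refine (h1.norm.const_mul B).mono' ?_ (ae_of_all _ fun q => ?_)
  · exact (Complex.measurable_ofReal.comp hκ.measurable).aestronglyMeasurable.mul
      hb.aestronglyMeasurable.comp_fst
  · simp only [Function.uncurry, norm_mul, Complex.norm_real, Real.norm_eq_abs]
    by_cases h : q.2 ∈ closedBall (0 : Euc d) ρ
    · rw [Set.indicator_of_mem h, norm_one, mul_one]
      gcongr
      exact hκ.bound _ _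
    · rw [mem_closedBall_zero_iff, not_le] at h
      rw [hκ.supp _ _ h]
      simp only [abs_zero, zero_mul]
      have := hκ.nonneg
      positivity

lemma IsBddKernel.integrable_right (hκ : IsBddKernel κ B ρ) (y : Euc d) :
    Integrable (fun v => (κ y v : ℂ)) := by
  have h1 : Integrable (fun v : Euc d => (closedBall (0 : Euc d) ρ).indicator (fun _ => B) v) :=
    (integrable_indicator_iff measurableSet_closedBall).2
      (integrableOn_const measure_closedBall_lt_top.ne)
  refine h1.mono' ?_ (ae_of_all _ fun v => ?_)
  · exact (Complex.measurable_ofReal.comp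
      (hκ.measurable.comp measurable_prodMk_left)).aestronglyMeasurable
  · rw [Complex.norm_real, Real.norm_eq_abs]
    by_cases h : v ∈ closedBall (0 : Euc d) ρ
    · rw [Set.indicator_of_mem h]
      exact hκ.bound _ _
    · rw [Set.indicator_of_notMem h]
      rw [mem_closedBall_zero_iff, not_le] at h
      rw [hκ.supp _ _ h, abs_zero]

lemma IsBddKernel.integrable_kerOp (hκ : IsBddKernel κ B ρ) (hb : Integrable b) :
    Integrable (kerOp κ b) :=
  integrable_superposition (φ := fun y => y) measurable_id (hκ.integrable_uncurry hb)

lemma IsBddKernel.fourier_kerOp (hκ : IsBddKernel κ B ρ) (hb : Integrable b) (ξ : Euc d) :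
    𝓕 (kerOp κ b) ξ = ∫ y, Complex.exp (↑(-2 * Real.pi * ⟪y, ξ⟫) * Complex.I) * b y *
      𝓕 (fun v => (κ y v : ℂ)) ξ := by
  have := fourier_superposition (φ := fun y => y) measurable_id (hκ.integrable_uncurry hb) ξ
  refine this.trans (integral_congr_ae (ae_of_all _ fun y => ?_))
  beta_reduce
  rw [mul_assoc (Complex.exp _) (b y)]
  refine congrArg (fun z => Complex.exp (↑(-2 * Real.pi * ⟪y, ξ⟫) * Complex.I) * z) ?_
  simp only [Real.fourier_eq, ← integral_const_mul, Circle.smul_def, smul_eq_mul]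
  congr 1
  ext v
  ring

lemma IsBddKernel.norm_kerOp_le (hκ : IsBddKernel κ B ρ) (hb : Integrable b) {S : Set (Euc d)}
    (hS : ∀ y v, b y ≠ 0 → κ y v ≠ 0 → y + v ∈ S) (x : Euc d) :
    ‖kerOp κ b x‖ ≤ S.indicator (fun _ => B * ∫ y, ‖b y‖) x := by
  by_cases hx : x ∈ S
  · rw [Set.indicator_of_mem hx, kerOp, ← integral_const_mul]
    refine norm_integral_le_of_norm_le (hb.norm.const_mul B) (ae_of_all _ fun y => ?_)
    rw [norm_mul, Complex.norm_real]
    gcongr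
    exact hκ.bound _ _
  · rw [Set.indicator_of_notMem hx, kerOp]
    have : ∀ y, (κ y (x - y) : ℂ) * b y = 0 := fun y => by
      by_contra h
      rw [mul_eq_zero, not_or, Complex.ofReal_eq_zero] at h
      exact hx (by simpa using hS y (x - y) h.2 h.1)
    simp [this]

end kerOp

/-- Size and Lipschitz bounds for a kernel `h y v` living at scale `‖v‖ ∼ R`. -/
structure IsScaleKernel {d : ℕ} (h : Euc d → Euc d → ℝ) (C R : ℝ) : Prop where
  pos : 0 < R
  cont : Continuous (Function.uncurry h)
  supp : ∀ y v, 2 * R < ‖v‖ → h y v = 0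
  bound : ∀ y v, |h y v| ≤ C / R ^ (d + 1)
  lip_left : ∀ y y' v, |h y v - h y' v| ≤ C / R ^ (d + 2) * ‖y - y'‖
  lip_right : ∀ y v v', |h y v - h y v'| ≤ C / R ^ (d + 2) * ‖v - v'‖

/-- The radial derivative `v · ∇_v h(y, v)`. -/
def radialDeriv {d : ℕ} (h : Euc d → Euc d → ℝ) (y v : Euc d) : ℝ :=
  deriv (fun t : ℝ => h y (t • v)) 1

namespace IsScaleKernel

variable {d : ℕ} {h : Euc d → Euc d → ℝ} {C R : ℝ}

lemma const_nonneg (hh : IsScaleKernel h C R) : 0 ≤ C := by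
  have h1 := (abs_nonneg _).trans (hh.bound 0 0)
  have := hh.pos
  by_contra h2
  push Not at h2
  exact absurd h1 (not_le.2 (div_neg_of_neg_of_pos h2 (by positivity)))

lemma measurable_radialDeriv (hh : IsScaleKernel h C R) :
    Measurable (Function.uncurry (radialDeriv h)) := by
  have h1 := measurable_deriv_with_param (𝕜 := ℝ) (f := fun (q : Euc d × Euc d) (t : ℝ) => h q.1 (t • q.2))
    (hh.cont.comp (by fun_prop : Continuous fun z : (Euc d × Euc d) × ℝ => (z.1.1, z.2 • z.1.2)))
  exact h1.comp (measurable_id.prodMk measurable_const)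

lemma radialDeriv_eq_zero (hh : IsScaleKernel h C R) (y v : Euc d) (hv : 2 * R < ‖v‖) :
    radialDeriv h y v = 0 := by
  have h1 : (fun t : ℝ => h y (t • v)) =ᶠ[𝓝 1] fun _ => (0 : ℝ) := by
    have h2 : Tendsto (fun t : ℝ => ‖t • v‖) (𝓝 1) (𝓝 ‖(1 : ℝ) • v‖) :=
      (by fun_prop : Continuous fun t : ℝ => ‖t • v‖).tendsto 1
    rw [one_smul] at h2
    filter_upwards [h2.eventually (lt_mem_nhds hv)] with t ht using hh.supp _ _ ht
  rw [radialDeriv, h1.deriv_eq]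
  simp

lemma abs_radialDeriv_le (hh : IsScaleKernel h C R) (y v : Euc d) :
    |radialDeriv h y v| ≤ 2 * C / R ^ (d + 1) := by
  have hR := hh.pos
  have hC := hh.const_nonneg
  by_cases hv : 2 * R < ‖v‖
  · rw [hh.radialDeriv_eq_zero y v hv, abs_zero]; positivity
  push Not at hv
  have h1 : ‖deriv (fun t : ℝ => h y (t • v)) 1‖ ≤ C / R ^ (d + 2) * ‖v‖ := by
    refine norm_deriv_le_of_lip' (by positivity) (Eventually.of_forall fun t => ?_)
    rw [Real.norm_eq_abs, mul_assoc]
    refine (hh.lip_right y (t • v) ((1 : ℝ) • v)).trans (le_of_eq ?_)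
    rw [← sub_smul, norm_smul]; ring
  calc |radialDeriv h y v| ≤ C / R ^ (d + 2) * ‖v‖ := h1
    _ ≤ C / R ^ (d + 2) * (2 * R) := by gcongr
    _ = _ := by field_simp; ring

lemma ae_hasDerivAt (hh : IsScaleKernel h C R) (y : Euc d) :
    ∀ᵐ v, HasDerivAt (fun t : ℝ => h y (t • v)) (radialDeriv h y v) 1 := by
  have hlip : LipschitzWith (C / R ^ (d + 2)).toNNReal (h y) :=
    LipschitzWith.of_dist_le_mul fun v v' => by
      have hR := hh.pos
      have hC := hh.const_nonneg
      rw [Real.coe_toNNReal _ (by positivity), dist_eq_norm, dist_eq_norm]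
      exact hh.lip_right y v v'
  filter_upwards [hlip.ae_differentiableAt] with v hv
  apply DifferentiableAt.hasDerivAt
  have h1 : DifferentiableAt ℝ (h y) ((1 : ℝ) • v) := by rwa [one_smul]
  exact h1.comp (1 : ℝ) (by fun_prop)

/-- Integration by parts in the radial direction against a plane wave. -/
lemma fourier_radial (hh : IsScaleKernel h C R) {ω : Euc d → ℝ} (hω : Measurable ω)
    {B : ℝ} (hωB : ∀ v, |ω v| ≤ B) (hhom : ∀ t : ℝ, 0 < t → ∀ v, v ≠ 0 → ω (t • v) = ω v)
    (y ξ : Euc d) :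
    2 * Real.pi * Complex.I * ∫ v, (Real.fourierChar (-⟪v, ξ⟫) : ℂ) *
        ((ω v * ⟪v, ξ⟫ * h y v : ℝ) : ℂ) =
      𝓕 (fun v => ((ω v * (radialDeriv h y v + d * h y v) : ℝ) : ℂ)) ξ := by
  have hR := hh.pos
  have hC := hh.const_nonneg
  have hcy : Continuous (h y) := hh.cont.comp (by fun_prop : Continuous fun v => (y, v))
  set e : Euc d → ℂ := fun v => Complex.exp (((-2 * Real.pi * ⟪v, ξ⟫ : ℝ) : ℂ) * Complex.I) with he
  have hexp : ∀ v : Euc d, (Real.fourierChar (-⟪v, ξ⟫) : ℂ) = e v := fun v => by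
    rw [Real.fourierChar_apply, he]; simp only; congr 2; push_cast; ring
  have hec : Continuous e := by fun_prop
  have hen : ∀ v, ‖e v‖ = 1 := fun v => Complex.norm_exp_ofReal_mul_I _
  have hed : ∀ v : Euc d, ∀ t : ℝ, HasDerivAt (fun t : ℝ => e (t • v))
      (-2 * Real.pi * ⟪v, ξ⟫ * Complex.I * e (t • v)) t := by
    intro v t
    have h1 : HasDerivAt (fun t : ℝ => (((-2 * Real.pi * ⟪t • v, ξ⟫ : ℝ) : ℂ) * Complex.I))
        (-2 * Real.pi * ⟪v, ξ⟫ * Complex.I) t := by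
      have h2 : HasDerivAt (fun t : ℝ => -2 * Real.pi * ⟪t • v, ξ⟫) (-2 * Real.pi * ⟪v, ξ⟫) t := by
        simp only [real_inner_smul_left]
        simpa using ((hasDerivAt_id t).mul_const ⟪v, ξ⟫).const_mul (-2 * Real.pi)
      simpa using h2.ofReal_comp.mul_const Complex.I
    rw [mul_comm]
    exact h1.cexp
  have hlipe : ∀ v : Euc d, ∀ t t' : ℝ, ‖e (t • v) - e (t' • v)‖ ≤
      2 * Real.pi * ‖v‖ * ‖ξ‖ * |t - t'| := by
    intro v t t'
    have := Convex.norm_image_sub_le_of_norm_hasDerivWithin_le (f := fun t : ℝ => e (t • v))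
      (s := Set.univ) (C := 2 * Real.pi * ‖v‖ * ‖ξ‖) (fun t _ => (hed v t).hasDerivWithinAt)
      (fun t _ => by
        simp only [norm_mul, hen, mul_one, Complex.norm_I, norm_neg, Complex.norm_real,
          Complex.norm_ofNat, Real.norm_of_nonneg Real.pi_pos.le]
        rw [mul_assoc _ ‖v‖]
        gcongr
        exact norm_inner_le_norm v ξ) convex_univ (Set.mem_univ t') (Set.mem_univ t)
    rwa [Real.norm_eq_abs] at this
  have key := integral_homogeneous_mul_radial_deriv hω hωB hhom
    (ψ := fun v => (h y v : ℂ) * e v)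
    (ψ' := fun v => (radialDeriv h y v : ℂ) * e v +
      (h y v : ℂ) * (-2 * Real.pi * ⟪v, ξ⟫ * Complex.I * e v))
    (by fun_prop) (ρ := 2 * R) (M := C / R ^ (d + 2) * (4 * R)
      + C / R ^ (d + 1) * (2 * Real.pi * (4 * R) * ‖ξ‖)) (by positivity)
    (fun v hv => by simp [hh.supp y v hv]) (by
      intro v t ht t' ht'
      by_cases hv : 4 * R < ‖v‖
      · have : ∀ t ∈ Set.Ioo (1 / 2 : ℝ) 2, h y (t • v) = 0 := by
          intro t ht
          apply hh.supp
          rw [norm_smul, Real.norm_of_nonneg (by linarith [ht.1])]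
          nlinarith [ht.1]
        simp only [this t ht, this t' ht', Complex.ofReal_zero, zero_mul, sub_zero, norm_zero]
        positivity
      push Not at hv
      have h1 : (h y (t • v) : ℂ) * e (t • v) - (h y (t' • v) : ℂ) * e (t' • v)
          = ((h y (t • v) - h y (t' • v) : ℝ) : ℂ) * e (t • v)
            + (h y (t' • v) : ℂ) * (e (t • v) - e (t' • v)) := by push_cast; ring
      rw [h1]
      refine (norm_add_le _ _).trans ?_
      rw [norm_mul, norm_mul, hen, mul_one, Complex.norm_real, Complex.norm_real, add_mul]
      have h2 := hh.lip_right y (t • v) (t' • v)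
      rw [← sub_smul, norm_smul] at h2
      refine add_le_add ?_ ?_
      · refine h2.trans ?_
        rw [Real.norm_eq_abs, mul_assoc, mul_comm |t - t'|]
        gcongr
      · rw [mul_assoc]
        refine mul_le_mul (hh.bound _ _) ((hlipe v t t').trans (by gcongr)) (norm_nonneg _)
          (by positivity))
    (by
      have h1 : Measurable (radialDeriv h y) := hh.measurable_radialDeriv.comp measurable_prodMk_left
      have h2 : Measurable fun v : Euc d => (h y v : ℂ) * (-2 * Real.pi * ⟪v, ξ⟫ * Complex.I * e v) := by
        exact Continuous.measurable (by fun_prop)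
      exact ((Complex.measurable_ofReal.comp h1).mul hec.measurable).add h2)
    (by
      filter_upwards [hh.ae_hasDerivAt y] with v hv
      have := hv.ofReal_comp.fun_mul (hed v 1)
      simpa using this)
  have hωint : ∀ g : Euc d → ℝ, Measurable g → ∀ K, (∀ v, |g v| ≤ K) → (∀ v, 2 * R < ‖v‖ → g v = 0) →
      Integrable (fun v => (ω v : ℂ) * ((g v : ℂ) * e v)) := by
    intro g hg K hK hs
    have h1 : IsBddKernel (fun _ v => ω v * g v : Euc d → Euc d → ℝ) (B * K) (2 * R) :=
      ⟨(hω.mul hg).comp measurable_snd, fun _ v => by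
        rw [abs_mul]
        exact mul_le_mul (hωB v) (hK v) (abs_nonneg _) ((abs_nonneg _).trans (hωB 0)),
        fun _ v hv => by rw [hs v hv, mul_zero]⟩
    have h2 := (h1.integrable_right 0).mul_bdd (c := 1) hec.aestronglyMeasurable
      (ae_of_all _ fun v => (hen v).le)
    refine h2.congr (ae_of_all _ fun v => ?_)
    simp only [Complex.ofReal_mul, mul_assoc]
  have hi1 := hωint (radialDeriv h y) (hh.measurable_radialDeriv.comp measurable_prodMk_left)
    _ (hh.abs_radialDeriv_le y) (hh.radialDeriv_eq_zero y)
  have hi2 := hωint (h y) hcy.measurable _ (hh.bound y) (hh.supp y)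
  have hi3 := hωint (fun v => ⟪v, ξ⟫ * h y v) (by fun_prop) (2 * R * ‖ξ‖ * (C / R ^ (d + 1)))
    (fun v => by
      by_cases hv : 2 * R < ‖v‖
      · rw [hh.supp y v hv, mul_zero, abs_zero]; positivity
      push Not at hv
      rw [abs_mul]
      have := abs_real_inner_le_norm v ξ
      have := hh.bound y v
      calc |⟪v, ξ⟫| * |h y v| ≤ ‖v‖ * ‖ξ‖ * (C / R ^ (d + 1)) := by gcongr
        _ ≤ _ := by gcongr)
    (fun v hv => by rw [hh.supp y v hv, mul_zero])
  have e1 : ∫ v, (ω v : ℂ) * ((radialDeriv h y v : ℂ) * e v +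
      (h y v : ℂ) * (-2 * Real.pi * ⟪v, ξ⟫ * Complex.I * e v)) =
      (∫ v, (ω v : ℂ) * ((radialDeriv h y v : ℂ) * e v)) + (-2 * Real.pi * Complex.I) *
        ∫ v, (ω v : ℂ) * (((⟪v, ξ⟫ * h y v : ℝ) : ℂ) * e v) := by
    rw [← integral_const_mul, ← integral_add hi1 (hi3.const_mul _)]
    congr 1
    ext v
    push_cast
    ring
  rw [e1] at key
  have e2 : 𝓕 (fun v => ((ω v * (radialDeriv h y v + d * h y v) : ℝ) : ℂ)) ξ =
      (∫ v, (ω v : ℂ) * ((radialDeriv h y v : ℂ) * e v)) + d * ∫ v, (ω v : ℂ) * ((h y v : ℂ) * e v) := by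
    rw [← integral_const_mul, ← integral_add hi1 (hi2.const_mul _), Real.fourier_eq]
    congr 1
    ext v
    rw [Circle.smul_def, hexp, smul_eq_mul]
    push_cast
    ring
  have e3 : ∫ v, (Real.fourierChar (-⟪v, ξ⟫) : ℂ) * ((ω v * ⟪v, ξ⟫ * h y v : ℝ) : ℂ) =
      ∫ v, (ω v : ℂ) * (((⟪v, ξ⟫ * h y v : ℝ) : ℂ) * e v) := by
    congr 1
    ext v
    rw [hexp]
    push_cast
    ring
  rw [e2, e3]
  linear_combination (-1 : ℂ) * key

end IsScaleKernel

end

section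

section Average

variable {d : ℕ}

/-- A Lipschitz probability density supported in the unit ball. -/
structure IsProfile (p : Euc d → ℝ) (M : ℝ) : Prop where
  nonneg : ∀ u, 0 ≤ p u
  cont : Continuous p
  supp : ∀ u, 1 < ‖u‖ → p u = 0
  integral_eq : ∫ u, p u = 1
  lip : ∀ u u', |p u - p u'| ≤ M * ‖u - u'‖

lemma exists_isProfile (d : ℕ) : ∃ (p : Euc d → ℝ) (M : ℝ), 0 < M ∧ IsProfile p M := by
  set q : Euc d → ℝ := fun u => max 0 (1 - ‖u‖) with hq
  have hqc : Continuous q := by fun_prop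
  have hq0 : ∀ u, 0 ≤ q u := fun u => le_max_left _ _
  have hqs : ∀ u, 1 < ‖u‖ → q u = 0 := fun u hu => max_eq_left (by linarith)
  have hcs : HasCompactSupport q := by
    refine HasCompactSupport.of_support_subset_isCompact (isCompact_closedBall 0 1) fun v hv => ?_
    rw [mem_closedBall_zero_iff]
    by_contra h
    exact hv (hqs v (not_le.1 h))
  have hpos : 0 < ∫ u, q u := by
    refine hqc.integral_pos_of_hasCompactSupport_nonneg_nonzero hcs hq0 (x := 0) ?_
    simp [hq]
  refine ⟨fun u => (∫ u, q u)⁻¹ * q u, (∫ u, q u)⁻¹, by positivity,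
    fun u => mul_nonneg (by positivity) (hq0 u), by fun_prop, fun u hu => by simp [hqs u hu], ?_, ?_⟩
  · rw [integral_const_mul, inv_mul_cancel₀ hpos.ne']
  · intro u u'
    rw [← mul_sub, abs_mul, abs_of_pos (by positivity : 0 < (∫ u, q u)⁻¹)]
    gcongr
    refine (abs_max_sub_max_le_max _ _ _ _).trans ?_
    rw [max_le_iff]
    refine ⟨by simp, ?_⟩
    rw [show (1 - ‖u‖) - (1 - ‖u'‖) = -(‖u‖ - ‖u'‖) by ring, abs_neg]
    exact abs_norm_sub_norm_le u u'

variable {p : Euc d → ℝ} {M : ℝ}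

lemma IsProfile.integrable (hp : IsProfile p M) : Integrable p :=
  integrable_of_integral_eq_one hp.integral_eq

/-- Averaging at scale `r` against the density `p`. -/
def avgOp (p : Euc d → ℝ) (r : ℝ) (g : Euc d → ℂ) (x : Euc d) : ℂ :=
  ∫ u, (p u : ℂ) * g (x - r • u)

/-- The operators `q_j` in the decomposition `g - avgOp p r g = r * ∑ j, ∂_j (q_j g)`. -/
def gradAvgOp (p : Euc d → ℝ) (r : ℝ) (j : Fin d) (g : Euc d → ℂ) (x : Euc d) : ℂ :=
  ∫ z : Euc d × ℝ, ((p z.1 * z.1 j : ℝ) : ℂ) * g (x - (z.2 * r) • z.1)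
    ∂(volume.prod (volume.restrict (Set.Ioc (0 : ℝ) 1)))

lemma integrable_weighted_translate {α : Type*} [MeasurableSpace α] {μ : Measure α}
    {w : α → ℝ} (hw : Integrable w μ) {g : Euc d → ℂ}
    (hg : Integrable g) :
    Integrable (Function.uncurry fun a v => (w a : ℂ) * g v) (μ.prod volume) :=
  hw.ofReal.mul_prod hg

lemma fourier_weighted_translate {α : Type*} [MeasurableSpace α] {μ : Measure α} [SFinite μ]
    {w : α → ℝ} (hw : Integrable w μ) {g : Euc d → ℂ}
    (hg : Integrable g) {φ : α → Euc d} (hφ : Measurable φ) (ξ : Euc d) :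
    𝓕 (fun x => ∫ a, (w a : ℂ) * g (x - φ a) ∂μ) ξ =
      (∫ a, (w a : ℂ) * Complex.exp (↑(-2 * Real.pi * ⟪φ a, ξ⟫) * Complex.I) ∂μ) * 𝓕 g ξ := by
  have := fourier_superposition hφ (integrable_weighted_translate hw hg) ξ
  refine this.trans ?_
  rw [← integral_mul_const]
  refine integral_congr_ae (ae_of_all _ fun a => ?_)
  have h1 : 𝓕 (fun v => (w a : ℂ) * g v) ξ = (w a : ℂ) * 𝓕 g ξ := by
    simp only [Real.fourier_eq, ← integral_const_mul, Circle.smul_def, smul_eq_mul]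
    congr 1
    ext v
    ring
  beta_reduce
  rw [h1]
  ring

lemma one_sub_exp_eq (θ : ℝ) : 1 - Complex.exp ((-θ : ℝ) * Complex.I) =
    ∫ τ in Set.Ioc (0 : ℝ) 1, (θ * Complex.I) * Complex.exp ((-(τ * θ) : ℝ) * Complex.I) := by
  rw [← intervalIntegral.integral_of_le zero_le_one]
  have h : ∀ τ ∈ Set.uIcc (0 : ℝ) 1, HasDerivAt
      (fun τ : ℝ => -Complex.exp ((-(τ * θ) : ℝ) * Complex.I))
      ((θ * Complex.I) * Complex.exp ((-(τ * θ) : ℝ) * Complex.I)) τ := by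
    intro τ _
    have h1 : HasDerivAt (fun τ : ℝ => -(τ * θ)) (-θ) τ := by
      simpa using ((hasDerivAt_id τ).mul_const θ).fun_neg
    have h2 := ((h1.ofReal_comp.mul_const Complex.I).cexp).fun_neg
    refine h2.congr_deriv ?_
    push_cast
    ring
  rw [intervalIntegral.integral_eq_sub_of_hasDerivAt h]
  · simp; ring
  · exact Continuous.intervalIntegrable (by fun_prop) _ _

lemma IsProfile.integrable_grad (hp : IsProfile p M) (j : Fin d) :
    Integrable (fun z : Euc d × ℝ => p z.1 * z.1 j)
      (volume.prod (volume.restrict (Set.Ioc (0 : ℝ) 1))) := by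
  have h1 : Integrable (fun u : Euc d => p u * u j) := by
    refine hp.integrable.mono' ?_ (ae_of_all _ fun u => ?_)
    · have := hp.cont
      exact Continuous.aestronglyMeasurable (by fun_prop)
    · rw [norm_mul, Real.norm_of_nonneg (hp.nonneg u)]
      by_cases hu : 1 < ‖u‖
      · simp [hp.supp u hu]
      · push Not at hu
        exact mul_le_of_le_one_right (hp.nonneg u) ((PiLp.norm_apply_le u j).trans hu)
  have h2 : Integrable (fun _ : ℝ => (1 : ℝ)) (volume.restrict (Set.Ioc (0 : ℝ) 1)) :=
    integrable_const _
  simpa using h1.mul_prod h2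

lemma IsProfile.integral_abs_grad_le (hp : IsProfile p M) (j : Fin d) :
    ∫ z : Euc d × ℝ, |p z.1 * z.1 j| ∂(volume.prod (volume.restrict (Set.Ioc (0 : ℝ) 1))) ≤ 1 := by
  have h2 : Integrable (fun _ : ℝ => (1 : ℝ)) (volume.restrict (Set.Ioc (0 : ℝ) 1)) :=
    integrable_const _
  have h3 := hp.integrable.mul_prod h2
  calc _ ≤ ∫ z : Euc d × ℝ, p z.1 * 1 ∂(volume.prod (volume.restrict (Set.Ioc (0 : ℝ) 1))) := by
        refine integral_mono (hp.integrable_grad j).abs h3 fun z => ?_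
        simp only [abs_mul, abs_of_nonneg (hp.nonneg z.1)]
        by_cases hu : 1 < ‖z.1‖
        · simp [hp.supp z.1 hu]
        · push Not at hu
          exact mul_le_mul_of_nonneg_left ((PiLp.norm_apply_le z.1 j).trans hu) (hp.nonneg _)
    _ = 1 := by
        refine (integral_prod_mul (μ := volume) (ν := volume.restrict (Set.Ioc (0 : ℝ) 1))
          p (fun _ => (1 : ℝ))).trans ?_
        simp [hp.integral_eq]

lemma IsProfile.one_sub_fourier (hp : IsProfile p M) (r : ℝ) (ξ : Euc d) :
    1 - ∫ u, (p u : ℂ) * Complex.exp (↑(-2 * Real.pi * ⟪r • u, ξ⟫) * Complex.I) =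
      2 * Real.pi * Complex.I * r * ∑ j, (ξ j : ℂ) *
        ∫ z : Euc d × ℝ, ((p z.1 * z.1 j : ℝ) : ℂ) *
          Complex.exp (↑(-2 * Real.pi * ⟪(z.2 * r) • z.1, ξ⟫) * Complex.I)
          ∂(volume.prod (volume.restrict (Set.Ioc (0 : ℝ) 1))) := by
  have hpi : Integrable (fun u => (p u : ℂ)) := hp.integrable.ofReal
  have h_int : Integrable (fun u => (p u : ℂ) *
      Complex.exp (↑(-2 * Real.pi * ⟪r • u, ξ⟫) * Complex.I)) :=
    hpi.mul_bdd (c := 1) (Continuous.aestronglyMeasurable (by fun_prop))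
      (ae_of_all _ fun v => (Complex.norm_exp_ofReal_mul_I _).le)
  have hintj : ∀ j, Integrable (fun z : Euc d × ℝ => ((p z.1 * z.1 j : ℝ) : ℂ) *
      Complex.exp (↑(-2 * Real.pi * ⟪(z.2 * r) • z.1, ξ⟫) * Complex.I))
      (volume.prod (volume.restrict (Set.Ioc (0 : ℝ) 1))) := fun j => by
    have hc : Continuous fun z : Euc d × ℝ =>
        Complex.exp (↑(-2 * Real.pi * ⟪(z.2 * r) • z.1, ξ⟫) * Complex.I) := by fun_prop
    exact (hp.integrable_grad j).ofReal.mul_bdd (c := 1) hc.aestronglyMeasurable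
      (ae_of_all _ fun v => (Complex.norm_exp_ofReal_mul_I _).le)
  have h1 : (1 : ℂ) = ∫ u, (p u : ℂ) := by rw [integral_complex_ofReal, hp.integral_eq]; simp
  conv_lhs => rw [h1]
  rw [← integral_sub hpi h_int]
  simp only [← integral_const_mul]
  rw [← integral_finsetSum _ (fun j _ => (hintj j).const_mul _), ← integral_const_mul]
  rw [integral_prod _ ((integrable_finsetSum _ (fun j _ => (hintj j).const_mul _)).const_mul _)]
  congr 1
  ext u
  have h2 := one_sub_exp_eq (2 * Real.pi * ⟪r • u, ξ⟫)
  rw [show (p u : ℂ) - p u * Complex.exp (↑(-2 * Real.pi * ⟪r • u, ξ⟫) * Complex.I) = p u * (1 -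
    Complex.exp ((-(2 * Real.pi * ⟪r • u, ξ⟫) : ℝ) * Complex.I)) by
      rw [mul_sub, mul_one]; congr 4; push_cast; ring]
  rw [h2, ← integral_const_mul]
  congr 1
  ext τ
  have h3 : ∀ j, (ξ j : ℂ) * (((p u * u j : ℝ) : ℂ) *
      Complex.exp (↑(-2 * Real.pi * ⟪(τ * r) • u, ξ⟫) * Complex.I)) =
      (u j * ξ j : ℝ) * (p u * Complex.exp (↑(-2 * Real.pi * ⟪(τ * r) • u, ξ⟫) * Complex.I)) := by
    intro j; push_cast; ring
  simp only [h3, ← Finset.sum_mul, ← Complex.ofReal_sum]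
  have h4 : ∑ j, u j * ξ j = ⟪u, ξ⟫ := by
    rw [PiLp.inner_apply]
    simp [mul_comm]
  rw [h4]
  simp only [real_inner_smul_left]
  rw [show -(τ * (2 * Real.pi * (r * ⟪u, ξ⟫))) = -2 * Real.pi * (τ * r * ⟪u, ξ⟫) by ring]
  push_cast
  ring

lemma IsProfile.integrable_avgOp (hp : IsProfile p M) (r : ℝ) {g : Euc d → ℂ} (hg : Integrable g) :
    Integrable (avgOp p r g) :=
  integrable_superposition (φ := fun u => r • u) (by fun_prop)
    (integrable_weighted_translate hp.integrable hg)

lemma IsProfile.integrable_gradAvgOp (hp : IsProfile p M) (r : ℝ) (j : Fin d) {g : Euc d → ℂ}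
    (hg : Integrable g) : Integrable (gradAvgOp p r j g) :=
  integrable_superposition (φ := fun z : Euc d × ℝ => (z.2 * r) • z.1) (by fun_prop)
    (integrable_weighted_translate (hp.integrable_grad j) hg)

lemma fourier_sub {f g : Euc d → ℂ} (hf : Integrable f) (hg : Integrable g) (ξ : Euc d) :
    𝓕 (fun x => f x - g x) ξ = 𝓕 f ξ - 𝓕 g ξ := by
  simp only [Real.fourier_eq, smul_sub]
  rw [integral_sub ((Real.fourierIntegral_convergent_iff ξ).2 hf)
    ((Real.fourierIntegral_convergent_iff ξ).2 hg)]

lemma fourier_add {f g : Euc d → ℂ} (hf : Integrable f) (hg : Integrable g) (ξ : Euc d) :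
    𝓕 (fun x => f x + g x) ξ = 𝓕 f ξ + 𝓕 g ξ := by
  simp only [Real.fourier_eq, smul_add]
  rw [integral_add ((Real.fourierIntegral_convergent_iff ξ).2 hf)
    ((Real.fourierIntegral_convergent_iff ξ).2 hg)]

lemma fourier_const_mul (c : ℂ) (f : Euc d → ℂ) (ξ : Euc d) :
    𝓕 (fun x => c * f x) ξ = c * 𝓕 f ξ := by
  simp only [Real.fourier_eq, ← integral_const_mul, Circle.smul_def, smul_eq_mul]
  congr 1
  ext v
  ring

lemma IsProfile.fourier_avgOp (hp : IsProfile p M) (r : ℝ) {g : Euc d → ℂ} (hg : Integrable g)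
    (ξ : Euc d) : 𝓕 (avgOp p r g) ξ =
      (∫ u, (p u : ℂ) * Complex.exp (↑(-2 * Real.pi * ⟪r • u, ξ⟫) * Complex.I)) * 𝓕 g ξ :=
  fourier_weighted_translate hp.integrable hg (φ := fun u => r • u) (by fun_prop) ξ

/-- `g - avgOp p r g` is a divergence. -/
lemma IsProfile.fourier_sub_avgOp (hp : IsProfile p M) (r : ℝ) {g : Euc d → ℂ} (hg : Integrable g)
    (ξ : Euc d) : 𝓕 (fun x => g x - avgOp p r g x) ξ =
      2 * Real.pi * Complex.I * r * ∑ j, (ξ j : ℂ) * 𝓕 (gradAvgOp p r j g) ξ := by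
  have h1 : ∀ j, 𝓕 (gradAvgOp p r j g) ξ = _ := fun j =>
    fourier_weighted_translate (hp.integrable_grad j) hg
      (φ := fun z : Euc d × ℝ => (z.2 * r) • z.1) (by fun_prop) ξ
  rw [fourier_sub hg (hp.integrable_avgOp r hg), hp.fourier_avgOp r hg]
  simp only [h1]
  rw [← one_sub_mul, hp.one_sub_fourier]
  simp only [Finset.sum_mul, Finset.mul_sum]
  refine Finset.sum_congr rfl fun j _ => ?_
  ring

lemma IsProfile.norm_avgOp_le (hp : IsProfile p M) {r : ℝ} (hr : 0 ≤ r) {g : Euc d → ℂ}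
    {S S' : Set (Euc d)} {B : ℝ} (hB : 0 ≤ B)
    (hg : ∀ x, ‖g x‖ ≤ S.indicator (fun _ => B) x)
    (hS : ∀ x ∈ S, ∀ h, ‖h‖ ≤ r → x + h ∈ S') (x : Euc d) :
    ‖avgOp p r g x‖ ≤ S'.indicator (fun _ => B) x := by
  have := norm_average_le hB hg hp.integrable (c := 1) (r := r) (φ := fun u => r • u)
    (by simp only [abs_of_nonneg (hp.nonneg _)]; exact hp.integral_eq.le) (fun u hu => by
      have : ‖u‖ ≤ 1 := by
        by_contra h
        exact hu (hp.supp u (not_le.1 h))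
      rw [norm_smul, Real.norm_of_nonneg hr]
      exact mul_le_of_le_one_right hr this) hS x
  simp only [one_mul] at this
  exact this

lemma IsProfile.norm_gradAvgOp_le (hp : IsProfile p M) {r : ℝ} (hr : 0 ≤ r) (j : Fin d)
    {g : Euc d → ℂ} {S S' : Set (Euc d)} {B : ℝ} (hB : 0 ≤ B)
    (hg : ∀ x, ‖g x‖ ≤ S.indicator (fun _ => B) x)
    (hS : ∀ x ∈ S, ∀ h, ‖h‖ ≤ r → x + h ∈ S') (x : Euc d) :
    ‖gradAvgOp p r j g x‖ ≤ S'.indicator (fun _ => B) x := by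
  have h1 : gradAvgOp p r j g x = ∫ z : Euc d × ℝ, ((p z.1 * z.1 j *
      (Set.Ioc (0 : ℝ) 1).indicator (fun _ => 1) z.2 : ℝ) : ℂ) * g (x - (z.2 * r) • z.1)
      ∂(volume.prod (volume.restrict (Set.Ioc (0 : ℝ) 1))) := by
    refine integral_congr_ae ?_
    have : ∀ᵐ z : Euc d × ℝ ∂(volume.prod (volume.restrict (Set.Ioc (0 : ℝ) 1))),
        z.2 ∈ Set.Ioc (0 : ℝ) 1 :=
      Measure.quasiMeasurePreserving_snd.ae (ae_restrict_mem measurableSet_Ioc)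
    filter_upwards [this] with z hz
    rw [Set.indicator_of_mem hz, mul_one]
  rw [h1]
  have hle : ∀ z : Euc d × ℝ, |p z.1 * z.1 j * (Set.Ioc (0 : ℝ) 1).indicator (fun _ => 1) z.2|
      ≤ |p z.1 * z.1 j| := fun z => by
    rw [abs_mul]
    refine mul_le_of_le_one_right (abs_nonneg _) ?_
    by_cases hz : z.2 ∈ Set.Ioc (0 : ℝ) 1
    · simp [Set.indicator_of_mem hz]
    · simp [Set.indicator_of_notMem hz]
  have h_int : Integrable (fun z : Euc d × ℝ => p z.1 * z.1 j *
      (Set.Ioc (0 : ℝ) 1).indicator (fun _ => 1) z.2)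
      (volume.prod (volume.restrict (Set.Ioc (0 : ℝ) 1))) := by
    refine (hp.integrable_grad j).abs.mono' ?_ (ae_of_all _ hle)
    have hm : Measurable ((Set.Ioc (0 : ℝ) 1).indicator (fun _ => (1 : ℝ))) :=
      measurable_const.indicator measurableSet_Ioc
    exact (hp.integrable_grad j).aestronglyMeasurable.mul
      (hm.comp measurable_snd).aestronglyMeasurable
  have := norm_average_le hB hg h_int (c := 1) (r := r) (φ := fun z : Euc d × ℝ => (z.2 * r) • z.1)
    ((integral_mono h_int.abs (hp.integrable_grad j).abs hle).trans (hp.integral_abs_grad_le j))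
    (fun z hz => by
      have h2 : ‖z.1‖ ≤ 1 := by
        by_contra h
        exact hz (by rw [hp.supp z.1 (not_le.1 h)]; simp)
      have h3 : z.2 ∈ Set.Ioc (0 : ℝ) 1 := by
        by_contra h
        exact hz (by rw [Set.indicator_of_notMem h, mul_zero])
      rw [norm_smul, Real.norm_of_nonneg (mul_nonneg h3.1.le hr)]
      calc z.2 * r * ‖z.1‖ ≤ 1 * r * 1 := by gcongr; exact h3.2
        _ = r := by ring) hS x
  simp only [one_mul] at this
  exact this

end Average

end

section

variable {d : ℕ}

lemma norm_le_sum_norm_apply (v : Euc d) : ‖v‖ ≤ ∑ j, ‖v j‖ := by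
  rw [EuclideanSpace.norm_eq]
  refine Real.sqrt_le_iff.2 ⟨Finset.sum_nonneg fun j _ => norm_nonneg _, ?_⟩
  exact Finset.sum_sq_le_sq_sum_of_nonneg fun j _ => norm_nonneg _

/-- The vectors whose coordinate of largest modulus is the `m`-th one (the first such). -/
def IsFace (m : Fin d) (v : Euc d) : Prop :=
  v m ≠ 0 ∧ (∀ j, |v j| ≤ |v m|) ∧ ∀ j, j < m → |v j| < |v m|

/-- The grid point just below `N • (v / v m)`. -/
def dirIndex (N : ℕ) (m : Fin d) (v : Euc d) : Fin d → ℤ := fun j => ⌊(N : ℝ) * (v j / v m)⌋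

/-- The cone of directions attached to the grid point `ν` of the `m`-th face. -/
def dirCone (N : ℕ) (m : Fin d) (ν : Fin d → ℤ) : Set (Euc d) :=
  {v | IsFace m v ∧ dirIndex N m v = ν}

lemma measurableSet_dirCone (N : ℕ) (m : Fin d) (ν : Fin d → ℤ) :
    MeasurableSet (dirCone N m ν) := by
  have hc : ∀ j, Measurable fun v : Euc d => v j := fun j => by fun_prop
  have ha : ∀ j, Measurable fun v : Euc d => |v j| := fun j => by fun_prop
  have h1 : MeasurableSet {v : Euc d | IsFace m v} := by
    have : {v : Euc d | IsFace m v} = {v : Euc d | v m = 0}ᶜ ∩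
        ((⋂ j, {v : Euc d | |v j| ≤ |v m|}) ∩
          ⋂ j, ⋂ (_ : j < m), {v : Euc d | |v j| < |v m|}) := by
      ext v; simp [IsFace]
    rw [this]
    exact (measurableSet_eq_fun (hc m) measurable_const).compl.inter
      ((MeasurableSet.iInter fun j => measurableSet_le (ha j) (ha m)).inter
        (MeasurableSet.iInter fun j => MeasurableSet.iInter fun _ =>
          measurableSet_lt (ha j) (ha m)))
  have h2 : Measurable (dirIndex (d := d) N m) := by
    refine measurable_pi_lambda _ fun j => ?_
    exact (((hc j).div (hc m)).const_mul (N : ℝ)).floor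
  exact h1.inter (h2 (measurableSet_singleton ν))

lemma smul_mem_dirCone {N : ℕ} {m : Fin d} {ν : Fin d → ℤ} {t : ℝ} (ht : 0 < t) (v : Euc d) :
    t • v ∈ dirCone N m ν ↔ v ∈ dirCone N m ν := by
  have h1 : dirIndex N m (t • v) = dirIndex N m v := by
    ext j
    simp only [dirIndex, PiLp.smul_apply, smul_eq_mul]
    rw [mul_div_mul_left _ _ ht.ne']
  have h2 : IsFace m (t • v) ↔ IsFace m v := by
    simp only [IsFace, PiLp.smul_apply, smul_eq_mul, abs_mul, ne_eq, mul_eq_zero, ht.ne', false_or,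
      mul_le_mul_iff_right₀ (abs_pos.2 ht.ne'), mul_lt_mul_iff_right₀ (abs_pos.2 ht.ne')]
  simp only [dirCone, Set.mem_ofPred_eq, h1, h2]

lemma exists_isFace {v : Euc d} (hv : v ≠ 0) : ∃ m, IsFace m v := by
  have hne : (Finset.univ : Finset (Fin d)).Nonempty := by
    by_contra h
    apply hv
    ext j
    exact absurd ⟨j, Finset.mem_univ j⟩ h
  obtain ⟨m₀, -, hm₀⟩ := Finset.exists_max_image Finset.univ (fun j => |v j|) hne
  set S := Finset.univ.filter fun j => |v j| = |v m₀|
  have hS : S.Nonempty := ⟨m₀, by simp [S]⟩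
  have hm : |v (S.min' hS)| = |v m₀| := (Finset.mem_filter.1 (S.min'_mem hS)).2
  refine ⟨S.min' hS, ?_, fun j => ?_, fun j hj => ?_⟩
  · intro h
    apply hv
    ext j
    have := hm₀ j (Finset.mem_univ j)
    rw [← hm, h, abs_zero] at this
    simpa using this
  · rw [hm]; exact hm₀ j (Finset.mem_univ j)
  · rw [hm]
    refine lt_of_le_of_ne (hm₀ j (Finset.mem_univ j)) fun h => ?_
    exact absurd (S.min'_le j (by simp [S, h])) (not_le.2 hj)

lemma IsFace.unique {m m' : Fin d} {v : Euc d} (h : IsFace m v) (h' : IsFace m' v) : m = m' := by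
  rcases lt_trichotomy m m' with hlt | heq | hlt
  · exact absurd (h'.2.2 m hlt) (not_lt.2 (h.2.1 m'))
  · exact heq
  · exact absurd (h.2.2 m' hlt) (not_lt.2 (h'.2.1 m))

lemma IsFace.abs_div_le {m : Fin d} {v : Euc d} (h : IsFace m v) (j : Fin d) :
    |v j / v m| ≤ 1 := by
  rw [abs_div]
  exact div_le_one_of_le₀ (h.2.1 j) (abs_nonneg _)

lemma IsFace.norm_le {m : Fin d} {v : Euc d} (h : IsFace m v) : ‖v‖ ≤ d * |v m| := by
  calc ‖v‖ ≤ ∑ j, ‖v j‖ := norm_le_sum_norm_apply v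
    _ ≤ ∑ _j : Fin d, |v m| := Finset.sum_le_sum fun j _ => h.2.1 j
    _ = d * |v m| := by simp

lemma dirIndex_mem_dirGrid {N : ℕ} {m : Fin d} {v : Euc d} (h : IsFace m v) :
    dirIndex N m v ∈ dirGrid d m N := by
  rw [dirGrid, Fintype.mem_piFinset]
  intro j
  by_cases hj : j = m
  · subst hj
    simp [dirIndex, div_self h.1]
  · have h1 := abs_le.1 (h.abs_div_le j)
    simp only [hj, if_false, Finset.mem_Icc, dirIndex]
    have hN : (0 : ℝ) ≤ N := by positivity
    constructor
    · rw [Int.le_floor]; push_cast; nlinarith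
    · have : (⌊(N : ℝ) * (v j / v m)⌋ : ℝ) ≤ N := (Int.floor_le _).trans (by nlinarith)
      exact_mod_cast this

lemma sum_indicator_dirCone (N : ℕ) {v : Euc d} (hv : v ≠ 0) :
    ∑ m, ∑ ν ∈ dirGrid d m N, (dirCone N m ν).indicator (fun _ => (1 : ℝ)) v = 1 := by
  classical
  obtain ⟨m, hm⟩ := exists_isFace hv
  rw [Finset.sum_eq_single m]
  · rw [Finset.sum_eq_single_of_mem _ (dirIndex_mem_dirGrid hm)]
    · exact Set.indicator_of_mem (show v ∈ dirCone N m _ from ⟨hm, rfl⟩) _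
    · intro ν _ hν
      exact Set.indicator_of_notMem (fun h => hν h.2.symm) _
  · intro m' _ hm'
    exact Finset.sum_eq_zero fun ν _ =>
      Set.indicator_of_notMem (fun h => hm' (h.1.unique hm)) _
  · intro h; exact absurd (Finset.mem_univ m) h

/-- The direction `ν / N`. -/
def gridDir (N : ℕ) (ν : Fin d → ℤ) : Euc d := WithLp.toLp 2 fun j => (ν j : ℝ) / N

lemma norm_gridDir_le {N : ℕ} {m : Fin d} {ν : Fin d → ℤ} (hν : ν ∈ dirGrid d m N) :
    ‖gridDir N ν‖ ≤ d := by
  rw [dirGrid, Fintype.mem_piFinset] at hν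
  calc ‖gridDir N ν‖ ≤ ∑ j, ‖gridDir N ν j‖ := norm_le_sum_norm_apply _
    _ ≤ ∑ _j : Fin d, (1 : ℝ) := by
      refine Finset.sum_le_sum fun j _ => ?_
      simp only [gridDir]
      rw [Real.norm_eq_abs, abs_div, Nat.abs_cast]
      refine div_le_one_of_le₀ ?_ (by positivity)
      have := hν j
      by_cases hj : j = m
      · simp only [hj, if_true, Finset.mem_singleton] at this ⊢
        rw [this]; simp
      · simp only [hj, if_false, Finset.mem_Icc] at this
        rw [abs_le]; exact_mod_cast this
    _ = d := by simp

lemma abs_dirIndex_sub_le {N : ℕ} {m : Fin d} {ν : Fin d → ℤ} {v : Euc d}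
    (hv : v ∈ dirCone N m ν) (j : Fin d) : |(ν j : ℝ) - N * (v j / v m)| ≤ 1 := by
  have h1 : ν j = ⌊(N : ℝ) * (v j / v m)⌋ := by rw [← hv.2]; rfl
  rw [h1, abs_le]
  have h2 := Int.floor_le ((N : ℝ) * (v j / v m))
  have h3 := Int.lt_floor_add_one ((N : ℝ) * (v j / v m))
  constructor <;> linarith

lemma norm_sub_smul_gridDir_le {N : ℕ} (hN : 1 ≤ N) {m : Fin d} {ν : Fin d → ℤ} {v : Euc d}
    (hv : v ∈ dirCone N m ν) : ‖v - v m • gridDir N ν‖ ≤ d * (‖v‖ / N) := by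
  have hN' : (0 : ℝ) < N := by positivity
  calc ‖v - v m • gridDir N ν‖ ≤ ∑ j, ‖(v - v m • gridDir N ν) j‖ := norm_le_sum_norm_apply _
    _ ≤ ∑ _j : Fin d, ‖v‖ / N := by
      refine Finset.sum_le_sum fun j _ => ?_
      have hm := hv.1.1
      have h1 : (v - v m • gridDir N ν) j = v m / N * -((ν j : ℝ) - N * (v j / v m)) := by
        simp only [gridDir, PiLp.sub_apply, PiLp.smul_apply, smul_eq_mul]
        field_simp
        ring
      rw [h1, Real.norm_eq_abs, abs_mul, abs_neg, abs_div, Nat.abs_cast]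
      have h2 := abs_dirIndex_sub_le hv j
      have h3 : |v m| ≤ ‖v‖ := PiLp.norm_apply_le v m
      calc |v m| / N * _ ≤ ‖v‖ / N * 1 := by gcongr
        _ = _ := mul_one _
    _ = _ := by simp

/-- A neighbourhood of width `D R / N` of a segment through `c` of length `∼ R` and
direction `e`. -/
def tube (c e : Euc d) (D R : ℝ) (N : ℕ) : Set (Euc d) :=
  {x | ∃ t : ℝ, |t| ≤ 2 * R ∧ ‖x - c - t • e‖ ≤ D * (R / N)}

lemma add_mem_tube {c e : Euc d} {D D' R : ℝ} {N : ℕ} {x h : Euc d} (hx : x ∈ tube c e D R N)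
    (hh : ‖h‖ ≤ D' * (R / N)) : x + h ∈ tube c e (D + D') R N := by
  obtain ⟨t, ht, h1⟩ := hx
  refine ⟨t, ht, ?_⟩
  rw [show x + h - c - t • e = (x - c - t • e) + h by abel, add_mul]
  exact (norm_add_le _ _).trans (add_le_add h1 hh)

lemma tube_mono {c e : Euc d} {D D' R : ℝ} (hR : 0 ≤ R) {N : ℕ} (h : D ≤ D') :
    tube c e D R N ⊆ tube c e D' R N := by
  rintro x ⟨t, ht, h1⟩
  exact ⟨t, ht, h1.trans (by gcongr)⟩

section Atom

variable {ω : Euc d → ℝ} {h : Euc d → Euc d → ℝ} {C R : ℝ}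

/-- The restriction of an angular function to a cone. -/
def conePart (N : ℕ) (m : Fin d) (ν : Fin d → ℤ) (ω : Euc d → ℝ) : Euc d → ℝ :=
  (dirCone N m ν).indicator ω

/-- The kernel `ω(v) ‖v‖ h(y, v)`. -/
def angKernel (ω : Euc d → ℝ) (h : Euc d → Euc d → ℝ) (y v : Euc d) : ℝ := ω v * (‖v‖ * h y v)

lemma IsScaleKernel.isBddKernel_angKernel (hh : IsScaleKernel h C R) (hω : Measurable ω)
    (hω1 : ∀ v, |ω v| ≤ 1) : IsBddKernel (angKernel ω h) (2 * C / R ^ d) (2 * R) where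
  measurable := (hω.comp measurable_snd).mul (measurable_snd.norm.mul hh.cont.measurable)
  supp := fun y v hv => by simp [angKernel, hh.supp y v hv]
  bound := fun y v => by
    have hR := hh.pos
    have hC := hh.const_nonneg
    by_cases hv : 2 * R < ‖v‖
    · simp only [angKernel, hh.supp y v hv, mul_zero, abs_zero]
      positivity
    · push Not at hv
      rw [angKernel, abs_mul, abs_mul, abs_norm]
      calc |ω v| * (‖v‖ * |h y v|) ≤ 1 * (2 * R * (C / R ^ (d + 1))) := by
            gcongr
            · exact hω1 v
            · exact hh.bound y v
        _ = _ := by field_simp; ring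

lemma IsScaleKernel.isBddKernel_radial (hh : IsScaleKernel h C R) (hω : Measurable ω) {B : ℝ}
    (hω1 : ∀ v, |ω v| ≤ B) :
    IsBddKernel (fun y v => ω v * (radialDeriv h y v + d * h y v))
      (B * ((2 + d) * C / R ^ (d + 1))) (2 * R) where
  measurable := (hω.comp measurable_snd).mul
    (hh.measurable_radialDeriv.add (hh.cont.measurable.const_mul _))
  supp := fun y v hv => by simp [hh.supp y v hv, hh.radialDeriv_eq_zero y v hv]
  bound := fun y v => by
    rw [abs_mul]
    refine mul_le_mul (hω1 v) ?_ (abs_nonneg _) ((abs_nonneg _).trans (hω1 v))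
    refine (abs_add_le _ _).trans ?_
    rw [abs_mul, Nat.abs_cast]
    calc |radialDeriv h y v| + d * |h y v| ≤ 2 * C / R ^ (d + 1) + d * (C / R ^ (d + 1)) := by
          gcongr
          · exact hh.abs_radialDeriv_le y v
          · exact hh.bound y v
      _ = _ := by ring

/-- The frequency side identity behind the divergence structure of a conical piece. -/
lemma IsScaleKernel.fourier_angKernel (hh : IsScaleKernel h C R) (hω : Measurable ω)
    (hω1 : ∀ v, |ω v| ≤ 1) (hhom : ∀ t : ℝ, 0 < t → ∀ v, v ≠ 0 → ω (t • v) = ω v)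
    {N : ℕ} {m : Fin d} {ν : Fin d → ℤ} (hcone : ∀ v, ω v ≠ 0 → v ∈ dirCone N m ν) (y ξ : Euc d) :
    2 * Real.pi * Complex.I * ((∑ j, (ν j : ℝ) * ξ j : ℝ) : ℂ) *
        𝓕 (fun v => (angKernel ω h y v : ℂ)) ξ =
      2 * Real.pi * Complex.I * ∑ j, (ξ j : ℂ) *
        𝓕 (fun v => (angKernel (fun v => ω v * ((ν j : ℝ) - N * (v j / v m))) h y v : ℂ)) ξ +
      N * 𝓕 (fun v => ((ω v * (‖v‖ / v m) * (radialDeriv h y v + d * h y v) : ℝ) : ℂ)) ξ := by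
  have hmj : ∀ j, Measurable fun v : Euc d => v j := fun j => by fun_prop
  have hωd : ∀ v, |ω v * (‖v‖ / v m)| ≤ d := by
    intro v
    by_cases hv : ω v = 0
    · simp [hv]
    have h1 := (hcone v hv).1
    rw [abs_mul, abs_div, abs_norm]
    have h2 : ‖v‖ / |v m| ≤ d := by
      rw [div_le_iff₀ (abs_pos.2 h1.1)]; exact h1.norm_le
    calc |ω v| * (‖v‖ / |v m|) ≤ 1 * d := by gcongr; exact hω1 v
      _ = d := one_mul _
  have hωdm : Measurable fun v => ω v * (‖v‖ / v m) := hω.mul (measurable_norm.div (hmj m))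
  have hωdh : ∀ t : ℝ, 0 < t → ∀ v, v ≠ 0 →
      ω (t • v) * (‖t • v‖ / (t • v) m) = ω v * (‖v‖ / v m) := by
    intro t ht v hv
    rw [hhom t ht v hv, norm_smul, Real.norm_of_nonneg ht.le, PiLp.smul_apply, smul_eq_mul,
      mul_div_mul_left _ _ ht.ne']
  rw [← hh.fourier_radial hωdm hωd hωdh y ξ]
  have hωj : ∀ j v, |ω v * ((ν j : ℝ) - N * (v j / v m))| ≤ 1 := by
    intro j v
    by_cases hv : ω v = 0
    · simp [hv]
    rw [abs_mul]
    exact mul_le_one₀ (hω1 v) (abs_nonneg _) (abs_dirIndex_sub_le (hcone v hv) j)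
  have hωjm : ∀ j, Measurable fun v => ω v * ((ν j : ℝ) - N * (v j / v m)) := fun j =>
    hω.mul (measurable_const.sub (((hmj j).div (hmj m)).const_mul _))
  have hci : ∀ (f : Euc d → ℂ), Integrable f →
      Integrable fun v => (Real.fourierChar (-⟪v, ξ⟫) : ℂ) * f v := fun f hf => by
    have := (Real.fourierIntegral_convergent_iff ξ).2 hf
    simpa only [Circle.smul_def, smul_eq_mul] using this
  have hi0 := hci _ ((hh.isBddKernel_angKernel hω hω1).integrable_right y)
  have hij := fun j => hci _ ((hh.isBddKernel_angKernel (hωjm j) (hωj j)).integrable_right y)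
  simp only [Real.fourier_eq, Circle.smul_def, smul_eq_mul]
  have key : ((∑ j, (ν j : ℝ) * ξ j : ℝ) : ℂ) * (∫ v, (Real.fourierChar (-⟪v, ξ⟫) : ℂ) *
      (angKernel ω h y v : ℂ)) = (∑ j, (ξ j : ℂ) * ∫ v, (Real.fourierChar (-⟪v, ξ⟫) : ℂ) *
      (angKernel (fun v => ω v * ((ν j : ℝ) - N * (v j / v m))) h y v : ℂ)) +
      N * ∫ v, (Real.fourierChar (-⟪v, ξ⟫) : ℂ) *
        ((ω v * (‖v‖ / v m) * ⟪v, ξ⟫ * h y v : ℝ) : ℂ) := by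
    have hpt : ∀ v, ω v * (‖v‖ / v m) * ⟪v, ξ⟫ * h y v * N =
        (∑ j, (ν j : ℝ) * ξ j) * angKernel ω h y v - ∑ j, ξ j *
          angKernel (fun v => ω v * ((ν j : ℝ) - N * (v j / v m))) h y v := by
      intro v
      have h4 : ⟪v, ξ⟫ = ∑ j, v j * ξ j := by
        rw [PiLp.inner_apply]
        simp [mul_comm]
      simp only [angKernel]
      rw [h4, Finset.sum_mul, ← Finset.sum_sub_distrib, Finset.mul_sum, Finset.sum_mul,
        Finset.sum_mul]
      refine Finset.sum_congr rfl fun j _ => ?_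
      ring
    have h5 : N * ∫ v, (Real.fourierChar (-⟪v, ξ⟫) : ℂ) *
        ((ω v * (‖v‖ / v m) * ⟪v, ξ⟫ * h y v : ℝ) : ℂ) = ∫ v, (((∑ j, (ν j : ℝ) * ξ j : ℝ) : ℂ) *
        ((Real.fourierChar (-⟪v, ξ⟫) : ℂ) * (angKernel ω h y v : ℂ)) - ∑ j, (ξ j : ℂ) *
        ((Real.fourierChar (-⟪v, ξ⟫) : ℂ) *
          (angKernel (fun v => ω v * ((ν j : ℝ) - N * (v j / v m))) h y v : ℂ))) := by
      rw [← integral_const_mul]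
      congr 1
      ext v
      have := congrArg (fun z : ℝ => (Real.fourierChar (-⟪v, ξ⟫) : ℂ) * (z : ℂ)) (hpt v)
      simp only [Complex.ofReal_mul _ (N : ℝ)] at this
      rw [Complex.ofReal_natCast, Complex.ofReal_sub, Complex.ofReal_sum, mul_sub,
        Finset.mul_sum] at this
      rw [mul_left_comm, mul_comm (N : ℂ), this]
      congr 1
      · push_cast; ring
      · refine Finset.sum_congr rfl fun j _ => ?_
        push_cast; ring
    rw [h5, integral_sub (hi0.const_mul _) (integrable_finsetSum _ fun j _ => (hij j).const_mul _),
      integral_const_mul, integral_finsetSum _ fun j _ => (hij j).const_mul _]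
    simp only [integral_const_mul]
    ring
  linear_combination (2 * Real.pi * Complex.I) * key

end Atom

end

section

variable {d : ℕ}

lemma IsBddKernel.integrable_fourier {κ : Euc d → Euc d → ℝ} {B ρ : ℝ} {b : Euc d → ℂ}
    (hκ : IsBddKernel κ B ρ) (hb : Integrable b) (ξ : Euc d) :
    Integrable fun y => Complex.exp (↑(-2 * Real.pi * ⟪y, ξ⟫) * Complex.I) * b y *
      𝓕 (fun v => (κ y v : ℂ)) ξ := by
  have h1 := hκ.integrable_uncurry hb
  have h2 : Integrable (fun z : Euc d × Euc d =>
      (Complex.exp (↑(-2 * Real.pi * ⟪z.1, ξ⟫) * Complex.I) * (Real.fourierChar (-⟪z.2, ξ⟫) : ℂ)) *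
        Function.uncurry (fun y v => (κ y v : ℂ) * b y) z) (volume.prod volume) := by
    refine h1.bdd_mul (c := 1) (Continuous.aestronglyMeasurable (by fun_prop)) (ae_of_all _ fun z => ?_)
    rw [norm_mul, Complex.norm_exp_ofReal_mul_I, Circle.norm_coe, one_mul]
  refine h2.integral_prod_left.congr (ae_of_all _ fun y => ?_)
  simp only [Function.uncurry]
  rw [Real.fourier_eq, ← integral_const_mul]
  refine integral_congr_ae (ae_of_all _ fun v => ?_)
  simp only [Circle.smul_def, smul_eq_mul]
  ring

/-- Divergence structure of a conical piece, on the frequency side. -/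
lemma IsScaleKernel.fourier_kerOp_angKernel {ω : Euc d → ℝ} {h : Euc d → Euc d → ℝ} {C R : ℝ}
    (hh : IsScaleKernel h C R) (hω : Measurable ω)
    (hω1 : ∀ v, |ω v| ≤ 1) (hhom : ∀ t : ℝ, 0 < t → ∀ v, v ≠ 0 → ω (t • v) = ω v)
    {N : ℕ} {m : Fin d} {ν : Fin d → ℤ} (hcone : ∀ v, ω v ≠ 0 → v ∈ dirCone N m ν)
    {b : Euc d → ℂ} (hb : Integrable b)
    {B₁ B₂ ρ₁ ρ₂ : ℝ}
    (h₁ : ∀ j, IsBddKernel (angKernel (fun v => ω v * ((ν j : ℝ) - N * (v j / v m))) h) B₁ ρ₁)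
    (h₂ : IsBddKernel (fun y v => ω v * (‖v‖ / v m) * (radialDeriv h y v + d * h y v)) B₂ ρ₂)
    (ξ : Euc d) :
    2 * Real.pi * Complex.I * ((∑ j, (ν j : ℝ) * ξ j : ℝ) : ℂ) * 𝓕 (kerOp (angKernel ω h) b) ξ =
      2 * Real.pi * Complex.I * ∑ j, (ξ j : ℂ) *
        𝓕 (kerOp (angKernel (fun v => ω v * ((ν j : ℝ) - N * (v j / v m))) h) b) ξ +
      N * 𝓕 (kerOp (fun y v => ω v * (‖v‖ / v m) * (radialDeriv h y v + d * h y v)) b) ξ := by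
  rw [(hh.isBddKernel_angKernel hω hω1).fourier_kerOp hb, h₂.fourier_kerOp hb]
  simp only [fun j => (h₁ j).fourier_kerOp hb ξ]
  simp only [← integral_const_mul]
  rw [← integral_finsetSum _ fun j _ => ((h₁ j).integrable_fourier hb ξ).const_mul _,
    ← integral_const_mul, ← integral_add]
  · refine integral_congr_ae (ae_of_all _ fun y => ?_)
    beta_reduce
    have := hh.fourier_angKernel hω hω1 hhom hcone y ξ
    set e := Complex.exp (↑(-2 * Real.pi * ⟪y, ξ⟫) * Complex.I) * b y
    have hs : ∑ j, (ξ j : ℂ) * (e * 𝓕 (fun v =>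
        (angKernel (fun v => ω v * ((ν j : ℝ) - N * (v j / v m))) h y v : ℂ)) ξ) =
        e * ∑ j, (ξ j : ℂ) * 𝓕 (fun v =>
        (angKernel (fun v => ω v * ((ν j : ℝ) - N * (v j / v m))) h y v : ℂ)) ξ := by
      rw [Finset.mul_sum]; exact Finset.sum_congr rfl fun j _ => by ring
    rw [hs]
    linear_combination e * this
  · exact (integrable_finsetSum _ fun j _ => ((h₁ j).integrable_fourier hb ξ).const_mul _).const_mul _
  · exact (h₂.integrable_fourier hb ξ).const_mul _

lemma abs_conePart_le {N : ℕ} {m : Fin d} {ν : Fin d → ℤ} {ω : Euc d → ℝ}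
    (hω1 : ∀ v, |ω v| ≤ 1) (v : Euc d) : |conePart N m ν ω v| ≤ 1 := by
  by_cases h : v ∈ dirCone N m ν <;> simp [conePart, h, hω1]

lemma mem_dirCone_of_conePart_ne {N : ℕ} {m : Fin d} {ν : Fin d → ℤ} {ω : Euc d → ℝ} {v : Euc d}
    (h : conePart N m ν ω v ≠ 0) : v ∈ dirCone N m ν := by
  by_contra h'
  exact h (Set.indicator_of_notMem h' _)

lemma norm_le_indicator_add {S : Set (Euc d)} {B₁ B₂ : ℝ} {z w : ℂ} {x : Euc d}
    (h₁ : ‖z‖ ≤ S.indicator (fun _ => B₁) x) (h₂ : ‖w‖ ≤ S.indicator (fun _ => B₂) x) :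
    ‖z‖ + ‖w‖ ≤ S.indicator (fun _ => B₁ + B₂) x := by
  by_cases h : x ∈ S <;> simp [h] at h₁ h₂ ⊢
  · linarith
  · simp [h₁, h₂]

/-- A smoothed conical piece of the operator, applied to an atom, has a divergence structure, and
it is controlled by the indicator of a tube. -/
lemma IsScaleKernel.exists_divergence_form {ω : Euc d → ℝ} {h : Euc d → Euc d → ℝ} {C R : ℝ}
    {p : Euc d → ℝ} {M : ℝ} (hp : IsProfile p M)
    (hh : IsScaleKernel h C R) (hω : Measurable ω)
    (hω1 : ∀ v, |ω v| ≤ 1) (hhom : ∀ t : ℝ, 0 < t → ∀ v, v ≠ 0 → ω (t • v) = ω v)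
    {N : ℕ} (hN : 1 ≤ N) (m : Fin d) (ν : Fin d → ℤ)
    {b : Euc d → ℂ} (hb : Integrable b) {c : Euc d} (hbc : ∀ y, b y ≠ 0 → ‖y - c‖ ≤ d * (R / N)) :
    ∃ G : Fin d → Euc d → ℂ,
      Integrable (fun x => kerOp (angKernel (conePart N m ν ω) h) b x -
        avgOp p (R / N) (kerOp (angKernel (conePart N m ν ω) h) b) x) ∧
      (∀ x, ‖kerOp (angKernel (conePart N m ν ω) h) b x -
        avgOp p (R / N) (kerOp (angKernel (conePart N m ν ω) h) b) x‖ ≤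
          (tube c (gridDir N ν) (3 * d + 1) R N).indicator
            (fun _ => (4 + d * (2 + d)) * C / R ^ d * ∫ y, ‖b y‖) x) ∧
      (∀ j, Integrable (G j)) ∧
      (∀ j x, ‖G j x‖ ≤ (tube c (gridDir N ν) (3 * d + 1) R N).indicator
            (fun _ => (4 + d * (2 + d)) * C / R ^ d * ∫ y, ‖b y‖) x) ∧
      ∀ ξ : Euc d, ((∑ j, (ν j : ℝ) * ξ j : ℝ) : ℂ) *
        𝓕 (fun x => kerOp (angKernel (conePart N m ν ω) h) b x -
          avgOp p (R / N) (kerOp (angKernel (conePart N m ν ω) h) b) x) ξ =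
            ∑ j, (ξ j : ℂ) * 𝓕 (G j) ξ := by
  have hR := hh.pos
  have hC := hh.const_nonneg
  have hN0 : (0 : ℝ) < N := by positivity
  have hI : 0 ≤ ∫ y, ‖b y‖ := integral_nonneg fun _ => norm_nonneg _
  set η := conePart N m ν ω with hη
  have hcone : ∀ v, η v ≠ 0 → v ∈ dirCone N m ν := fun v hv => mem_dirCone_of_conePart_ne hv
  have hηm : Measurable η := hω.indicator (measurableSet_dirCone N m ν)
  have hη1 : ∀ v, |η v| ≤ 1 := abs_conePart_le hω1
  have hηh : ∀ t : ℝ, 0 < t → ∀ v, v ≠ 0 → η (t • v) = η v := by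
    intro t ht v hv
    by_cases h' : v ∈ dirCone N m ν
    · rw [hη, conePart, Set.indicator_of_mem ((smul_mem_dirCone ht v).2 h'),
        Set.indicator_of_mem h', hhom t ht v hv]
    · rw [hη, conePart, Set.indicator_of_notMem (mt (smul_mem_dirCone ht v).1 h'),
        Set.indicator_of_notMem h']
  have hmj : ∀ j, Measurable fun v : Euc d => v j := fun j => by fun_prop
  have hηj : ∀ j v, |η v * ((ν j : ℝ) - N * (v j / v m))| ≤ 1 := by
    intro j v
    by_cases hv : η v = 0
    · simp [hv]
    rw [abs_mul]
    exact mul_le_one₀ (hη1 v) (abs_nonneg _) (abs_dirIndex_sub_le (hcone v hv) j)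
  have hηjm : ∀ j, Measurable fun v => η v * ((ν j : ℝ) - N * (v j / v m)) := fun j =>
    hηm.mul (measurable_const.sub (((hmj j).div (hmj m)).const_mul _))
  have hηρ : ∀ v, |η v * (‖v‖ / v m)| ≤ d := by
    intro v
    by_cases hv : η v = 0
    · simp [hv]
    have h1 := (hcone v hv).1
    rw [abs_mul, abs_div, abs_norm]
    have h2 : ‖v‖ / |v m| ≤ d := by
      rw [div_le_iff₀ (abs_pos.2 h1.1)]; exact h1.norm_le
    calc |η v| * (‖v‖ / |v m|) ≤ 1 * d := by gcongr; exact hη1 v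
      _ = d := one_mul _
  have hηρm : Measurable fun v => η v * (‖v‖ / v m) := hηm.mul (measurable_norm.div (hmj m))
  have k₀ := hh.isBddKernel_angKernel hηm hη1
  have k₁ := fun j => hh.isBddKernel_angKernel (hηjm j) (hηj j)
  have k₂ := hh.isBddKernel_radial hηρm hηρ
  have hspt : ∀ y v, b y ≠ 0 → η v ≠ 0 → ‖v‖ ≤ 2 * R → y + v ∈ tube c (gridDir N ν) (3 * d) R N := by
    intro y v hy hv hv2
    refine ⟨v m, (PiLp.norm_apply_le v m).trans hv2, ?_⟩
    rw [show y + v - c - v m • gridDir N ν = (y - c) + (v - v m • gridDir N ν) by abel]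
    calc _ ≤ d * (R / N) + d * (2 * R / N) := by
          refine (norm_add_le _ _).trans (add_le_add (hbc y hy) ?_)
          refine (norm_sub_smul_gridDir_le hN (hcone v hv)).trans ?_
          gcongr
      _ = _ := by ring
  have b₀ := k₀.norm_kerOp_le hb (S := tube c (gridDir N ν) (3 * d) R N) fun y v hy hv =>
    hspt y v hy (left_ne_zero_of_mul hv) (by by_contra h'; exact hv (k₀.supp y v (not_le.1 h')))
  have b₁ := fun j => (k₁ j).norm_kerOp_le hb (S := tube c (gridDir N ν) (3 * d) R N)
    fun y v hy hv => hspt y v hy (left_ne_zero_of_mul (left_ne_zero_of_mul hv))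
      (by by_contra h'; exact hv ((k₁ j).supp y v (not_le.1 h')))
  have b₂ := k₂.norm_kerOp_le hb (S := tube c (gridDir N ν) (3 * d) R N)
    fun y v hy hv => hspt y v hy (left_ne_zero_of_mul (left_ne_zero_of_mul hv))
      (by by_contra h'; exact hv (k₂.supp y v (not_le.1 h')))
  have hst : ∀ x ∈ tube c (gridDir N ν) (3 * d) R N, ∀ u : Euc d, ‖u‖ ≤ R / N →
      x + u ∈ tube c (gridDir N ν) (3 * d + 1) R N := fun x hx u hu =>
    add_mem_tube hx (by rwa [one_mul])
  have hsub : tube c (gridDir N ν) (3 * d) R N ⊆ tube c (gridDir N ν) (3 * d + 1) R N :=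
    tube_mono hR.le (by linarith)
  have hr : 0 ≤ R / N := by positivity
  have hB₀ : 0 ≤ 2 * C / R ^ d * ∫ y, ‖b y‖ := by positivity
  have hB₂ : 0 ≤ d * ((2 + d) * C / R ^ (d + 1)) * ∫ y, ‖b y‖ := by positivity
  have up : ∀ {g : Euc d → ℂ} {B B' : ℝ}, 0 ≤ B → B ≤ B' →
      (∀ x, ‖g x‖ ≤ (tube c (gridDir N ν) (3 * d) R N).indicator (fun _ => B) x) →
      ∀ x, ‖g x‖ ≤ (tube c (gridDir N ν) (3 * d + 1) R N).indicator (fun _ => B') x := by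
    intro g B B' hB hBB hg x
    exact (hg x).trans ((Set.indicator_le_indicator_of_subset hsub (fun _ => hB) x).trans
      (Set.indicator_le_indicator hBB))
  set F := kerOp (angKernel η h) b
  set Fj := fun j => kerOp (angKernel (fun v => η v * ((ν j : ℝ) - N * (v j / v m))) h) b
  set Fρ := kerOp (fun y v => η v * (‖v‖ / v m) * (radialDeriv h y v + d * h y v)) b
  have i₀ : Integrable F := k₀.integrable_kerOp hb
  have i₁ : ∀ j, Integrable (Fj j) := fun j => (k₁ j).integrable_kerOp hb
  have i₂ : Integrable Fρ := k₂.integrable_kerOp hb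
  have hK : (4 + d * (2 + d)) * C / R ^ d * ∫ y, ‖b y‖ =
      (2 * C / R ^ d * (∫ y, ‖b y‖) + 2 * C / R ^ d * ∫ y, ‖b y‖) +
        R * (d * ((2 + d) * C / R ^ (d + 1)) * ∫ y, ‖b y‖) := by
    field_simp
    ring
  have hK2 : 2 * C / R ^ d * (∫ y, ‖b y‖) + 2 * C / R ^ d * (∫ y, ‖b y‖) ≤
      (4 + d * (2 + d)) * C / R ^ d * ∫ y, ‖b y‖ := by
    rw [hK]
    have : 0 ≤ R * (d * ((2 + d) * C / R ^ (d + 1)) * ∫ y, ‖b y‖) := by positivity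
    linarith
  refine ⟨fun j x => (Fj j x - avgOp p (R / N) (Fj j) x) + (R : ℂ) * gradAvgOp p (R / N) j Fρ x,
    i₀.sub (hp.integrable_avgOp _ i₀), fun x => ?_, fun j => ?_, fun j x => ?_, fun ξ => ?_⟩
  · refine (norm_sub_le _ _).trans ?_
    refine (norm_le_indicator_add (up hB₀ le_rfl b₀ x) (hp.norm_avgOp_le hr hB₀ b₀ hst x)).trans ?_
    exact Set.indicator_le_indicator hK2
  · exact ((i₁ j).sub (hp.integrable_avgOp _ (i₁ j))).add
      ((hp.integrable_gradAvgOp _ j i₂).const_mul _)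
  · rw [hK]
    refine (norm_add_le _ _).trans (norm_le_indicator_add ?_ ?_)
    · exact (norm_sub_le _ _).trans
        (norm_le_indicator_add (up hB₀ le_rfl (b₁ j) x) (hp.norm_avgOp_le hr hB₀ (b₁ j) hst x))
    · rw [norm_mul, Complex.norm_real, Real.norm_of_nonneg hR.le]
      have := mul_le_mul_of_nonneg_left (hp.norm_gradAvgOp_le hr j hB₂ b₂ hst x) hR.le
      rwa [← Set.indicator_const_mul] at this
  · have e1 := hh.fourier_kerOp_angKernel hηm hη1 hηh hcone hb k₁ k₂ ξ
    have e2 : ∀ j, 𝓕 (fun x => (Fj j x - avgOp p (R / N) (Fj j) x) +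
        (R : ℂ) * gradAvgOp p (R / N) j Fρ x) ξ =
        (1 - ∫ u, (p u : ℂ) * Complex.exp (↑(-2 * Real.pi * ⟪(R / N) • u, ξ⟫) * Complex.I)) *
          𝓕 (Fj j) ξ + R * 𝓕 (gradAvgOp p (R / N) j Fρ) ξ := by
      intro j
      have hA : Integrable (fun x => Fj j x - avgOp p (R / N) (Fj j) x) :=
        (i₁ j).sub (hp.integrable_avgOp _ (i₁ j))
      rw [fourier_add hA ((hp.integrable_gradAvgOp _ j i₂).const_mul _), fourier_const_mul,
        fourier_sub (i₁ j) (hp.integrable_avgOp _ (i₁ j)), hp.fourier_avgOp _ (i₁ j)]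
      ring
    have e3 := hp.fourier_sub_avgOp (R / N) i₂ ξ
    rw [fourier_sub i₂ (hp.integrable_avgOp _ i₂), hp.fourier_avgOp _ i₂] at e3
    rw [fourier_sub i₀ (hp.integrable_avgOp _ i₀), hp.fourier_avgOp _ i₀]
    simp only [e2, mul_add, Finset.sum_add_distrib]
    have hπ : (2 * Real.pi * Complex.I : ℂ) ≠ 0 := Complex.two_pi_I_ne_zero
    refine mul_left_cancel₀ hπ ?_
    have hNc : (N : ℂ) ≠ 0 := by exact_mod_cast hN0.ne'
    set P := ∫ u, (p u : ℂ) * Complex.exp (↑(-2 * Real.pi * ⟪(R / N) • u, ξ⟫) * Complex.I)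
    have e4 : ∑ j, (ξ j : ℂ) * ((1 - P) * 𝓕 (Fj j) ξ) =
        (1 - P) * ∑ j, (ξ j : ℂ) * 𝓕 (Fj j) ξ := by
      rw [Finset.mul_sum]; exact Finset.sum_congr rfl fun j _ => by ring
    have e5 : ∑ j, (ξ j : ℂ) * ((R : ℂ) * 𝓕 (gradAvgOp p (R / N) j Fρ) ξ) =
        R * ∑ j, (ξ j : ℂ) * 𝓕 (gradAvgOp p (R / N) j Fρ) ξ := by
      rw [Finset.mul_sum]; exact Finset.sum_congr rfl fun j _ => by ring
    rw [e4, e5]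
    have e6 : (N : ℂ) * (1 - P) * 𝓕 Fρ ξ = 2 * Real.pi * Complex.I *
        (R * ∑ j, (ξ j : ℂ) * 𝓕 (gradAvgOp p (R / N) j Fρ) ξ) := by
      have : (N : ℂ) * (1 - P) * 𝓕 Fρ ξ = N * (𝓕 Fρ ξ - P * 𝓕 Fρ ξ) := by ring
      rw [this, e3]
      push_cast
      field_simp
    linear_combination (1 - P) * e1 + e6

end

section

variable {d : ℕ}

/-- The volume of the unit ball. -/
def unitVol (d : ℕ) : ℝ := (volume (ball (0 : Euc d) 1)).toReal

lemma unitVol_nonneg (d : ℕ) : 0 ≤ unitVol d := ENNReal.toReal_nonneg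

lemma volume_closedBall_eq (x : Euc d) {r : ℝ} (hr : 0 ≤ r) :
    volume (closedBall x r) = ENNReal.ofReal (unitVol d * r ^ d) := by
  rw [Measure.addHaar_closedBall _ _ hr, finrank_euclideanSpace, Fintype.card_fin, mul_comm,
    ENNReal.ofReal_mul (unitVol_nonneg d), unitVol, ENNReal.ofReal_toReal measure_ball_lt_top.ne]

lemma lintegral_enorm_le_of_support {g : Euc d → ℂ} {B r : ℝ} (hB : 0 ≤ B) (hr : 0 ≤ r) (x : Euc d)
    (hg : ∀ v, ‖g v‖ ≤ B) (hs : ∀ v, r < ‖v - x‖ → g v = 0) :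
    ∫⁻ v, ‖g v‖ₑ ≤ ENNReal.ofReal (B * (unitVol d * r ^ d)) := by
  calc ∫⁻ v, ‖g v‖ₑ ≤ ∫⁻ v, (closedBall x r).indicator (fun _ => ENNReal.ofReal B) v := by
        refine lintegral_mono fun v => ?_
        by_cases hv : v ∈ closedBall x r
        · rw [Set.indicator_of_mem hv, ← ofReal_norm]
          exact ENNReal.ofReal_le_ofReal (hg v)
        · rw [hs v (by simpa [dist_eq_norm] using hv)]
          simp
    _ = _ := by
        rw [lintegral_indicator_const isClosed_closedBall.measurableSet, volume_closedBall_eq x hr,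
          ENNReal.ofReal_mul hB]

variable {p : Euc d → ℝ} {M : ℝ}

lemma IsProfile.exists_le (hp : IsProfile p M) : ∃ B, ∀ u, ‖p u‖ ≤ B := by
  have hcs : HasCompactSupport p := by
    refine HasCompactSupport.of_support_subset_isCompact (isCompact_closedBall 0 1) fun v hv => ?_
    rw [mem_closedBall_zero_iff]
    by_contra h
    exact hv (hp.supp v (not_le.1 h))
  exact hcs.exists_bound_of_continuous hp.cont

lemma IsProfile.lintegral_enorm_avgOp_le (hp : IsProfile p M) (r : ℝ) {g : Euc d → ℂ}
    (hg : Integrable g) : ∫⁻ x, ‖avgOp p r g x‖ₑ ≤ ∫⁻ x, ‖g x‖ₑ := by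
  refine (lintegral_enorm_superposition_le (φ := fun u => r • u)
    (Φ := fun u x => (p u : ℂ) * g x) (by fun_prop)
    (integrable_weighted_translate hp.integrable hg)).trans ?_
  have h0 : ∀ u, ∫⁻ x, ‖(p u : ℂ) * g x‖ₑ = ‖(p u : ℂ)‖ₑ * ∫⁻ x, ‖g x‖ₑ := fun u => by
    simp only [enorm_mul]
    exact lintegral_const_mul' _ _ enorm_ne_top
  rw [lintegral_congr h0, lintegral_mul_const'' _ (by have := hp.cont; fun_prop)]
  have : ∫⁻ u, ‖(p u : ℂ)‖ₑ = 1 := by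
    have h1 : ∀ u, ‖(p u : ℂ)‖ₑ = ENNReal.ofReal (p u) := fun u => by
      rw [← ofReal_norm, Complex.norm_real, Real.norm_of_nonneg (hp.nonneg u)]
    simp only [h1]
    rw [← ofReal_integral_eq_lintegral_ofReal hp.integrable (ae_of_all _ hp.nonneg),
      hp.integral_eq, ENNReal.ofReal_one]
  rw [this, one_mul]

lemma integrable_comp_sub_smul {g : Euc d → ℂ} (hg : Integrable g) {r : ℝ} (hr : r ≠ 0)
    (x : Euc d) : Integrable fun u => g (x - r • u) :=
  (hg.comp_sub_left x).comp_smul hr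

lemma IsProfile.integrable_avgOp_integrand (hp : IsProfile p M) {g : Euc d → ℂ}
    (hg : Integrable g) {r : ℝ} (hr : r ≠ 0) (x : Euc d) :
    Integrable fun u => (p u : ℂ) * g (x - r • u) := by
  obtain ⟨B, hB⟩ := hp.exists_le
  refine (integrable_comp_sub_smul hg hr x).bdd_mul (c := B)
    (Continuous.aestronglyMeasurable (by have := hp.cont; fun_prop)) (ae_of_all _ fun u => ?_)
  rw [Complex.norm_real]
  exact hB u

lemma IsProfile.avgOp_sub (hp : IsProfile p M) {f g : Euc d → ℂ} (hf : Integrable f)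
    (hg : Integrable g) {r : ℝ} (hr : r ≠ 0) (x : Euc d) :
    avgOp p r (fun x => f x - g x) x = avgOp p r f x - avgOp p r g x := by
  simp only [avgOp, mul_sub]
  exact integral_sub (hp.integrable_avgOp_integrand hf hr x) (hp.integrable_avgOp_integrand hg hr x)

lemma IsProfile.avgOp_finsetSum (hp : IsProfile p M) {ι : Type*} (S : Finset ι)
    {f : ι → Euc d → ℂ} (hf : ∀ i ∈ S, Integrable (f i)) {r : ℝ} (hr : r ≠ 0) (x : Euc d) :
    avgOp p r (fun x => ∑ i ∈ S, f i x) x = ∑ i ∈ S, avgOp p r (f i) x := by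
  simp only [avgOp, Finset.mul_sum]
  exact integral_finsetSum _ fun i hi => hp.integrable_avgOp_integrand (hf i hi) hr x

/-- Averages written as convolutions against the rescaled density. -/
lemma avgOp_eq_integral (p : Euc d → ℝ) {r : ℝ} (hr : 0 < r) (g : Euc d → ℂ) (x y : Euc d) :
    avgOp p r g (x - y) = ∫ v, (((r ^ d)⁻¹ * p (r⁻¹ • (x - v - y)) : ℝ) : ℂ) * g v := by
  have h1 : ∫ v, (((r ^ d)⁻¹ * p (r⁻¹ • (x - v - y)) : ℝ) : ℂ) * g v =
      ∫ w, (((r ^ d)⁻¹ * p (r⁻¹ • w) : ℝ) : ℂ) * g (x - y - w) := by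
    rw [← integral_sub_left_eq_self (fun v => (((r ^ d)⁻¹ * p (r⁻¹ • (x - v - y)) : ℝ) : ℂ) * g v)
      volume (x - y)]
    refine integral_congr_ae (ae_of_all _ fun w => ?_)
    beta_reduce
    rw [show x - (x - y - w) - y = w by abel]
  have h2 := Measure.integral_comp_smul (volume : Measure (Euc d))
    (fun w => (((r ^ d)⁻¹ * p (r⁻¹ • w) : ℝ) : ℂ) * g (x - y - w)) r
  rw [finrank_euclideanSpace, Fintype.card_fin, abs_of_pos (by positivity)] at h2
  rw [h1, avgOp]
  have h3 : ∫ w, (((r ^ d)⁻¹ * p (r⁻¹ • w) : ℝ) : ℂ) * g (x - y - w) =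
      (r ^ d : ℝ) • ∫ u, (((r ^ d)⁻¹ * p (r⁻¹ • r • u) : ℝ) : ℂ) * g (x - y - r • u) := by
    rw [h2, smul_smul, mul_inv_cancel₀ (by positivity), one_smul]
  rw [h3, ← integral_smul]
  refine integral_congr_ae (ae_of_all _ fun u => ?_)
  beta_reduce
  rw [smul_smul, inv_mul_cancel₀ hr.ne', one_smul, Complex.real_smul, ← mul_assoc,
    ← Complex.ofReal_mul, ← mul_assoc, mul_inv_cancel₀ (by positivity), one_mul]

lemma IsProfile.lintegral_avgOp_translate_sub_le (hp : IsProfile p M) {r : ℝ} (hr : 0 < r)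
    {g : Euc d → ℂ} (hg : Integrable g) (y c : Euc d) :
    ∫⁻ x, ‖avgOp p r g (x - y) - avgOp p r g (x - c)‖ₑ ≤
      ENNReal.ofReal (2 * unitVol d * M * (‖y - c‖ / r)) * ∫⁻ x, ‖g x‖ₑ := by
  obtain ⟨B, hB⟩ := hp.exists_le
  have hB0 : 0 ≤ B := (norm_nonneg _).trans (hB 0)
  have hM : 0 ≤ M * ‖y - c‖ := by
    have := hp.lip y c
    exact (abs_nonneg _).trans this
  have hu := unitVol_nonneg d
  have hpc := hp.cont
  set q : Euc d → Euc d → ℂ := fun y z => (((r ^ d)⁻¹ * p (r⁻¹ • (z - y)) : ℝ) : ℂ) with hq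
  have hqc : ∀ y, Continuous (q y) := fun y => by simp only [hq]; fun_prop
  have hqi : ∀ y, Integrable (q y) := by
    intro y
    have h1 : Integrable fun z : Euc d => p (r⁻¹ • (z - y)) :=
      (hp.integrable.comp_smul (inv_ne_zero hr.ne')).comp_sub_right y
    exact (h1.const_mul _).ofReal
  have hi : ∀ y x, Integrable fun v => (((r ^ d)⁻¹ * p (r⁻¹ • (x - v - y)) : ℝ) : ℂ) * g v := by
    intro y x
    refine hg.bdd_mul (c := (r ^ d)⁻¹ * B) (Continuous.aestronglyMeasurable (by fun_prop))
      (ae_of_all _ fun v => ?_)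
    rw [Complex.norm_real, norm_mul, Real.norm_of_nonneg (by positivity : 0 ≤ (r ^ d)⁻¹)]
    gcongr
    exact hB _
  have hrep : ∀ x, avgOp p r g (x - y) - avgOp p r g (x - c) =
      ∫ v, (g v * (q y (x - v) - q c (x - v))) := by
    intro x
    rw [avgOp_eq_integral p hr, avgOp_eq_integral p hr, ← integral_sub (hi y x) (hi c x)]
    refine integral_congr_ae (ae_of_all _ fun v => ?_)
    simp only [hq]
    ring
  simp only [hrep]
  have hΦ : Integrable (Function.uncurry fun v z => g v * (q y z - q c z))
      ((volume : Measure (Euc d)).prod volume) := hg.mul_prod ((hqi y).sub (hqi c))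
  refine (lintegral_enorm_superposition_le (φ := fun v : Euc d => v) measurable_id hΦ).trans ?_
  have h0 : ∀ v, ∫⁻ z, ‖g v * (q y z - q c z)‖ₑ = ‖g v‖ₑ * ∫⁻ z, ‖q y z - q c z‖ₑ := fun v => by
    simp only [enorm_mul]
    exact lintegral_const_mul' _ _ enorm_ne_top
  rw [lintegral_congr h0, lintegral_mul_const'' _ hg.aestronglyMeasurable.enorm, mul_comm]
  gcongr
  have hsupp : ∀ y z : Euc d, r < ‖z - y‖ → q y z = 0 := by
    intro y z h
    simp only [hq]
    rw [hp.supp, mul_zero, Complex.ofReal_zero]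
    rw [norm_smul, norm_inv, Real.norm_of_nonneg hr.le, lt_inv_mul_iff₀ hr, mul_one]
    exact h
  have hlip : ∀ z, ‖q y z - q c z‖ ≤ (r ^ d)⁻¹ * (M * ‖y - c‖ / r) := by
    intro z
    simp only [hq]
    rw [← Complex.ofReal_sub, Complex.norm_real, ← mul_sub, norm_mul,
      Real.norm_of_nonneg (by positivity : 0 ≤ (r ^ d)⁻¹)]
    gcongr
    refine (hp.lip _ _).trans (le_of_eq ?_)
    rw [← smul_sub, norm_smul, norm_inv, Real.norm_of_nonneg hr.le,
      show z - y - (z - c) = -(y - c) by abel, norm_neg]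
    ring
  have hb0 : 0 ≤ (r ^ d)⁻¹ * (M * ‖y - c‖ / r) := by positivity
  calc ∫⁻ z, ‖q y z - q c z‖ₑ ≤
      ∫⁻ z, ((closedBall y r).indicator (fun _ => ENNReal.ofReal ((r ^ d)⁻¹ * (M * ‖y - c‖ / r))) z +
        (closedBall c r).indicator (fun _ => ENNReal.ofReal ((r ^ d)⁻¹ * (M * ‖y - c‖ / r))) z) := by
        refine lintegral_mono fun z => ?_
        have h1 : ‖q y z - q c z‖ₑ ≤ ENNReal.ofReal ((r ^ d)⁻¹ * (M * ‖y - c‖ / r)) := by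
          rw [← ofReal_norm]
          exact ENNReal.ofReal_le_ofReal (hlip z)
        by_cases hy : z ∈ closedBall y r
        · rw [Set.indicator_of_mem hy]
          exact h1.trans le_self_add
        · by_cases hc : z ∈ closedBall c r
          · rw [Set.indicator_of_mem hc]
            exact h1.trans le_add_self
          · rw [hsupp y z (by simpa [dist_eq_norm] using hy),
              hsupp c z (by simpa [dist_eq_norm] using hc)]
            simp
    _ = _ := by
        rw [lintegral_add_left (measurable_const.indicator isClosed_closedBall.measurableSet),
          lintegral_indicator_const isClosed_closedBall.measurableSet,
          lintegral_indicator_const isClosed_closedBall.measurableSet,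
          volume_closedBall_eq _ hr.le, volume_closedBall_eq _ hr.le, ← ENNReal.ofReal_mul hb0,
          ← ENNReal.ofReal_add (by positivity) (by positivity)]
        congr 1
        field_simp
        ring

section kerOp

variable {κ : Euc d → Euc d → ℝ} {B ρ : ℝ} {b : Euc d → ℂ}

lemma IsBddKernel.integrable_mul (hκ : IsBddKernel κ B ρ) (hb : Integrable b) (x : Euc d) :
    Integrable fun y => (κ y (x - y) : ℂ) * b y := by
  refine hb.bdd_mul (c := B) ?_ (ae_of_all _ fun y => ?_)
  · have : Measurable fun y => κ y (x - y) :=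
      hκ.measurable.comp (measurable_id.prodMk (measurable_const.sub measurable_id))
    exact this.complex_ofReal.aestronglyMeasurable
  · rw [Complex.norm_real]
    exact hκ.bound _ _

lemma IsBddKernel.avgOp_kerOp (hκ : IsBddKernel κ B ρ) (hp : IsProfile p M) (hb : Integrable b)
    (r : ℝ) (x : Euc d) :
    avgOp p r (kerOp κ b) x = ∫ y, b y * avgOp p r (fun v => (κ y v : ℂ)) (x - y) := by
  simp only [avgOp, kerOp, ← integral_const_mul]
  rw [integral_integral_swap]
  · refine integral_congr_ae (ae_of_all _ fun y => integral_congr_ae (ae_of_all _ fun u => ?_))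
    beta_reduce
    rw [show x - r • u - y = x - y - r • u by abel]
    ring
  · have h1 : Integrable (fun z : Euc d × Euc d => (p z.1 : ℂ) * b z.2) (volume.prod volume) :=
      (hp.integrable.ofReal (𝕜 := ℂ)).mul_prod hb
    have h2 : Measurable fun z : Euc d × Euc d => (κ z.2 (x - r • z.1 - z.2) : ℂ) := by
      refine Measurable.complex_ofReal (hκ.measurable.comp (measurable_snd.prodMk ?_))
      fun_prop
    refine (h1.bdd_mul (c := B) h2.aestronglyMeasurable (ae_of_all _ fun z => ?_)).congr
      (ae_of_all _ fun z => ?_)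
    · rw [Complex.norm_real]
      exact hκ.bound _ _
    · simp only [Function.uncurry]
      ring

/-- Averages of the operator at scale `r` are small on mean zero functions of scale `δ ≪ r`. -/
lemma IsBddKernel.lintegral_avgOp_kerOp_le (hκ : IsBddKernel κ B ρ) (hρ : 0 ≤ ρ)
    (hp : IsProfile p M) (hb : Integrable b)
    (hb0 : ∫ y, b y = 0) {c : Euc d} {δ r B' : ℝ} (hr : 0 < r) (hM : 0 ≤ M) (hB' : 0 ≤ B')
    (hbc : ∀ y, b y ≠ 0 → ‖y - c‖ ≤ δ)
    (hlip : ∀ y v, ‖y - c‖ ≤ δ → |κ y v - κ c v| ≤ B' * δ) :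
    ∫⁻ x, ‖avgOp p r (kerOp κ b) x‖ₑ ≤
      ENNReal.ofReal ((2 * unitVol d * M * B / r + B') * (unitVol d * ρ ^ d) * δ) *
        ∫⁻ y, ‖b y‖ₑ := by
  by_cases hδ : 0 ≤ δ
  swap
  · have : b = 0 := by
      ext y
      by_contra h
      exact hδ ((norm_nonneg _).trans (hbc y h))
    have h2 : ∀ x, avgOp p r (kerOp κ b) x = 0 := by
      intro x
      simp [avgOp, kerOp, this]
    simp [h2]
  have hB := hκ.nonneg
  have hu := unitVol_nonneg d
  have h_int : ∀ y, Integrable fun v => (κ y v : ℂ) := hκ.integrable_right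
  set a : Euc d → Euc d → ℂ := fun y => avgOp p r fun v => (κ y v : ℂ) with ha
  have hab : ∀ y z, ‖a y z‖ ≤ B := by
    intro y z
    have := hp.norm_avgOp_le hr.le (g := fun v => (κ y v : ℂ)) (S := Set.univ) (S' := Set.univ)
      hB (fun x => by simpa using hκ.bound y x) (fun _ _ _ _ => Set.mem_univ _) z
    simpa using this
  have ham : Measurable fun z : Euc d × Euc d => a z.1 z.2 := by
    have h1 : Measurable fun q : (Euc d × Euc d) × Euc d =>
        (p q.2 : ℂ) * (κ q.1.1 (q.1.2 - r • q.2) : ℂ) := by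
      have h2 : Measurable fun q : (Euc d × Euc d) × Euc d => κ q.1.1 (q.1.2 - r • q.2) :=
        hκ.measurable.comp (f := fun q : (Euc d × Euc d) × Euc d => (q.1.1, q.1.2 - r • q.2))
          (by fun_prop)
      have h3 := hp.cont.measurable
      exact (h3.comp measurable_snd).complex_ofReal.mul h2.complex_ofReal
    exact (h1.stronglyMeasurable.integral_prod_right
      (ν := (volume : Measure (Euc d)))).measurable
  have hbd : ∀ x, Integrable fun y => b y * a y (x - y) := by
    intro x
    refine hb.mul_bdd (c := B) ?_ (ae_of_all _ fun y => hab _ _)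
    exact (ham.comp (measurable_id.prodMk (measurable_const.sub measurable_id))).aestronglyMeasurable
  have hrep : ∀ x, avgOp p r (kerOp κ b) x = ∫ y, b y * (a y (x - y) - a c (x - c)) := by
    intro x
    rw [hκ.avgOp_kerOp hp hb]
    simp only [mul_sub]
    rw [integral_sub (hbd x) (hb.mul_const _), integral_mul_const, hb0, zero_mul, sub_zero]
  have hfix : ∀ y, ‖y - c‖ ≤ δ → ∫⁻ x, ‖a y (x - y) - a c (x - c)‖ₑ ≤
      ENNReal.ofReal ((2 * unitVol d * M * B / r + B') * (unitVol d * ρ ^ d) * δ) := by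
    intro y hy
    have e1 := hp.lintegral_avgOp_translate_sub_le hr (h_int y) y c
    have e2 : ∫⁻ v, ‖(κ y v : ℂ)‖ₑ ≤ ENNReal.ofReal (B * (unitVol d * ρ ^ d)) :=
      lintegral_enorm_le_of_support hB hρ 0 (fun v => by
        rw [Complex.norm_real]; exact hκ.bound y v)
        (fun v hv => by rw [hκ.supp y v (by simpa using hv), Complex.ofReal_zero])
    have e3 : ∫⁻ x, ‖avgOp p r (fun v => (κ y v : ℂ) - κ c v) (x - c)‖ₑ ≤
        ENNReal.ofReal (B' * δ * (unitVol d * ρ ^ d)) := by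
      rw [lintegral_sub_right_eq_self (fun x => ‖avgOp p r (fun v => (κ y v : ℂ) - κ c v) x‖ₑ) c]
      refine (hp.lintegral_enorm_avgOp_le r ((h_int y).sub (h_int c))).trans ?_
      refine lintegral_enorm_le_of_support (by positivity) hρ 0 (fun v => ?_) (fun v hv => ?_)
      · rw [Pi.sub_apply, ← Complex.ofReal_sub, Complex.norm_real]
        exact hlip y v hy
      · rw [Pi.sub_apply, hκ.supp y v (by simpa using hv), hκ.supp c v (by simpa using hv)]
        simp
    have hmeas : AEMeasurable (fun x => ‖a y (x - y) - a y (x - c)‖ₑ) := by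
      have h4 : ∀ w : Euc d, Measurable fun x => a y (x - w) := fun w =>
        ham.comp (measurable_const.prodMk (measurable_id.sub measurable_const))
      exact ((h4 y).sub (h4 c)).enorm.aemeasurable
    calc ∫⁻ x, ‖a y (x - y) - a c (x - c)‖ₑ ≤
        ∫⁻ x, (‖a y (x - y) - a y (x - c)‖ₑ +
          ‖avgOp p r (fun v => (κ y v : ℂ) - κ c v) (x - c)‖ₑ) := by
          refine lintegral_mono fun x => ?_
          rw [hp.avgOp_sub (h_int y) (h_int c) hr.ne']
          refine le_trans (le_of_eq ?_) (enorm_add_le _ _)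
          congr 1
          simp only [ha]
          ring
      _ ≤ ENNReal.ofReal (2 * unitVol d * M * (δ / r)) * ENNReal.ofReal (B * (unitVol d * ρ ^ d)) +
          ENNReal.ofReal (B' * δ * (unitVol d * ρ ^ d)) := by
          rw [lintegral_add_left' hmeas]
          refine add_le_add (e1.trans (mul_le_mul' (ENNReal.ofReal_le_ofReal ?_) e2)) e3
          gcongr
      _ = _ := by
          rw [← ENNReal.ofReal_mul (by positivity),
            ← ENNReal.ofReal_add (by positivity) (by positivity)]
          congr 1
          ring
  simp only [hrep]
  calc ∫⁻ x, ‖∫ y, b y * (a y (x - y) - a c (x - c))‖ₑ ≤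
      ∫⁻ x, ∫⁻ y, ‖b y * (a y (x - y) - a c (x - c))‖ₑ :=
        lintegral_mono fun x => enorm_integral_le_lintegral_enorm _
    _ = ∫⁻ y, ∫⁻ x, ‖b y * (a y (x - y) - a c (x - c))‖ₑ := by
        refine lintegral_lintegral_swap ?_
        have h1 : AEStronglyMeasurable (fun z : Euc d × Euc d => b z.2) (volume.prod volume) :=
          hb.aestronglyMeasurable.comp_snd
        have h2 : Measurable fun z : Euc d × Euc d => a z.2 (z.1 - z.2) - a c (z.1 - c) :=
          (ham.comp (measurable_snd.prodMk (measurable_fst.sub measurable_snd))).sub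
            (ham.comp (measurable_const.prodMk (measurable_fst.sub measurable_const)))
        exact (h1.mul h2.aestronglyMeasurable).enorm
    _ ≤ ∫⁻ y, ENNReal.ofReal ((2 * unitVol d * M * B / r + B') * (unitVol d * ρ ^ d) * δ) *
          ‖b y‖ₑ := by
        refine lintegral_mono fun y => ?_
        by_cases hy : b y = 0
        · simp [hy]
        simp only [enorm_mul]
        rw [lintegral_const_mul' _ _ enorm_ne_top, mul_comm]
        gcongr
        exact hfix y (hbc y hy)
    _ = _ := lintegral_const_mul' _ _ ENNReal.ofReal_ne_top

end kerOp

/-- The conical pieces add up to the full operator. -/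
lemma IsScaleKernel.sum_kerOp_conePart {ω : Euc d → ℝ} {h : Euc d → Euc d → ℝ} {C R : ℝ}
    (hh : IsScaleKernel h C R) (hω : Measurable ω) (hω1 : ∀ v, |ω v| ≤ 1) (N : ℕ)
    {b : Euc d → ℂ} (hb : Integrable b) (x : Euc d) :
    ∑ m, ∑ ν ∈ dirGrid d m N, kerOp (angKernel (conePart N m ν ω) h) b x =
      kerOp (angKernel ω h) b x := by
  have hi : ∀ m ν, Integrable fun y => (angKernel (conePart N m ν ω) h y (x - y) : ℂ) * b y :=
    fun m ν => (hh.isBddKernel_angKernel (hω.indicator (measurableSet_dirCone N m ν))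
      (abs_conePart_le hω1)).integrable_mul hb x
  simp only [kerOp]
  simp only [fun m => (integral_finsetSum (dirGrid d m N) fun ν _ => hi m ν).symm]
  rw [← integral_finsetSum _ fun m _ => integrable_finsetSum _ fun ν _ => hi m ν]
  refine integral_congr_ae (ae_of_all _ fun y => ?_)
  beta_reduce
  simp only [← Finset.sum_mul, ← Complex.ofReal_sum]
  congr 2
  by_cases hv : x - y = 0
  · simp [angKernel, hv]
  · calc _ = (∑ m, ∑ ν ∈ dirGrid d m N, (dirCone N m ν).indicator (fun _ => (1 : ℝ)) (x - y)) *
          angKernel ω h y (x - y) := by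
          simp only [Finset.sum_mul]
          refine Finset.sum_congr rfl fun m _ => Finset.sum_congr rfl fun ν _ => ?_
          by_cases h' : x - y ∈ dirCone N m ν <;> simp [angKernel, conePart, h']
      _ = _ := by rw [sum_indicator_dirCone N hv, one_mul]

end

section

variable {d : ℕ}

lemma measurableSet_tube (c e : Euc d) (D R : ℝ) (N : ℕ) : MeasurableSet (tube c e D R N) := by
  have h : tube c e D R N = (fun q : ℝ × Euc d => c + q.1 • e + q.2) ''
      (Set.Icc (-(2 * R)) (2 * R) ×ˢ closedBall 0 (D * (R / N))) := by
    ext x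
    simp only [tube, Set.mem_ofPred_eq, Set.mem_image, Set.mem_prod, Set.mem_Icc,
      mem_closedBall_zero_iff, Prod.exists]
    constructor
    · rintro ⟨t, ht, hx⟩
      exact ⟨t, x - c - t • e, ⟨abs_le.1 ht, hx⟩, by abel⟩
    · rintro ⟨t, w, ⟨ht, hw⟩, rfl⟩
      exact ⟨t, abs_le.2 ht, by rwa [show c + t • e + w - c - t • e = w by abel]⟩
  rw [h]
  exact ((isCompact_Icc.prod (isCompact_closedBall _ _)).image (by fun_prop)).measurableSet

lemma volume_tube_le {c e : Euc d} {D E R : ℝ} {N : ℕ} (hR : 0 < R) (hN : 1 ≤ N) (hD : 0 ≤ D)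
    (he : ‖e‖ ≤ E) :
    volume (tube c e D R N) ≤
      ENNReal.ofReal (5 * unitVol d * (D + E) ^ d * (R ^ d * (N / N ^ d))) := by
  have hN0 : (0 : ℝ) < N := by positivity
  have hE : 0 ≤ E := (norm_nonneg _).trans he
  have hu := unitVol_nonneg d
  set I : Finset ℤ := Finset.Icc (-(2 * N : ℤ)) (2 * N)
  have hcov : tube c e D R N ⊆
      ⋃ k ∈ I, closedBall (c + ((k : ℝ) * (R / N)) • e) ((D + E) * (R / N)) := by
    rintro x ⟨t, ht, hx⟩
    have hRN : 0 < R / N := by positivity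
    have h1 := Int.floor_le (t / (R / N))
    have h2 := Int.lt_floor_add_one (t / (R / N))
    set k := ⌊t / (R / N)⌋
    rw [le_div_iff₀ hRN] at h1
    rw [div_lt_iff₀ hRN] at h2
    have ht' := abs_le.1 ht
    have e1 : 2 * R = 2 * N * (R / N) := by field_simp
    refine Set.mem_iUnion₂.2 ⟨k, ?_, ?_⟩
    · rw [Finset.mem_Icc]
      constructor
      · rw [Int.le_floor, le_div_iff₀ hRN]
        push_cast
        linarith [ht'.1]
      · have h3 : (k : ℝ) * (R / N) ≤ (2 * N : ℝ) * (R / N) := by linarith [ht'.2]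
        have h4 : (k : ℝ) ≤ 2 * N := le_of_mul_le_mul_right h3 hRN
        exact_mod_cast h4
    · rw [mem_closedBall, dist_eq_norm,
        show x - (c + ((k : ℝ) * (R / N)) • e) = (x - c - t • e) + (t - k * (R / N)) • e by
          rw [sub_smul]; abel, add_mul]
      refine (norm_add_le _ _).trans (add_le_add hx ?_)
      rw [norm_smul, mul_comm]
      refine mul_le_mul he ?_ (norm_nonneg _) hE
      rw [Real.norm_eq_abs, abs_le]
      constructor <;> linarith
  calc volume (tube c e D R N) ≤ ∑ k ∈ I, volume (closedBall (c + ((k : ℝ) * (R / N)) • e)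
        ((D + E) * (R / N))) := (measure_mono hcov).trans (measure_biUnion_finset_le _ _)
    _ = (4 * N + 1 : ℕ) * ENNReal.ofReal (unitVol d * ((D + E) * (R / N)) ^ d) := by
      simp only [fun k : ℤ => volume_closedBall_eq (c + ((k : ℝ) * (R / N)) • e)
        (by positivity : 0 ≤ (D + E) * (R / N))]
      rw [Finset.sum_const, nsmul_eq_mul]
      congr 2
      simp only [I, Int.card_Icc]
      lia
    _ = ENNReal.ofReal ((4 * N + 1 : ℕ) * (unitVol d * ((D + E) * (R / N)) ^ d)) := by
      rw [ENNReal.ofReal_mul (p := ((4 * N + 1 : ℕ) : ℝ)) (Nat.cast_nonneg _),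
        ENNReal.ofReal_natCast]
    _ ≤ _ := by
      refine ENNReal.ofReal_le_ofReal ?_
      have h5 : ((4 * N + 1 : ℕ) : ℝ) ≤ 5 * N := by
        have : (1 : ℝ) ≤ N := by exact_mod_cast hN
        push_cast
        linarith
      calc ((4 * N + 1 : ℕ) : ℝ) * (unitVol d * ((D + E) * (R / N)) ^ d) ≤
          5 * N * (unitVol d * ((D + E) * (R / N)) ^ d) := by gcongr
        _ = _ := by rw [mul_pow, div_pow]; ring

lemma sum_mul_sum_le_two_mul {ι : Type*} (S : Finset ι) (a : ι → ℝ≥0∞) (ℓ : ι → ℝ) :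
    (∑ i ∈ S, a i) ^ 2 ≤
      2 * ∑ i ∈ S, ∑ j ∈ S with ℓ j ≤ ℓ i, a i * a j := by
  classical
  have h1 : ∑ i ∈ S, ∑ j ∈ S with ℓ j ≤ ℓ i, a i * a j =
      ∑ i ∈ S, ∑ j ∈ S, if ℓ j ≤ ℓ i then a i * a j else 0 :=
    Finset.sum_congr rfl fun i _ => Finset.sum_filter _ _
  have h2 : ∑ i ∈ S, ∑ j ∈ S, (if ℓ j ≤ ℓ i then a i * a j else 0) =
      ∑ i ∈ S, ∑ j ∈ S, if ℓ i ≤ ℓ j then a i * a j else 0 := by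
    rw [Finset.sum_comm]
    exact Finset.sum_congr rfl fun i _ => Finset.sum_congr rfl fun j _ => by rw [mul_comm (a j)]
  rw [pow_two, Finset.sum_mul_sum, h1, two_mul]
  conv_rhs => arg 2; rw [h2]
  rw [← Finset.sum_add_distrib]
  refine Finset.sum_le_sum fun i _ => ?_
  rw [← Finset.sum_add_distrib]
  refine Finset.sum_le_sum fun j _ => ?_
  rcases le_total (ℓ j) (ℓ i) with h | h
  · rw [if_pos h]; exact le_self_add
  · rw [if_pos h]; exact le_add_self

/-- The constant in the `L²` bound for sums of indicators of parallel tubes. -/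
def tubeConst (d : ℕ) (D E : ℝ) : ℝ :=
  2 * ((5 * unitVol d * (D + E) ^ d) * (5 * unitVol d * ((d + 2 * D) + E) ^ d * 2 ^ d))

lemma tubeConst_nonneg (d : ℕ) {D E : ℝ} (hD : 0 ≤ D) (hE : 0 ≤ E) : 0 ≤ tubeConst d D E := by
  have := unitVol_nonneg d
  rw [tubeConst]
  positivity

/-- Parallel tubes attached to disjoint cubes overlap little in `L²`. -/
lemma lintegral_sq_sum_indicator_tube_le {ι : Type*} (S : Finset ι) (c : ι → Euc d) (ℓ : ι → ℝ)
    (Q : ι → Set (Euc d)) {e : Euc d} {D E M : ℝ} {N : ℕ} (hN : 1 ≤ N) (hNM : (N : ℝ) ≤ M)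
    (hD : 0 ≤ D) (he : ‖e‖ ≤ E) (hℓ : ∀ i ∈ S, 0 < ℓ i) (hQm : ∀ i ∈ S, MeasurableSet (Q i))
    (hQd : (S : Set ι).PairwiseDisjoint Q) (hQv : ∀ i ∈ S, volume (Q i) = ENNReal.ofReal (ℓ i ^ d))
    (hQc : ∀ i ∈ S, ∀ x ∈ Q i, ‖x - c i‖ ≤ d * ℓ i) :
    ∫⁻ x, (∑ i ∈ S, (tube (c i) e D (M * ℓ i) N).indicator (fun _ => (1 : ℝ≥0∞)) x) ^ 2 ≤
      ENNReal.ofReal (tubeConst d D E * (M ^ d * (N / N ^ d)) ^ 2) * ∑ i ∈ S, volume (Q i) := by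
  classical
  have hN0 : (0 : ℝ) < N := by positivity
  have hM : 0 < M := hN0.trans_le hNM
  have hE : 0 ≤ E := (norm_nonneg _).trans he
  have hu := unitVol_nonneg d
  set T : ι → Set (Euc d) := fun i => tube (c i) e D (M * ℓ i) N with hT
  have hTm : ∀ i, MeasurableSet (T i) := fun i => measurableSet_tube _ _ _ _ _
  set c₁ : ℝ := 5 * unitVol d * (D + E) ^ d with hc₁
  set c₂ : ℝ := 5 * unitVol d * ((d + 2 * D) + E) ^ d * 2 ^ d with hc₂
  set W : ℝ := M ^ d * (N / N ^ d) with hW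
  have hc₁0 : 0 ≤ c₁ := by positivity
  have hc₂0 : 0 ≤ c₂ := by positivity
  have hW0 : 0 ≤ W := by positivity
  have hTv : ∀ j ∈ S, volume (T j) ≤ ENNReal.ofReal (c₁ * W) * volume (Q j) := by
    intro j hj
    have hj0 := hℓ j hj
    refine (volume_tube_le (by positivity) hN hD he).trans (le_of_eq ?_)
    rw [hQv j hj, ← ENNReal.ofReal_mul (by positivity)]
    congr 1
    rw [hW, mul_pow]
    ring
  have hfat : ∀ i ∈ S, ∀ j ∈ S, ℓ j ≤ ℓ i → (T i ∩ T j).Nonempty →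
      Q j ⊆ tube (c i) e (d + 2 * D) (2 * (M * ℓ i)) N := by
    rintro i hi j hj hij ⟨x, ⟨t, ht, hx⟩, ⟨t', ht', hx'⟩⟩ z hz
    have hi0 := hℓ i hi
    have hj0 := hℓ j hj
    refine ⟨t - t', ?_, ?_⟩
    · have : M * ℓ j ≤ M * ℓ i := by gcongr
      calc |t - t'| ≤ |t| + |t'| := abs_sub _ _
        _ ≤ _ := by linarith
    · have e1 : z - c i - (t - t') • e = (z - c j) + (-(x - c j - t' • e) + (x - c i - t • e)) := by
        rw [sub_smul]; abel
      rw [e1]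
      have h1 : ‖z - c j‖ ≤ d * (M * ℓ i / N) := by
        refine (hQc j hj z hz).trans ?_
        gcongr
        rw [le_div_iff₀ hN0, mul_comm]
        exact mul_le_mul hNM hij hj0.le hM.le
      have h2 : ‖x - c j - t' • e‖ ≤ D * (M * ℓ i / N) := hx'.trans (by gcongr)
      calc _ ≤ ‖z - c j‖ + (‖-(x - c j - t' • e)‖ + ‖x - c i - t • e‖) :=
            (norm_add_le _ _).trans (by gcongr; exact norm_add_le _ _)
        _ ≤ d * (M * ℓ i / N) + (D * (M * ℓ i / N) + D * (M * ℓ i / N)) := by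
            rw [norm_neg]; gcongr
        _ = (d + 2 * D) * (M * ℓ i / N) := by ring
        _ ≤ (d + 2 * D) * (2 * (M * ℓ i) / N) := by
            refine mul_le_mul_of_nonneg_left ?_ (by positivity)
            refine div_le_div_of_nonneg_right ?_ hN0.le
            linarith [mul_pos hM hi0]
  have hpair : ∀ i ∈ S, ∑ j ∈ S with ℓ j ≤ ℓ i, volume (T i ∩ T j) ≤
      ENNReal.ofReal (c₁ * W) * (ENNReal.ofReal (c₂ * W) * volume (Q i)) := by
    intro i hi
    have hi0 := hℓ i hi
    set J := {j ∈ S | ℓ j ≤ ℓ i ∧ (T i ∩ T j).Nonempty} with hJ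
    have h1 : ∑ j ∈ S with ℓ j ≤ ℓ i, volume (T i ∩ T j) = ∑ j ∈ J, volume (T i ∩ T j) := by
      symm
      refine Finset.sum_subset (fun j hj => ?_) fun j hj hj' => ?_
      · simp only [hJ, Finset.mem_filter] at hj ⊢
        exact ⟨hj.1, hj.2.1⟩
      · simp only [hJ, Finset.mem_filter] at hj hj'
        have : ¬ (T i ∩ T j).Nonempty := fun h => hj' ⟨hj.1, hj.2, h⟩
        rw [Set.not_nonempty_iff_eq_empty.1 this, measure_empty]
    rw [h1]
    have hJS : ∀ j ∈ J, j ∈ S := fun j hj => (Finset.mem_filter.1 hj).1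
    calc ∑ j ∈ J, volume (T i ∩ T j) ≤ ∑ j ∈ J, ENNReal.ofReal (c₁ * W) * volume (Q j) :=
          Finset.sum_le_sum fun j hj =>
            (measure_mono Set.inter_subset_right).trans (hTv j (hJS j hj))
      _ = ENNReal.ofReal (c₁ * W) * volume (⋃ j ∈ J, Q j) := by
          rw [← Finset.mul_sum, measure_biUnion_finset (fun j hj k hk hjk =>
            hQd (hJS j hj) (hJS k hk) hjk) fun j hj => hQm j (hJS j hj)]
      _ ≤ ENNReal.ofReal (c₁ * W) * volume (tube (c i) e (d + 2 * D) (2 * (M * ℓ i)) N) := by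
          gcongr
          refine Set.iUnion₂_subset fun j hj => ?_
          have := (Finset.mem_filter.1 hj).2
          exact hfat i hi j (hJS j hj) this.1 this.2
      _ ≤ _ := by
          gcongr
          refine (volume_tube_le (by positivity) hN (by positivity) he).trans (le_of_eq ?_)
          rw [hQv i hi, ← ENNReal.ofReal_mul (by positivity)]
          congr 1
          rw [hW, hc₂, mul_pow, mul_pow]
          ring
  have hind : ∀ i j x, (T i).indicator (fun _ => (1 : ℝ≥0∞)) x *
      (T j).indicator (fun _ => (1 : ℝ≥0∞)) x = (T i ∩ T j).indicator (fun _ => (1 : ℝ≥0∞)) x := by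
    intro i j x
    by_cases h1 : x ∈ T i <;> by_cases h2 : x ∈ T j <;> simp [h1, h2]
  calc ∫⁻ x, (∑ i ∈ S, (T i).indicator (fun _ => (1 : ℝ≥0∞)) x) ^ 2 ≤
      ∫⁻ x, 2 * ∑ i ∈ S, ∑ j ∈ S with ℓ j ≤ ℓ i, (T i ∩ T j).indicator (fun _ => (1 : ℝ≥0∞)) x := by
        refine lintegral_mono fun x => ?_
        simp only [← hind]
        exact sum_mul_sum_le_two_mul S _ ℓ
    _ = 2 * ∑ i ∈ S, ∑ j ∈ S with ℓ j ≤ ℓ i, volume (T i ∩ T j) := by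
        have hm : ∀ i j, Measurable ((T i ∩ T j).indicator fun _ => (1 : ℝ≥0∞)) := fun i j =>
          measurable_const.indicator ((hTm i).inter (hTm j))
        rw [lintegral_const_mul' _ _ (by simp),
          lintegral_finsetSum _ fun i _ => Finset.measurable_sum _ fun j _ => hm i j]
        congr 1
        refine Finset.sum_congr rfl fun i _ => ?_
        rw [lintegral_finsetSum _ fun j _ => hm i j]
        refine Finset.sum_congr rfl fun j _ => ?_
        rw [lintegral_indicator_const ((hTm i).inter (hTm j)), one_mul]
    _ ≤ 2 * ∑ i ∈ S, ENNReal.ofReal (c₁ * W) * (ENNReal.ofReal (c₂ * W) * volume (Q i)) := by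
        gcongr with i hi
        exact hpair i hi
    _ = _ := by
        rw [← Finset.mul_sum, ← Finset.mul_sum, ← mul_assoc, ← mul_assoc]
        congr 1
        rw [← ENNReal.ofReal_ofNat 2, ← ENNReal.ofReal_mul (by positivity),
          ← ENNReal.ofReal_mul (by positivity)]
        congr 1
        rw [tubeConst]
        ring

end

section

variable {d : ℕ} {ι : Type*}

lemma memLp_two_of_lintegral_sq {f : Euc d → ℂ} (hf : Integrable f) (h : ∫⁻ x, ‖f x‖ₑ ^ 2 < ∞) :
    MemLp f 2 := by
  refine ⟨hf.1, ?_⟩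
  rw [eLpNorm_lt_top_iff_lintegral_rpow_enorm_lt_top (by norm_num) (by norm_num)]
  simpa using h

/-- Mean-zero functions `b i` with masses at most `β |Q i|`, carried by disjoint sets `Q i` which
are comparable to cubes with centres `c i` and side lengths `ℓ i`. -/
structure IsAtomFamily (S : Finset ι) (b : ι → Euc d → ℂ) (c : ι → Euc d) (ℓ : ι → ℝ)
    (Q : ι → Set (Euc d)) (β : ℝ) : Prop where
  side_pos : ∀ i ∈ S, 0 < ℓ i
  measurableSet : ∀ i ∈ S, MeasurableSet (Q i)
  disjoint : (S : Set ι).PairwiseDisjoint Q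
  volume_eq : ∀ i ∈ S, volume (Q i) = ENNReal.ofReal (ℓ i ^ d)
  norm_sub_le : ∀ i ∈ S, ∀ x ∈ Q i, ‖x - c i‖ ≤ d * ℓ i
  integrable : ∀ i ∈ S, Integrable (b i)
  supp : ∀ i ∈ S, ∀ y, b i y ≠ 0 → y ∈ Q i
  mean : ∀ i ∈ S, ∫ y, b i y = 0
  mass : ∀ i ∈ S, ∫ y, ‖b i y‖ ≤ β * ℓ i ^ d

namespace IsAtomFamily

variable {S : Finset ι} {b : ι → Euc d → ℂ} {c : ι → Euc d} {ℓ : ι → ℝ}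
    {Q : ι → Set (Euc d)} {β : ℝ}

lemma sum_volume_lt_top (hS : IsAtomFamily S b c ℓ Q β) : ∑ i ∈ S, volume (Q i) < ∞ :=
  ENNReal.sum_lt_top.2 fun i hi => by rw [hS.volume_eq i hi]; exact ofReal_lt_top

lemma lintegral_sq_le_of_tube (hS : IsAtomFamily S b c ℓ Q β) {e : Euc d} {D E M γ : ℝ} {N : ℕ}
    (hN : 1 ≤ N) (hNM : (N : ℝ) ≤ M) (hD : 0 ≤ D) (he : ‖e‖ ≤ E) (hγ : 0 ≤ γ) {X : Euc d → ℂ}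
    (hX : ∀ x, ‖X x‖ ≤ ∑ i ∈ S, (tube (c i) e D (M * ℓ i) N).indicator (fun _ => γ) x) :
    ∫⁻ x, ‖X x‖ₑ ^ 2 ≤
      ENNReal.ofReal (γ ^ 2 * (tubeConst d D E * (M ^ d * (N / N ^ d)) ^ 2)) *
        ∑ i ∈ S, volume (Q i) := by
  have h1 : ∀ x, ‖X x‖ₑ ^ 2 ≤ ENNReal.ofReal (γ ^ 2) *
      (∑ i ∈ S, (tube (c i) e D (M * ℓ i) N).indicator (fun _ => (1 : ℝ≥0∞)) x) ^ 2 := by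
    intro x
    rw [ENNReal.ofReal_pow hγ, ← mul_pow]
    gcongr
    rw [← ofReal_norm]
    refine (ENNReal.ofReal_le_ofReal (hX x)).trans ?_
    rw [ENNReal.ofReal_sum_of_nonneg fun i _ => Set.indicator_nonneg (fun _ _ => hγ) _,
      Finset.mul_sum]
    refine Finset.sum_le_sum fun i _ => ?_
    by_cases hx : x ∈ tube (c i) e D (M * ℓ i) N <;> simp [hx]
  calc _ ≤ ∫⁻ x, ENNReal.ofReal (γ ^ 2) *
        (∑ i ∈ S, (tube (c i) e D (M * ℓ i) N).indicator (fun _ => (1 : ℝ≥0∞)) x) ^ 2 :=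
        lintegral_mono h1
    _ = ENNReal.ofReal (γ ^ 2) * ∫⁻ x,
        (∑ i ∈ S, (tube (c i) e D (M * ℓ i) N).indicator (fun _ => (1 : ℝ≥0∞)) x) ^ 2 :=
        lintegral_const_mul' _ _ ofReal_ne_top
    _ ≤ ENNReal.ofReal (γ ^ 2) * (ENNReal.ofReal (tubeConst d D E * (M ^ d * (N / N ^ d)) ^ 2) *
        ∑ i ∈ S, volume (Q i)) := by
        gcongr
        exact lintegral_sq_sum_indicator_tube_le S c ℓ Q hN hNM hD he hS.side_pos
          hS.measurableSet hS.disjoint hS.volume_eq hS.norm_sub_le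
    _ = _ := by rw [← mul_assoc, ← ENNReal.ofReal_mul (sq_nonneg _)]

/-- The microlocalised pieces are small in `L²` since the directions are spread out. -/
lemma lintegral_sq_conePart_le (hd : 2 ≤ d) (hS : IsAtomFamily S b c ℓ Q β) (hβ : 0 ≤ β)
    {p : Euc d → ℝ} {Mp : ℝ} (hp : IsProfile p Mp) {C M : ℝ} {h : ι → Euc d → Euc d → ℝ}
    (hC : 0 ≤ C)
    (hh : ∀ i ∈ S, IsScaleKernel (h i) C (M * ℓ i)) {ω : Euc d → ℝ} (hω : Measurable ω)
    (hω1 : ∀ v, |ω v| ≤ 1) (hhom : ∀ t : ℝ, 0 < t → ∀ v, v ≠ 0 → ω (t • v) = ω v)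
    {N : ℕ} (hN : 1 ≤ N) (hNM : (N : ℝ) ≤ M) {W : ℝ} (hW0 : 0 ≤ W) (m : Fin d)
    (hW : ∀ u : Euc d, ‖u‖ = 1 →
      ∑ ν ∈ dirGrid d m N, (1 + (∑ j, (ν j : ℝ) * u j) ^ 2)⁻¹ ≤ W * (N : ℝ) ^ (d - 2)) :
    ∫⁻ x, ‖∑ ν ∈ dirGrid d m N, ∑ i ∈ S, (kerOp (angKernel (conePart N m ν ω) (h i)) (b i) x -
      avgOp p (M * ℓ i / N) (kerOp (angKernel (conePart N m ν ω) (h i)) (b i)) x)‖ₑ ^ 2 ≤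
      ENNReal.ofReal (W * 3 ^ (d - 1) * (1 + d) * ((4 + d * (2 + d)) * C) ^ 2 *
        tubeConst d (3 * d + 1) d / N * β ^ 2) * ∑ i ∈ S, volume (Q i) := by
  classical
  have : NeZero d := ⟨by lia⟩
  have hN0 : (0 : ℝ) < N := by positivity
  have hM : 0 < M := hN0.trans_le hNM
  have hbc : ∀ i ∈ S, ∀ y, b i y ≠ 0 → ‖y - c i‖ ≤ d * (M * ℓ i / N) := by
    intro i hi y hy
    refine (hS.norm_sub_le i hi y (hS.supp i hi y hy)).trans ?_
    gcongr
    rw [le_div_iff₀ hN0, mul_comm]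
    exact mul_le_mul_of_nonneg_right hNM (hS.side_pos i hi).le
  have hG : ∀ (ν : Fin d → ℤ) (i : ι), ∃ G : Fin d → Euc d → ℂ, i ∈ S → _ := fun ν i => by
    by_cases hi : i ∈ S
    · obtain ⟨G, hG⟩ := (hh i hi).exists_divergence_form hp hω hω1 hhom hN m ν
        (hS.integrable i hi) (hbc i hi)
      exact ⟨G, fun _ => hG⟩
    · exact ⟨0, fun h => absurd h hi⟩
  choose G hG using hG
  set γ : ℝ := (4 + d * (2 + d)) * C * β / M ^ d with hγ
  have hγ0 : 0 ≤ γ := by positivity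
  set H : (Fin d → ℤ) → ι → Euc d → ℂ := fun ν i x =>
    kerOp (angKernel (conePart N m ν ω) (h i)) (b i) x -
      avgOp p (M * ℓ i / N) (kerOp (angKernel (conePart N m ν ω) (h i)) (b i)) x with hH
  have hγi : ∀ i ∈ S, (4 + d * (2 + d)) * C / (M * ℓ i) ^ d * ∫ y, ‖b i y‖ ≤ γ := by
    intro i hi
    have := hS.side_pos i hi
    calc _ ≤ (4 + d * (2 + d)) * C / (M * ℓ i) ^ d * (β * ℓ i ^ d) := by
          gcongr
          exact hS.mass i hi
      _ = γ := by rw [hγ, mul_pow]; field_simp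
  have hind : ∀ (i) (_ : i ∈ S) (e : Euc d) (x : Euc d),
      (tube (c i) e (3 * d + 1) (M * ℓ i) N).indicator
        (fun _ => (4 + d * (2 + d)) * C / (M * ℓ i) ^ d * ∫ y, ‖b i y‖) x ≤
      (tube (c i) e (3 * d + 1) (M * ℓ i) N).indicator (fun _ => γ) x :=
    fun i hi e x => Set.indicator_le_indicator (hγi i hi)
  set V : ℝ≥0∞ := ENNReal.ofReal (γ ^ 2 * (tubeConst d (3 * d + 1) d *
      (M ^ d * (N / N ^ d)) ^ 2)) * ∑ i ∈ S, volume (Q i) with hV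
  have hVtop : V < ∞ := ENNReal.mul_lt_top ofReal_lt_top hS.sum_volume_lt_top
  have hHV : ∀ ν ∈ dirGrid d m N, ∫⁻ x, ‖∑ i ∈ S, H ν i x‖ₑ ^ 2 ≤ V := fun ν hν =>
    hS.lintegral_sq_le_of_tube hN hNM (by positivity) (norm_gridDir_le hν) hγ0 fun x =>
      (norm_sum_le _ _).trans <| Finset.sum_le_sum fun i hi =>
        ((hG ν i hi).2.1 x).trans (hind i hi _ x)
  have hGV : ∀ ν ∈ dirGrid d m N, ∀ j, ∫⁻ x, ‖∑ i ∈ S, G ν i j x‖ₑ ^ 2 ≤ V := fun ν hν j =>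
    hS.lintegral_sq_le_of_tube hN hNM (by positivity) (norm_gridDir_le hν) hγ0 fun x =>
      (norm_sum_le _ _).trans <| Finset.sum_le_sum fun i hi =>
        ((hG ν i hi).2.2.2.1 j x).trans (hind i hi _ x)
  have hHi : ∀ ν, Integrable fun x => ∑ i ∈ S, H ν i x := fun ν =>
    integrable_finsetSum _ fun i hi => (hG ν i hi).1
  have hGi : ∀ ν j, Integrable fun x => ∑ i ∈ S, G ν i j x := fun ν j =>
    integrable_finsetSum _ fun i hi => (hG ν i hi).2.2.1 j
  have hmain := lintegral_sq_sum_le_of_divergence (dirGrid d m N)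
    (fun ν => WithLp.toLp 2 fun j => (ν j : ℝ)) (W * (N : ℝ) ^ (d - 2))
    (fun u hu => by
      refine le_trans (le_of_eq ?_) (hW u hu)
      refine Finset.sum_congr rfl fun ν _ => ?_
      congr 3
      simp [PiLp.inner_apply, mul_comm])
    (fun ν x => ∑ i ∈ S, H ν i x) (fun ν j x => ∑ i ∈ S, G ν i j x)
    (fun ν _ => hHi ν) (fun ν hν => memLp_two_of_lintegral_sq (hHi ν) ((hHV ν hν).trans_lt hVtop))
    (fun ν _ j => hGi ν j)
    (fun ν hν j => memLp_two_of_lintegral_sq (hGi ν j) ((hGV ν hν j).trans_lt hVtop))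
    (fun ν _ ξ => by
      rw [fourier_finset_sum S (f := fun i => H ν i) fun i hi => (hG ν i hi).1]
      simp only [fun j => fourier_finset_sum S (f := fun i => G ν i j) fun i hi =>
        (hG ν i hi).2.2.1 j, Finset.mul_sum]
      rw [Finset.sum_comm]
      refine Finset.sum_congr rfl fun i hi => ?_
      rw [← (hG ν i hi).2.2.2.2 ξ]
      congr 2
      simp [PiLp.inner_apply, mul_comm])
  refine hmain.trans ?_
  calc _ ≤ ENNReal.ofReal (W * (N : ℝ) ^ (d - 2)) *
        ∑ ν ∈ dirGrid d m N, (V + ∑ j : Fin d, V) := by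
        gcongr with ν hν j
        · exact hHV ν hν
        · exact hGV ν hν j
    _ = ENNReal.ofReal (W * (N : ℝ) ^ (d - 2)) * (((2 * N + 1) ^ (d - 1) * (1 + d) : ℕ) * V) := by
        rw [Finset.sum_const, card_dirGrid, Finset.sum_const, Finset.card_univ, Fintype.card_fin,
          nsmul_eq_mul, nsmul_eq_mul]
        push_cast
        ring
    _ ≤ _ := by
        rw [hV, ← ENNReal.ofReal_natCast, ← mul_assoc, ← mul_assoc, ← ENNReal.ofReal_mul (by positivity),
          ← ENNReal.ofReal_mul (by positivity)]
        refine mul_le_mul_left (ENNReal.ofReal_le_ofReal ?_) _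
        have ht := tubeConst_nonneg d (D := 3 * d + 1) (E := d) (by positivity) (by positivity)
        have h3 : (((2 * N + 1) ^ (d - 1) * (1 + d) : ℕ) : ℝ) ≤ (3 * N) ^ (d - 1) * (1 + d) := by
          push_cast
          gcongr
          have : (1 : ℝ) ≤ N := by exact_mod_cast hN
          linarith
        calc _ ≤ W * (N : ℝ) ^ (d - 2) * ((3 * N) ^ (d - 1) * (1 + d)) *
              (γ ^ 2 * (tubeConst d (3 * d + 1) d * (M ^ d * (N / N ^ d)) ^ 2)) := by
              gcongr
          _ = _ := by
              rw [hγ]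
              obtain ⟨e, rfl⟩ := Nat.exists_eq_add_of_le hd
              rw [show 2 + e - 2 = e by lia, show 2 + e - 1 = e + 1 by lia]
              rw [mul_pow (3 : ℝ), pow_succ (N : ℝ) e, pow_add (N : ℝ) 2 e]
              field_simp

end IsAtomFamily

end

section

variable {d : ℕ}

lemma volume_lt_norm_le_of_lintegral {f : Euc d → ℂ} (hf : AEStronglyMeasurable f) {a : ℝ}
    (ha : 0 < a) {B : ℝ} {V : ℝ≥0∞} (h : ∫⁻ x, ‖f x‖ₑ ≤ ENNReal.ofReal B * V) :
    volume {x | a ≤ ‖f x‖} ≤ ENNReal.ofReal (B / a) * V := by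
  have h1 : {x | a ≤ ‖f x‖} ⊆ {x | ENNReal.ofReal a ≤ ‖f x‖ₑ} := fun x hx => by
    rw [Set.mem_ofPred_eq, ← ofReal_norm]
    exact ENNReal.ofReal_le_ofReal hx
  refine (measure_mono h1).trans ((meas_ge_le_lintegral_div hf.enorm (by simpa using ha)
    ofReal_ne_top).trans ?_)
  rw [ENNReal.ofReal_div_of_pos ha]
  refine (ENNReal.div_le_div_right h _).trans (le_of_eq ?_)
  simp only [div_eq_mul_inv]
  ring

lemma volume_lt_norm_le_of_lintegral_sq {f : Euc d → ℂ} (hf : AEStronglyMeasurable f) {a : ℝ}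
    (ha : 0 < a) {B : ℝ} {V : ℝ≥0∞} (h : ∫⁻ x, ‖f x‖ₑ ^ 2 ≤ ENNReal.ofReal B * V) :
    volume {x | a ≤ ‖f x‖} ≤ ENNReal.ofReal (B / a ^ 2) * V := by
  have h1 : {x | a ≤ ‖f x‖} ⊆ {x | ENNReal.ofReal (a ^ 2) ≤ ‖f x‖ₑ ^ 2} := fun x hx => by
    rw [Set.mem_ofPred_eq, ← ofReal_norm, ENNReal.ofReal_pow ha.le]
    gcongr
    exact hx
  have ha2 : 0 < a ^ 2 := by positivity
  refine (measure_mono h1).trans ((meas_ge_le_lintegral_div (hf.enorm.pow_const 2)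
    (by simpa using ha2.ne') ofReal_ne_top).trans ?_)
  rw [ENNReal.ofReal_div_of_pos ha2]
  refine (ENNReal.div_le_div_right h _).trans (le_of_eq ?_)
  simp only [div_eq_mul_inv]
  ring

lemma IsScaleKernel.abs_angKernel_sub_le {h : Euc d → Euc d → ℝ} {C R : ℝ}
    (hh : IsScaleKernel h C R) {ω : Euc d → ℝ} (hω1 : ∀ v, |ω v| ≤ 1) (y c v : Euc d) :
    |angKernel ω h y v - angKernel ω h c v| ≤ 2 * C / R ^ (d + 1) * ‖y - c‖ := by
  have hR := hh.pos
  have hC := hh.const_nonneg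
  have hR' : 0 ≤ 2 * C / R ^ (d + 1) * ‖y - c‖ := by positivity
  by_cases hv : 2 * R < ‖v‖
  · simpa [angKernel, hh.supp _ v hv] using hR'
  · push Not at hv
    rw [angKernel, angKernel, ← mul_sub, ← mul_sub, abs_mul, abs_mul, abs_norm]
    calc |ω v| * (‖v‖ * |h y v - h c v|) ≤ 1 * ((2 * R) * (C / R ^ (d + 2) * ‖y - c‖)) := by
          gcongr
          · exact hω1 v
          · exact hh.lip_left y c v
      _ = _ := by rw [pow_succ R (d + 1)]; field_simp

namespace IsAtomFamily

variable {ι : Type*} {S : Finset ι} {b : ι → Euc d → ℂ} {c : ι → Euc d} {ℓ : ι → ℝ}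
    {Q : ι → Set (Euc d)} {β : ℝ}

lemma lintegral_enorm_le (hS : IsAtomFamily S b c ℓ Q β) (hβ : 0 ≤ β) {i : ι} (hi : i ∈ S) :
    ∫⁻ y, ‖b i y‖ₑ ≤ ENNReal.ofReal β * volume (Q i) := by
  rw [hS.volume_eq i hi, ← ENNReal.ofReal_mul hβ,
    ← ofReal_integral_norm_eq_lintegral_enorm (hS.integrable i hi)]
  exact ENNReal.ofReal_le_ofReal (hS.mass i hi)

lemma lintegral_sum_avgOp_le (hS : IsAtomFamily S b c ℓ Q β) (hβ : 0 ≤ β)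
    {p : Euc d → ℝ} {Mp : ℝ} (hMp : 0 ≤ Mp) (hp : IsProfile p Mp) {C M : ℝ}
    {h : ι → Euc d → Euc d → ℝ} (hC : 0 ≤ C)
    (hh : ∀ i ∈ S, IsScaleKernel (h i) C (M * ℓ i)) {ω : Euc d → ℝ} (hω : Measurable ω)
    (hω1 : ∀ v, |ω v| ≤ 1) {N : ℕ} (hN : 1 ≤ N) (hNM : (N : ℝ) ^ 2 ≤ M) :
    ∫⁻ x, ‖∑ i ∈ S, avgOp p (M * ℓ i / N) (kerOp (angKernel ω (h i)) (b i)) x‖ₑ ≤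
      ENNReal.ofReal ((4 * unitVol d * Mp * C + 2 * C) * (unitVol d * 2 ^ d) * d / N * β) *
        ∑ i ∈ S, volume (Q i) := by
  have hN1 : (1 : ℝ) ≤ N := by exact_mod_cast hN
  have hN0 : (0 : ℝ) < N := by positivity
  have hM : 0 < M := (by positivity : (0 : ℝ) < (N : ℝ) ^ 2).trans_le hNM
  have hu := unitVol_nonneg d
  have hI : ∀ i ∈ S, Integrable
      (avgOp p (M * ℓ i / N) (kerOp (angKernel ω (h i)) (b i))) := fun i hi =>
    hp.integrable_avgOp _
      (((hh i hi).isBddKernel_angKernel hω hω1).integrable_kerOp (hS.integrable i hi))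
  calc _ ≤ ∫⁻ x, ∑ i ∈ S, ‖avgOp p (M * ℓ i / N) (kerOp (angKernel ω (h i)) (b i)) x‖ₑ :=
        lintegral_mono fun x => enorm_sum_le _ _
    _ = ∑ i ∈ S, ∫⁻ x, ‖avgOp p (M * ℓ i / N) (kerOp (angKernel ω (h i)) (b i)) x‖ₑ :=
        lintegral_finsetSum' _ fun i hi => (hI i hi).1.enorm
    _ ≤ ∑ i ∈ S, ENNReal.ofReal ((4 * unitVol d * Mp * C + 2 * C) * (unitVol d * 2 ^ d) * d / N * β)
          * volume (Q i) := by
        refine Finset.sum_le_sum fun i hi => ?_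
        have hℓ := hS.side_pos i hi
        refine (((hh i hi).isBddKernel_angKernel hω hω1).lintegral_avgOp_kerOp_le
          (mul_nonneg zero_le_two (hh i hi).pos.le) hp (hS.integrable i hi) (hS.mean i hi)
          (c := c i) (δ := d * ℓ i) (r := M * ℓ i / N) (B' := 2 * C / (M * ℓ i) ^ (d + 1))
          (by positivity) hMp (by positivity)
          (fun y hy => hS.norm_sub_le i hi y (hS.supp i hi y hy))
          (fun y v hy => ((hh i hi).abs_angKernel_sub_le hω1 y (c i) v).trans (by gcongr))).trans ?_
        refine (mul_le_mul_right (hS.lintegral_enorm_le hβ hi) _).trans ?_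
        rw [← mul_assoc, ← ENNReal.ofReal_mul (by positivity)]
        refine mul_le_mul_left (ENNReal.ofReal_le_ofReal (mul_le_mul_of_nonneg_right ?_ hβ)) _
        calc _ = (4 * unitVol d * Mp * C * N + 2 * C) * (unitVol d * 2 ^ d) * d / M := by
              rw [mul_pow, mul_pow]; field_simp; ring
          _ ≤ (4 * unitVol d * Mp * C * N + 2 * C * N) * (unitVol d * 2 ^ d) * d / N ^ 2 := by
              have : 2 * C ≤ 2 * C * N := le_mul_of_one_le_right (by positivity) hN1
              refine div_le_div₀ (by positivity) ?_ (by positivity) hNM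
              gcongr
          _ = _ := by field_simp
    _ = _ := by rw [Finset.mul_sum]

lemma sum_kerOp_eq (hS : IsAtomFamily S b c ℓ Q β)
    {p : Euc d → ℝ} {Mp : ℝ} (hp : IsProfile p Mp) {C M : ℝ}
    {h : ι → Euc d → Euc d → ℝ} 
    (hh : ∀ i ∈ S, IsScaleKernel (h i) C (M * ℓ i)) {ω : Euc d → ℝ} (hω : Measurable ω)
    (hω1 : ∀ v, |ω v| ≤ 1) {N : ℕ} (hN : 1 ≤ N) (x : Euc d) :
    ∑ i ∈ S, kerOp (angKernel ω (h i)) (b i) x =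
      (∑ i ∈ S, avgOp p (M * ℓ i / N) (kerOp (angKernel ω (h i)) (b i)) x) +
      ∑ m, ∑ ν ∈ dirGrid d m N, ∑ i ∈ S, (kerOp (angKernel (conePart N m ν ω) (h i)) (b i) x -
        avgOp p (M * ℓ i / N) (kerOp (angKernel (conePart N m ν ω) (h i)) (b i)) x) := by
  have hN0 : (0 : ℝ) < N := by positivity
  simp only [Finset.sum_comm (t := S)]
  rw [← Finset.sum_add_distrib]
  refine Finset.sum_congr rfl fun i hi => ?_
  have hr : M * ℓ i / N ≠ 0 := (div_pos (hh i hi).pos hN0).ne'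
  have hk : kerOp (angKernel ω (h i)) (b i) = fun x =>
      ∑ m, ∑ ν ∈ dirGrid d m N, kerOp (angKernel (conePart N m ν ω) (h i)) (b i) x :=
    funext fun x => ((hh i hi).sum_kerOp_conePart hω hω1 N (hS.integrable i hi) x).symm
  have hI : ∀ m ν, Integrable (kerOp (angKernel (conePart N m ν ω) (h i)) (b i)) := fun m ν =>
    ((hh i hi).isBddKernel_angKernel (hω.indicator (measurableSet_dirCone N m ν))
      (abs_conePart_le hω1)).integrable_kerOp (hS.integrable i hi)
  have ha : avgOp p (M * ℓ i / N) (kerOp (angKernel ω (h i)) (b i)) x = ∑ m,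
      ∑ ν ∈ dirGrid d m N, avgOp p (M * ℓ i / N)
        (kerOp (angKernel (conePart N m ν ω) (h i)) (b i)) x := by
    rw [hk, hp.avgOp_finsetSum _ (fun m _ => integrable_finsetSum _ fun ν _ => hI m ν) hr]
    exact Finset.sum_congr rfl fun m _ => hp.avgOp_finsetSum _ (fun ν _ => hI m ν) hr x
  rw [ha, hk]
  simp only [Finset.sum_sub_distrib]
  ring

end IsAtomFamily

/-- Weak type estimate, with decay in the gap `M` between the scale of the kernels and the
sizes of the cubes carrying the atoms. -/
lemma exists_volume_sum_kerOp_le (ι : Type*) (hd : 2 ≤ d) {C : ℝ} (hC : 0 ≤ C) :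
    ∃ K : ℝ, 0 ≤ K ∧ ∀ (S : Finset ι) (b : ι → Euc d → ℂ) (c : ι → Euc d) (ℓ : ι → ℝ)
      (Q : ι → Set (Euc d)) (β : ℝ) (h : ι → Euc d → Euc d → ℝ) (ω : Euc d → ℝ) (N : ℕ) (M a : ℝ),
      IsAtomFamily S b c ℓ Q β → 0 ≤ β → (∀ i ∈ S, IsScaleKernel (h i) C (M * ℓ i)) →
      Measurable ω → (∀ v, |ω v| ≤ 1) → (∀ t : ℝ, 0 < t → ∀ v, v ≠ 0 → ω (t • v) = ω v) →
      1 ≤ N → (N : ℝ) ^ 2 ≤ M → 0 < a →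
      volume {x | a < ‖∑ i ∈ S, kerOp (angKernel ω (h i)) (b i) x‖} ≤
        ENNReal.ofReal (K / N * (β / a + (β / a) ^ 2)) * ∑ i ∈ S, volume (Q i) := by
  obtain ⟨p, Mp, hMp, hp⟩ := exists_isProfile d
  obtain ⟨W, hW0, hW⟩ := exists_sum_dirGrid_weight_le d hd
  have hu := unitVol_nonneg d
  have hd0 : (0 : ℝ) < d := by positivity
  have ht := tubeConst_nonneg d (D := 3 * d + 1) (E := d) (by positivity) (by positivity)
  set K₁ : ℝ := (4 * unitVol d * Mp * C + 2 * C) * (unitVol d * 2 ^ d) * d with hK₁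
  set K₂ : ℝ := W * 3 ^ (d - 1) * (1 + d) * ((4 + d * (2 + d)) * C) ^ 2 *
        tubeConst d (3 * d + 1) d with hK₂
  have hK₁0 : 0 ≤ K₁ := by positivity
  have hK₂0 : 0 ≤ K₂ := by positivity
  refine ⟨2 * K₁ + d * (K₂ * (2 * d) ^ 2), by positivity, ?_⟩
  intro S b c ℓ Q β h ω N M a hS hβ hh hω hω1 hhom hN hNM ha
  have hN1 : (1 : ℝ) ≤ N := by exact_mod_cast hN
  have hN0 : (0 : ℝ) < N := by positivity
  set E : Euc d → ℂ := fun x =>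
    ∑ i ∈ S, avgOp p (M * ℓ i / N) (kerOp (angKernel ω (h i)) (b i)) x with hE
  set H : Fin d → Euc d → ℂ := fun m x => ∑ ν ∈ dirGrid d m N, ∑ i ∈ S,
    (kerOp (angKernel (conePart N m ν ω) (h i)) (b i) x -
        avgOp p (M * ℓ i / N) (kerOp (angKernel (conePart N m ν ω) (h i)) (b i)) x) with hH
  have hEm : AEStronglyMeasurable E := (integrable_finsetSum _ fun i hi =>
    hp.integrable_avgOp _ (((hh i hi).isBddKernel_angKernel hω hω1).integrable_kerOp
      (hS.integrable i hi))).1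
  have hHm : ∀ m, AEStronglyMeasurable (H m) := fun m =>
    (integrable_finsetSum _ fun ν _ => integrable_finsetSum _ fun i hi => by
      have := ((hh i hi).isBddKernel_angKernel (hω.indicator (measurableSet_dirCone N m ν))
        (abs_conePart_le hω1)).integrable_kerOp (hS.integrable i hi)
      exact this.sub (hp.integrable_avgOp _ this)).1
  have hsub : {x | a < ‖∑ i ∈ S, kerOp (angKernel ω (h i)) (b i) x‖} ⊆
      {x | a / 2 ≤ ‖E x‖} ∪ ⋃ m, {x | a / (2 * d) ≤ ‖H m x‖} := by
    intro x hx
    rw [Set.mem_ofPred_eq, hS.sum_kerOp_eq hp hh hω hω1 hN x] at hx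
    by_contra hcon
    simp only [Set.mem_union, Set.mem_iUnion, Set.mem_ofPred_eq, not_or, not_exists, not_le] at hcon
    have h1 : ∑ m, ‖H m x‖ ≤ ∑ _m : Fin d, a / (2 * d) :=
      Finset.sum_le_sum fun m _ => (hcon.2 m).le
    have h2 : ∑ _m : Fin d, a / (2 * d) = a / 2 := by
      rw [Finset.sum_const, Finset.card_univ, Fintype.card_fin, nsmul_eq_mul]
      field_simp
    have h3 := hx.trans_le ((norm_add_le (E x) (∑ m, H m x)).trans
      (add_le_add_right (norm_sum_le _ _) _))
    linarith [hcon.1]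
  refine (measure_mono hsub).trans ((measure_union_le _ _).trans ?_)
  have hEv := volume_lt_norm_le_of_lintegral hEm (half_pos ha)
    (hS.lintegral_sum_avgOp_le hβ hMp.le hp hC hh hω hω1 hN hNM)
  have hHv : ∀ m, volume {x | a / (2 * d) ≤ ‖H m x‖} ≤ _ := fun m =>
    volume_lt_norm_le_of_lintegral_sq (hHm m) (by positivity)
      (hS.lintegral_sq_conePart_le hd hβ hp hC hh hω hω1 hhom hN
        ((le_self_pow₀ hN1 two_ne_zero).trans hNM) hW0.le m (hW m N hN))
  refine (add_le_add hEv ((measure_iUnion_fintype_le _ _).trans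
    (Finset.sum_le_sum fun m _ => hHv m))).trans ?_
  rw [Finset.sum_const, Finset.card_univ, Fintype.card_fin, nsmul_eq_mul, ← ENNReal.ofReal_natCast,
    ← mul_assoc (ENNReal.ofReal (d : ℝ)), ← ENNReal.ofReal_mul (by positivity), ← add_mul,
    ← ENNReal.ofReal_add (by positivity) (by positivity)]
  refine mul_le_mul_left (ENNReal.ofReal_le_ofReal ?_) _
  rw [← hK₁, ← hK₂]
  have h1 : 0 ≤ K₁ / N * (β / a) ^ 2 := by positivity
  have h2 : 0 ≤ K₂ / N * (β / a) := by positivity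
  calc _ = 2 * (K₁ / N * (β / a)) + d * (2 * d) ^ 2 * (K₂ / N * (β / a) ^ 2) := by
        field_simp
    _ ≤ 2 * (K₁ / N * (β / a)) + d * (2 * d) ^ 2 * (K₂ / N * (β / a) ^ 2) +
        (2 * (K₁ / N * (β / a) ^ 2) + d * (2 * d) ^ 2 * (K₂ / N * (β / a))) :=
        le_add_of_nonneg_right (by positivity)
    _ = _ := by ring

end

section

variable {d : ℕ}

/-- The piecewise linear cutoff, equal to `1` on `(-∞, 1]` and to `0` on `[2, ∞)`. -/
def ramp (r : ℝ) : ℝ := max 0 (min 1 (2 - r))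

/-- A cutoff to `1/2 ≤ r ≤ 2` whose dyadic dilates sum to one. -/
def annulus (r : ℝ) : ℝ := ramp r - ramp (2 * r)

lemma ramp_of_le {r : ℝ} (hr : r ≤ 1) : ramp r = 1 := by
  rw [ramp, min_eq_left (by linarith), max_eq_right zero_le_one]

lemma ramp_of_ge {r : ℝ} (hr : 2 ≤ r) : ramp r = 0 := by
  rw [ramp, max_eq_left ((min_le_right _ _).trans (by linarith))]

lemma ramp_nonneg (r : ℝ) : 0 ≤ ramp r := le_max_left _ _

lemma ramp_le_one (r : ℝ) : ramp r ≤ 1 := max_le zero_le_one (min_le_left _ _)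

lemma abs_ramp_sub_le (r s : ℝ) : |ramp r - ramp s| ≤ |r - s| := by
  rw [ramp, ramp, max_comm, max_comm (0 : ℝ)]
  refine (abs_max_sub_max_le_abs _ _ _).trans ?_
  rw [abs_le]
  constructor <;>
    rcases abs_cases (r - s) with h | h <;> rcases min_cases 1 (2 - r) with h1 | h1 <;>
    rcases min_cases 1 (2 - s) with h2 | h2 <;> linarith

lemma annulus_of_le {r : ℝ} (hr : r ≤ 1 / 2) : annulus r = 0 := by
  rw [annulus, ramp_of_le (by linarith), ramp_of_le (by linarith), sub_self]

lemma annulus_of_ge {r : ℝ} (hr : 2 ≤ r) : annulus r = 0 := by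
  rw [annulus, ramp_of_ge hr, ramp_of_ge (by linarith), sub_self]

lemma abs_annulus_le (r : ℝ) : |annulus r| ≤ 1 := by
  rw [annulus, abs_le]
  constructor <;> linarith [ramp_nonneg r, ramp_nonneg (2 * r), ramp_le_one r, ramp_le_one (2 * r)]

lemma abs_annulus_sub_le (r s : ℝ) : |annulus r - annulus s| ≤ 3 * |r - s| := by
  have h1 := abs_ramp_sub_le r s
  have h2 := abs_ramp_sub_le (2 * r) (2 * s)
  rw [← mul_sub, abs_mul, abs_two] at h2
  rw [annulus, annulus, show ramp r - ramp (2 * r) - (ramp s - ramp (2 * s)) =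
    (ramp r - ramp s) - (ramp (2 * r) - ramp (2 * s)) by ring]
  linarith [abs_sub (ramp r - ramp s) (ramp (2 * r) - ramp (2 * s))]

lemma sum_annulus {r R : ℝ} (hR : 0 < R) (hr : R ≤ r) {n : ℕ} (hn : r ≤ 2 ^ n * R) :
    ∑ s ∈ Finset.range (n + 1), annulus (r / (2 ^ s * R)) = 1 := by
  have h : ∀ m : ℕ, ∑ s ∈ Finset.range (m + 1), annulus (r / (2 ^ s * R)) =
      ramp (r / (2 ^ m * R)) := by
    intro m
    induction m with
    | zero =>
      have : 2 ≤ 2 * (r / R) := by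
        have : 1 ≤ r / R := (one_le_div hR).2 hr
        linarith
      simp [annulus, ramp_of_ge this]
    | succ m ih =>
      rw [Finset.sum_range_succ, ih, annulus,
        show 2 * (r / (2 ^ (m + 1) * R)) = r / (2 ^ m * R) by rw [pow_succ]; field_simp]
      ring
  rw [h n, ramp_of_le ((div_le_one (by positivity)).2 hn)]

/-- A Lipschitz truncation of `r ↦ r⁻ⁿ` to `R/2 ≤ r ≤ 2R`. -/
def radProfile (n : ℕ) (R r : ℝ) : ℝ := annulus (r / R) * (max r (R / 2))⁻¹ ^ n

variable {n : ℕ} {R : ℝ}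

lemma inv_max_le (hR : 0 < R) (r : ℝ) : (max r (R / 2))⁻¹ ≤ 2 / R := by
  rw [← inv_div R 2]
  exact inv_anti₀ (half_pos hR) (le_max_right _ _)

lemma inv_max_nonneg (hR : 0 < R) (r : ℝ) : 0 ≤ (max r (R / 2))⁻¹ :=
  inv_nonneg.2 ((half_pos hR).le.trans (le_max_right _ _))

lemma radProfile_of_ge (hR : 0 < R) {r : ℝ} (hr : 2 * R ≤ r) : radProfile n R r = 0 := by
  rw [radProfile, annulus_of_ge, zero_mul]
  rwa [le_div_iff₀ hR]

lemma abs_radProfile_le (hR : 0 < R) (r : ℝ) : |radProfile n R r| ≤ (2 / R) ^ n := by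
  rw [radProfile, abs_mul, abs_pow, abs_of_nonneg (inv_max_nonneg hR r)]
  calc _ ≤ 1 * (2 / R) ^ n := by
        gcongr
        · exact abs_annulus_le _
        · exact inv_max_le hR r
    _ = _ := one_mul _

lemma abs_radProfile_mul_pow_le (hR : 0 < R) {r : ℝ} (hr : 0 ≤ r) (k : ℕ) :
    |radProfile (n + k) R r| * r ^ k ≤ (2 / R) ^ n := by
  have h0 := inv_max_nonneg hR r
  have hm : 0 < max r (R / 2) := (half_pos hR).trans_le (le_max_right _ _)
  rw [radProfile, abs_mul, abs_pow, abs_of_nonneg h0, pow_add]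
  calc _ ≤ 1 * ((2 / R) ^ n * (max r (R / 2))⁻¹ ^ k) * (max r (R / 2)) ^ k := by
        gcongr
        · exact abs_annulus_le _
        · exact inv_max_le hR r
        · exact le_max_left _ _
    _ = _ := by
        rw [one_mul, mul_assoc, ← mul_pow, inv_mul_cancel₀ hm.ne', one_pow, mul_one]

lemma abs_inv_max_sub_le (hR : 0 < R) (r s : ℝ) :
    |(max r (R / 2))⁻¹ - (max s (R / 2))⁻¹| ≤ (2 / R) ^ 2 * |r - s| := by
  have hr : 0 < max r (R / 2) := (half_pos hR).trans_le (le_max_right _ _)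
  have hs : 0 < max s (R / 2) := (half_pos hR).trans_le (le_max_right _ _)
  have h := abs_max_sub_max_le_abs s r (R / 2)
  rw [inv_sub_inv hr.ne' hs.ne', abs_div, abs_mul, abs_of_pos hr, abs_of_pos hs, div_eq_mul_inv,
    mul_inv, mul_comm, abs_sub_comm r s, sq]
  gcongr
  · exact inv_max_le hR r
  · exact inv_max_le hR s

lemma abs_radProfile_sub_le (hR : 0 < R) (r s : ℝ) :
    |radProfile n R r - radProfile n R s| ≤ (2 + n) * (2 / R) ^ (n + 1) * |r - s| := by
  have h0 := inv_max_nonneg hR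
  have h1 := inv_max_le hR
  have hA : |annulus (r / R) - annulus (s / R)| ≤ 2 * (2 / R) * |r - s| := by
    refine (abs_annulus_sub_le _ _).trans ?_
    rw [← sub_div, abs_div, abs_of_pos hR]
    have : 0 ≤ |r - s| / R := by positivity
    calc 3 * (|r - s| / R) ≤ 4 * (|r - s| / R) := by linarith
      _ = _ := by ring
  have hB : |(max r (R / 2))⁻¹ ^ n - (max s (R / 2))⁻¹ ^ n| ≤ n * (2 / R) ^ (n + 1) * |r - s| := by
    rcases Nat.eq_zero_or_pos n with rfl | hn
    · simp
    refine (abs_pow_sub_pow_le _ _ _).trans ?_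
    rw [abs_of_nonneg (h0 r), abs_of_nonneg (h0 s)]
    calc _ ≤ (2 / R) ^ 2 * |r - s| * n * (2 / R) ^ (n - 1) := by
          gcongr
          · exact abs_inv_max_sub_le hR r s
          · exact max_le (h1 r) (h1 s)
      _ = n * ((2 / R) ^ 2 * (2 / R) ^ (n - 1)) * |r - s| := by ring
      _ = _ := by rw [← pow_add, show 2 + (n - 1) = n + 1 by lia]
  rw [radProfile, radProfile, show ∀ a b a' b' : ℝ, a * b - a' * b' = (a - a') * b + a' * (b - b') by
    intros; ring]
  refine (abs_add_le _ _).trans ?_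
  rw [abs_mul, abs_mul, abs_pow, abs_of_nonneg (h0 r)]
  calc _ ≤ 2 * (2 / R) * |r - s| * (2 / R) ^ n + 1 * (n * (2 / R) ^ (n + 1) * |r - s|) := by
        gcongr
        · exact h1 r
        · exact abs_annulus_le _
    _ = _ := by ring

/-- The part of the commutator kernel at scale `R`, without its angular factor. -/
def commKernel (k : ℕ) (A : Euc d → ℝ) (R : ℝ) (y v : Euc d) : ℝ :=
  radProfile (d + 1 + k) R ‖v‖ * (A (y + v) - A y) ^ k

lemma abs_pow_sub_pow_le_of_le {a b B : ℝ} (ha : |a| ≤ B) (hb : |b| ≤ B) (k : ℕ) :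
    |a ^ k - b ^ k| ≤ k * B ^ (k - 1) * |a - b| := by
  refine (abs_pow_sub_pow_le _ _ _).trans ?_
  calc |a - b| * k * max |a| |b| ^ (k - 1) ≤ |a - b| * k * B ^ (k - 1) := by
        gcongr
        · exact max_le ha hb
    _ = _ := by ring

/-- The constant in the kernel estimates. -/
def commConst (d k : ℕ) : ℝ := 4 ^ k * (4 + d + 4 * k) * 2 ^ (d + 2 + k)

lemma commConst_nonneg (d k : ℕ) : 0 ≤ commConst d k := by rw [commConst]; positivity

lemma isScaleKernel_commKernel {A : Euc d → ℝ} (hA : ∀ x y, |A x - A y| ≤ ‖x - y‖) {k : ℕ}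
    (hk : 1 ≤ k) (hR : 0 < R) : IsScaleKernel (commKernel k A R) (commConst d k) R := by
  have hAv : ∀ y v, |A (y + v) - A y| ≤ ‖v‖ := fun y v => by simpa using hA (y + v) y
  have h4 : (1 : ℝ) ≤ 4 ^ k := one_le_pow₀ (by norm_num)
  have h2 : (1 : ℝ) ≤ 2 ^ k := one_le_pow₀ (by norm_num)
  have hk1 : (1 : ℝ) ≤ k := by exact_mod_cast hk
  have hbound : ∀ y v, |commKernel k A R y v| ≤ commConst d k / R ^ (d + 1) := fun y v => by
    rw [commKernel, abs_mul, abs_pow]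
    calc _ ≤ |radProfile (d + 1 + k) R ‖v‖| * ‖v‖ ^ k := by gcongr; exact hAv y v
      _ ≤ (2 / R) ^ (d + 1) := abs_radProfile_mul_pow_le hR (norm_nonneg v) k
      _ = 1 * 1 * 2 ^ (d + 1) / R ^ (d + 1) := by rw [div_pow]; ring
      _ ≤ _ := by
        rw [commConst]
        gcongr
        · linarith
        · norm_num
        · lia
  have hleft : ∀ y y' v, |commKernel k A R y v - commKernel k A R y' v| ≤
      commConst d k / R ^ (d + 2) * ‖y - y'‖ := fun y y' v => by
    rw [commKernel, commKernel, ← mul_sub, abs_mul]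
    have h1 := abs_pow_sub_pow_le_of_le (hAv y v) (hAv y' v) k
    have h2' : |A (y + v) - A y - (A (y' + v) - A y')| ≤ 2 * ‖y - y'‖ := by
      have e1 := hA (y + v) (y' + v)
      rw [add_sub_add_right_eq_sub] at e1
      rw [show A (y + v) - A y - (A (y' + v) - A y') = (A (y + v) - A (y' + v)) - (A y - A y') by ring]
      linarith [abs_sub (A (y + v) - A (y' + v)) (A y - A y'), hA y y']
    calc _ ≤ |radProfile (d + 1 + k) R ‖v‖| * (k * ‖v‖ ^ (k - 1) * (2 * ‖y - y'‖)) := by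
          gcongr
          exact h1.trans (by gcongr)
      _ = 2 * k * (|radProfile (d + 2 + (k - 1)) R ‖v‖| * ‖v‖ ^ (k - 1)) * ‖y - y'‖ := by
          rw [show d + 2 + (k - 1) = d + 1 + k by lia]; ring
      _ ≤ 2 * k * (2 / R) ^ (d + 2) * ‖y - y'‖ := by
          gcongr
          exact abs_radProfile_mul_pow_le hR (norm_nonneg v) (k - 1)
      _ = 1 * (2 * k) * 2 ^ (d + 2) / R ^ (d + 2) * ‖y - y'‖ := by rw [div_pow]; ring
      _ ≤ _ := by
        have e : (1 : ℝ) * (2 * k) ≤ 4 ^ k * (4 + d + 4 * k) := by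
          have hd0 : (0 : ℝ) ≤ d := Nat.cast_nonneg d
          exact mul_le_mul h4 (by linarith) (by positivity) (by positivity)
        have e' : (2 : ℝ) ^ (d + 2) ≤ 2 ^ (d + 2 + k) :=
          pow_le_pow_right₀ (by norm_num) (by lia)
        rw [commConst]
        exact mul_le_mul_of_nonneg_right (div_le_div_of_nonneg_right
          (mul_le_mul e e' (by positivity) (by positivity)) (by positivity)) (norm_nonneg _)
  have hright : ∀ y v v', |commKernel k A R y v - commKernel k A R y v'| ≤
      commConst d k / R ^ (d + 2) * ‖v - v'‖ := by
    intro y v v'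
    wlog hvv : ‖v'‖ ≤ ‖v‖ generalizing v v'
    · rw [abs_sub_comm, norm_sub_rev]
      exact this v' v (not_le.1 hvv).le
    have hC0 : 0 ≤ commConst d k / R ^ (d + 2) * ‖v - v'‖ :=
      mul_nonneg (div_nonneg (commConst_nonneg d k) (by positivity)) (norm_nonneg _)
    by_cases hv' : 2 * R ≤ ‖v'‖
    · rw [commKernel, commKernel, radProfile_of_ge hR hv', radProfile_of_ge hR (hv'.trans hvv)]
      simpa using hC0
    push Not at hv'
    set a := A (y + v) - A y with ha
    set a' := A (y + v') - A y with ha'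
    have haa : |a - a'| ≤ ‖v - v'‖ := by
      have e1 := hA (y + v) (y + v')
      rw [add_sub_add_left_eq_sub] at e1
      rwa [ha, ha', sub_sub_sub_cancel_right]
    have hP : |radProfile (d + 1 + k) R ‖v‖ - radProfile (d + 1 + k) R ‖v'‖| ≤
        (2 + (d + 1 + k : ℕ)) * (2 / R) ^ (d + 1 + k + 1) * ‖v - v'‖ :=
      (abs_radProfile_sub_le hR _ _).trans (by gcongr; exact abs_norm_sub_norm_le v v')
    have h1 : |(radProfile (d + 1 + k) R ‖v‖ - radProfile (d + 1 + k) R ‖v'‖) * a' ^ k| ≤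
        4 ^ k * (3 + d + k) * 2 ^ (d + 2) / R ^ (d + 2) * ‖v - v'‖ := by
      rw [abs_mul, abs_pow]
      calc _ ≤ (2 + (d + 1 + k : ℕ)) * (2 / R) ^ (d + 1 + k + 1) * ‖v - v'‖ * (2 * R) ^ k := by
            gcongr
            exact (hAv y v').trans hv'.le
        _ = _ := by
            rw [show d + 1 + k + 1 = d + 2 + k by ring, div_pow, mul_pow, pow_add R (d + 2) k,
              pow_add (2 : ℝ) (d + 2) k, show (4 : ℝ) = 2 * 2 by norm_num, mul_pow]
            push_cast
            field_simp
            ring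
    have h2 : |radProfile (d + 1 + k) R ‖v‖ * (a ^ k - a' ^ k)| ≤
        4 ^ k * k * 2 ^ (d + 2) / R ^ (d + 2) * ‖v - v'‖ := by
      by_cases hv : 2 * R ≤ ‖v‖
      · rw [radProfile_of_ge hR hv, zero_mul, abs_zero]
        positivity
      push Not at hv
      rw [abs_mul]
      calc _ ≤ (2 / R) ^ (d + 1 + k) * (k * (2 * R) ^ (k - 1) * ‖v - v'‖) := by
            gcongr
            · exact abs_radProfile_le hR _
            · exact (abs_pow_sub_pow_le_of_le ((hAv y v).trans hv.le) ((hAv y v').trans hv'.le) k).trans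
                (by gcongr)
        _ = 4 ^ (k - 1) * k * 2 ^ (d + 2) / R ^ (d + 2) * ‖v - v'‖ := by
            rw [show d + 1 + k = d + 2 + (k - 1) by lia, div_pow, mul_pow,
              pow_add R (d + 2) (k - 1), pow_add (2 : ℝ) (d + 2) (k - 1),
              show (4 : ℝ) = 2 * 2 by norm_num, mul_pow]
            field_simp
        _ ≤ _ := by
            gcongr
            · norm_num
            · lia
    calc _ = |(radProfile (d + 1 + k) R ‖v‖ - radProfile (d + 1 + k) R ‖v'‖) * a' ^ k +
          radProfile (d + 1 + k) R ‖v‖ * (a ^ k - a' ^ k)| := by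
          rw [commKernel, commKernel, ← ha, ← ha']; congr 1; ring
      _ ≤ _ := (abs_add_le _ _).trans (add_le_add h1 h2)
      _ = 4 ^ k * (3 + d + 2 * k) * 2 ^ (d + 2) / R ^ (d + 2) * ‖v - v'‖ := by ring
      _ ≤ _ := by
        have e : (3 : ℝ) + d + 2 * k ≤ 4 + d + 4 * k := by linarith
        have e' : (2 : ℝ) ^ (d + 2) ≤ 2 ^ (d + 2 + k) :=
          pow_le_pow_right₀ (by norm_num) (by lia)
        rw [commConst]
        exact mul_le_mul_of_nonneg_right (div_le_div_of_nonneg_right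
          (mul_le_mul (mul_le_mul_of_nonneg_left e (by positivity)) e' (by positivity)
            (by positivity)) (by positivity)) (norm_nonneg _)
  refine ⟨hR, ?_, fun y v hv => ?_, hbound, hleft, hright⟩
  · have h0 : 0 ≤ commConst d k / R ^ (d + 2) := div_nonneg (commConst_nonneg d k) (by positivity)
    refine (LipschitzWith.uncurry (Kα := ⟨_, h0⟩) (Kβ := ⟨_, h0⟩)
      (fun v => LipschitzWith.of_dist_le_mul fun y y' => ?_)
      (fun y => LipschitzWith.of_dist_le_mul fun v v' => ?_)).continuous
    · rw [Real.dist_eq, dist_eq_norm]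
      exact hleft y y' v
    · rw [Real.dist_eq, dist_eq_norm]
      exact hright y v v'
  · rw [commKernel, radProfile_of_ge hR hv.le, zero_mul]

/-- The commutator kernel at scale `R`. -/
lemma angKernel_commKernel (ω : Euc d → ℝ) (A : Euc d → ℝ) (k : ℕ) (hR : 0 < R) (x y : Euc d) :
    angKernel ω (commKernel k A R) y (x - y) =
      annulus (‖x - y‖ / R) * (ω (x - y) / ‖x - y‖ ^ d * ((A x - A y) / ‖x - y‖) ^ k) := by
  rw [angKernel, commKernel, radProfile, add_sub_cancel]
  by_cases h : ‖x - y‖ / R ≤ 1 / 2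
  · rw [annulus_of_le h]; simp
  push Not at h
  rw [lt_div_iff₀ hR] at h
  have h0 : 0 < ‖x - y‖ := (by positivity : 0 < 1 / 2 * R).trans h
  rw [max_eq_left (by linarith), inv_pow, div_pow, pow_add, pow_succ]
  field_simp

end

section

variable {d : ℕ}

/-- The kernel of the Calderón commutator. -/
def calKer (ω A : Euc d → ℝ) (k : ℕ) (x y : Euc d) : ℝ :=
  ω (x - y) / ‖x - y‖ ^ d * ((A x - A y) / ‖x - y‖) ^ k

lemma pow_four_thirds_le (s : ℕ) : ((4 : ℝ) / 3) ^ s ≤ 4 / 3 * ((2 ^ (s / 2) : ℕ) : ℝ) := by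
  push_cast
  obtain ⟨m, rfl | rfl⟩ := Nat.even_or_odd' s
  · rw [Nat.mul_div_cancel_left _ two_pos, pow_mul]
    have : ((4 / 3 : ℝ) ^ 2) ^ m ≤ 2 ^ m := by gcongr; norm_num
    linarith [pow_pos (two_pos (α := ℝ)) m]
  · rw [show (2 * m + 1) / 2 = m by lia, pow_succ, pow_mul, mul_comm]
    gcongr
    norm_num

/-- Away from the cubes carrying the atoms, the commutator applied to the atoms is the sum of its
pieces at scales at least the sizes of the cubes. -/
lemma IsAtomFamily.exists_sum_integral_calKer_eq {ι : Type*} {S : Finset ι} {b : ι → Euc d → ℂ}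
    {c : ι → Euc d} {ℓ : ι → ℝ} {Q : ι → Set (Euc d)} {β : ℝ} (hS : IsAtomFamily S b c ℓ Q β)
    {ω A : Euc d → ℝ} (hω : Measurable ω) (hω1 : ∀ v, |ω v| ≤ 1)
    (hA : ∀ x y, |A x - A y| ≤ ‖x - y‖) {k : ℕ} (hk : 1 ≤ k) {x : Euc d}
    (hx : ∀ i ∈ S, (d + 1) * ℓ i < ‖x - c i‖) :
    ∃ n : ℕ, ∑ i ∈ S, ∫ y, (calKer ω A k x y : ℂ) * b i y =
      ∑ s ∈ Finset.range (n + 1),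
        ∑ i ∈ S, kerOp (angKernel ω (commKernel k A (2 ^ s * ℓ i))) (b i) x := by
  obtain ⟨n, hn⟩ := pow_unbounded_of_one_lt (∑ i ∈ S, (‖x - c i‖ / ℓ i + d)) one_lt_two
  refine ⟨n, ?_⟩
  rw [Finset.sum_comm]
  refine Finset.sum_congr rfl fun i hi => ?_
  have hℓ := hS.side_pos i hi
  have hni : ‖x - c i‖ / ℓ i + d ≤ 2 ^ n :=
    (Finset.single_le_sum (f := fun i => ‖x - c i‖ / ℓ i + d) (fun j hj => by
      have := hS.side_pos j hj
      positivity) hi).trans hn.le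
  have hni' : ‖x - c i‖ + d * ℓ i ≤ 2 ^ n * ℓ i := by
    have := mul_le_mul_of_nonneg_right hni hℓ.le
    rwa [add_mul, div_mul_cancel₀ _ hℓ.ne'] at this
  simp only [kerOp]
  rw [← integral_finsetSum _ fun s _ => ((isScaleKernel_commKernel hA hk
    (by positivity : 0 < 2 ^ s * ℓ i)).isBddKernel_angKernel hω hω1).integrable_mul
      (hS.integrable i hi) x]
  refine integral_congr_ae (ae_of_all _ fun y => ?_)
  beta_reduce
  by_cases hy : b i y = 0
  · simp [hy]
  have hyc := hS.norm_sub_le i hi y (hS.supp i hi y hy)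
  have hxi := hx i hi
  have h1 : ‖x - c i‖ ≤ ‖x - y‖ + ‖y - c i‖ := by simpa using norm_add_le (x - y) (y - c i)
  have h2 : ‖x - y‖ ≤ ‖x - c i‖ + ‖y - c i‖ := by
    simpa using _root_.norm_sub_le (x - c i) (y - c i)
  have hs := sum_annulus hℓ (r := ‖x - y‖) (by linarith) (h2.trans (by linarith) :
    ‖x - y‖ ≤ 2 ^ n * ℓ i)
  rw [← Finset.sum_mul]
  congr 1
  rw [← Complex.ofReal_sum]
  congr 1
  rw [Finset.sum_congr rfl fun s _ => angKernel_commKernel ω A k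
    (by positivity : 0 < 2 ^ s * ℓ i) x y, ← Finset.sum_mul, hs, one_mul, calKer]

/-- The weak-type estimate for the commutator applied to a family of atoms, away from them. -/
lemma exists_volume_sum_integral_calKer_le (ι : Type*) (hd : 2 ≤ d) {k : ℕ} (hk : 1 ≤ k) :
    ∃ K : ℝ, 0 ≤ K ∧ ∀ (S : Finset ι) (b : ι → Euc d → ℂ) (c : ι → Euc d) (ℓ : ι → ℝ)
      (Q : ι → Set (Euc d)) (β : ℝ) (ω A : Euc d → ℝ) (t : ℝ),
      IsAtomFamily S b c ℓ Q β → 0 ≤ β → (∀ x y, |A x - A y| ≤ ‖x - y‖) →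
      Measurable ω → (∀ v, |ω v| ≤ 1) → (∀ t : ℝ, 0 < t → ∀ v, v ≠ 0 → ω (t • v) = ω v) →
      0 < t →
      volume {x | (∀ i ∈ S, (d + 1) * ℓ i < ‖x - c i‖) ∧
          t < ‖∑ i ∈ S, ∫ y, (calKer ω A k x y : ℂ) * b i y‖} ≤
        ENNReal.ofReal (K * (β / t + (β / t) ^ 2)) * ∑ i ∈ S, volume (Q i) := by
  obtain ⟨K, hK0, hK⟩ := exists_volume_sum_kerOp_le ι hd (commConst_nonneg d k)
  refine ⟨1800 * K, by positivity, ?_⟩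
  intro S b c ℓ Q β ω A t hS hβ hA hω hω1 hωh ht
  set X : ℝ := β / t with hX
  have hX0 : 0 ≤ X := by positivity
  let a : ℕ → ℝ := fun s => t / 10 * (9 / 10) ^ s
  have ha : ∀ s, 0 < a s := fun s => by positivity
  let G : ℕ → Euc d → ℂ := fun s x =>
    ∑ i ∈ S, kerOp (angKernel ω (commKernel k A (2 ^ s * ℓ i))) (b i) x
  have hsub : {x | (∀ i ∈ S, (d + 1) * ℓ i < ‖x - c i‖) ∧
      t < ‖∑ i ∈ S, ∫ y, (calKer ω A k x y : ℂ) * b i y‖} ⊆ ⋃ s, {x | a s < ‖G s x‖} := by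
    rintro x ⟨hx, hxt⟩
    obtain ⟨n, hn⟩ := hS.exists_sum_integral_calKer_eq hω hω1 hA hk hx
    rw [hn] at hxt
    by_contra hcon
    simp only [Set.mem_iUnion, Set.mem_ofPred_eq, not_exists, not_lt] at hcon
    have h1 : ‖∑ s ∈ Finset.range (n + 1), G s x‖ ≤ ∑ s ∈ Finset.range (n + 1), a s :=
      (norm_sum_le _ _).trans (Finset.sum_le_sum fun s _ => hcon s)
    have h2 : ∑ s ∈ Finset.range (n + 1), a s ≤ t := by
      rw [← Finset.mul_sum, geom_sum_eq (by norm_num)]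
      have : (0 : ℝ) ≤ (9 / 10) ^ (n + 1) := by positivity
      have e : t / 10 * (((9 / 10 : ℝ) ^ (n + 1) - 1) / (9 / 10 - 1)) =
        t * (1 - (9 / 10) ^ (n + 1)) := by ring
      rw [e]
      nlinarith
    exact absurd (hxt.trans_le (h1.trans h2)) (lt_irrefl _)
  have hG : ∀ s, volume {x | a s < ‖G s x‖} ≤
      ENNReal.ofReal (K * (X + X ^ 2) * (400 / 3) * (25 / 27) ^ s) * ∑ i ∈ S, volume (Q i) := by
    intro s
    have hN1 : 1 ≤ 2 ^ (s / 2) := Nat.one_le_two_pow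
    have hNM : (((2 ^ (s / 2) : ℕ)) : ℝ) ^ 2 ≤ 2 ^ s := by
      push_cast
      rw [← pow_mul]
      exact pow_le_pow_right₀ one_le_two (by lia)
    refine (hK S b c ℓ Q β _ ω (2 ^ (s / 2)) (2 ^ s) (a s) hS hβ
      (fun i hi => isScaleKernel_commKernel hA hk (mul_pos (by positivity) (hS.side_pos i hi)))
      hω hω1 hωh hN1 hNM (ha s)).trans ?_
    refine mul_le_mul_left (ENNReal.ofReal_le_ofReal ?_) _
    have hN0 : (0 : ℝ) < ((2 ^ (s / 2) : ℕ) : ℝ) := by positivity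
    have e1 : β / a s = 10 * X * (10 / 9) ^ s := by
      simp only [a]
      rw [hX, show (10 / 9 : ℝ) = (9 / 10)⁻¹ by norm_num, inv_pow]
      field_simp
    have e2 : β / a s + (β / a s) ^ 2 ≤ 100 * (X + X ^ 2) * (100 / 81) ^ s := by
      have h3 : (10 / 9 : ℝ) ^ s ≤ (100 / 81) ^ s :=
        pow_le_pow_left₀ (by norm_num) (by norm_num) s
      have h4 : ((10 / 9 : ℝ) ^ s) ^ 2 = (100 / 81) ^ s := by
        rw [← pow_mul, mul_comm, pow_mul]; norm_num
      rw [e1, mul_pow, h4]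
      have h5 : 10 * X * (10 / 9) ^ s ≤ 100 * X * (100 / 81) ^ s := by
        gcongr
        norm_num
      calc _ ≤ 100 * X * (100 / 81) ^ s + (10 * X) ^ 2 * (100 / 81) ^ s := by gcongr
        _ = _ := by ring
    have e3 : K / ((2 ^ (s / 2) : ℕ) : ℝ) ≤ K * (4 / 3) * (3 / 4) ^ s := by
      rw [div_le_iff₀ hN0]
      have h6 := pow_four_thirds_le s
      have h7 : (3 / 4 : ℝ) ^ s * (4 / 3) ^ s = 1 := by rw [← mul_pow]; norm_num
      have h8 : 1 ≤ (3 / 4 : ℝ) ^ s * (4 / 3 * ((2 ^ (s / 2) : ℕ) : ℝ)) := by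
        rw [← h7]; gcongr
      calc K = K * 1 := (mul_one K).symm
        _ ≤ K * ((3 / 4 : ℝ) ^ s * (4 / 3 * ((2 ^ (s / 2) : ℕ) : ℝ))) := by gcongr
        _ = _ := by ring
    calc _ ≤ K * (4 / 3) * (3 / 4) ^ s * (100 * (X + X ^ 2) * (100 / 81) ^ s) := by
          have : 0 ≤ β / a s := div_nonneg hβ (ha s).le
          exact mul_le_mul e3 e2 (by positivity) (by positivity)
      _ = K * (X + X ^ 2) * (400 / 3) * ((3 / 4) ^ s * (100 / 81) ^ s) := by ring
      _ = _ := by rw [← mul_pow]; norm_num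
  calc _ ≤ ∑' s, volume {x | a s < ‖G s x‖} := (measure_mono hsub).trans (measure_iUnion_le _)
    _ ≤ ∑' s : ℕ, ENNReal.ofReal (K * (X + X ^ 2) * (400 / 3) * (25 / 27) ^ s) *
          ∑ i ∈ S, volume (Q i) := ENNReal.tsum_le_tsum hG
    _ = _ := by
      rw [ENNReal.tsum_mul_right, ← ENNReal.ofReal_tsum_of_nonneg (fun s => by positivity)
        ((summable_geometric_of_lt_one (by norm_num) (by norm_num)).mul_left _), tsum_mul_left,
        tsum_geometric_of_lt_one (by norm_num) (by norm_num)]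
      congr 2
      ring

end

section

variable {d : ℕ}

/-- The half-open cube of side `ℓ` with lower corner `ℓ n`. -/
def gridCube (ℓ : ℝ) (n : Fin d → ℤ) : Set (Euc d) :=
  {x | ∀ m, x m ∈ Set.Ico (n m * ℓ) ((n m + 1) * ℓ)}

/-- The interior of `gridCube ℓ n`. -/
def openGridCube (ℓ : ℝ) (n : Fin d → ℤ) : Set (Euc d) :=
  {x | ∀ m, x m ∈ Set.Ioo (n m * ℓ) ((n m + 1) * ℓ)}

/-- The lower corner of `gridCube ℓ n`. -/
def gridCorner (ℓ : ℝ) (n : Fin d → ℤ) : Euc d := WithLp.toLp 2 fun m => n m * ℓ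

lemma openGridCube_subset (ℓ : ℝ) (n : Fin d → ℤ) : openGridCube ℓ n ⊆ gridCube ℓ n :=
  fun _ hx m => Set.Ioo_subset_Ico_self (hx m)

lemma mem_gridCube_iff {ℓ : ℝ} (hℓ : 0 < ℓ) {n : Fin d → ℤ} {x : Euc d} :
    x ∈ gridCube ℓ n ↔ ∀ m, ⌊x m / ℓ⌋ = n m := by
  refine forall_congr' fun m => ?_
  rw [Int.floor_eq_iff, le_div_iff₀ hℓ, div_lt_iff₀ hℓ, Set.mem_Ico]

lemma volume_gridCube {ℓ : ℝ} (hℓ : 0 ≤ ℓ) (n : Fin d → ℤ) :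
    volume (gridCube ℓ n) = ENNReal.ofReal (ℓ ^ d) := by
  have h : gridCube ℓ n = (WithLp.ofLp : Euc d → Fin d → ℝ) ⁻¹'
      Set.univ.pi fun m => Set.Ico (n m * ℓ) ((n m + 1) * ℓ) := by
    ext x; simp [gridCube]
  rw [h, (PiLp.volume_preserving_ofLp (Fin d)).measure_preimage
    (MeasurableSet.univ_pi fun m => measurableSet_Ico).nullMeasurableSet, volume_pi_pi]
  simp only [Real.volume_Ico, add_mul, one_mul, add_sub_cancel_left, Finset.prod_const,
    Finset.card_univ, Fintype.card_fin, ENNReal.ofReal_pow hℓ]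

lemma volume_openGridCube {ℓ : ℝ} (hℓ : 0 ≤ ℓ) (n : Fin d → ℤ) :
    volume (openGridCube ℓ n) = ENNReal.ofReal (ℓ ^ d) := by
  have h : openGridCube ℓ n = (WithLp.ofLp : Euc d → Fin d → ℝ) ⁻¹'
      Set.univ.pi fun m => Set.Ioo (n m * ℓ) ((n m + 1) * ℓ) := by
    ext x; simp [openGridCube]
  rw [h, (PiLp.volume_preserving_ofLp (Fin d)).measure_preimage
    (MeasurableSet.univ_pi fun m => measurableSet_Ioo).nullMeasurableSet, volume_pi_pi]
  simp only [Real.volume_Ioo, add_mul, one_mul, add_sub_cancel_left, Finset.prod_const,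
    Finset.card_univ, Fintype.card_fin, ENNReal.ofReal_pow hℓ]

lemma measurableSet_gridCube (ℓ : ℝ) (n : Fin d → ℤ) : MeasurableSet (gridCube ℓ n) := by
  have h : gridCube ℓ n = ⋂ m, (fun x : Euc d => x m) ⁻¹' Set.Ico (n m * ℓ) ((n m + 1) * ℓ) := by
    ext x; simp [gridCube]
  rw [h]
  exact MeasurableSet.iInter fun m => (by fun_prop : Measurable fun x : Euc d => x m)
    measurableSet_Ico

lemma isOpen_openGridCube (ℓ : ℝ) (n : Fin d → ℤ) : IsOpen (openGridCube ℓ n) := by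
  have h : openGridCube ℓ n =
      ⋂ m, (fun x : Euc d => x m) ⁻¹' Set.Ioo (n m * ℓ) ((n m + 1) * ℓ) := by
    ext x; simp [openGridCube]
  rw [h]
  exact isOpen_iInter_of_finite fun m => isOpen_Ioo.preimage
    (by fun_prop : Continuous fun x : Euc d => x m)

lemma norm_sub_le_of_mem_gridCube {ℓ : ℝ} {n : Fin d → ℤ} {x y : Euc d}
    (hx : x ∈ gridCube ℓ n) (hy : y ∈ gridCube ℓ n) : ‖x - y‖ ≤ d * ℓ := by
  refine (norm_le_sum_norm_apply _).trans ?_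
  calc ∑ j, ‖(x - y) j‖ ≤ ∑ _j : Fin d, ℓ := Finset.sum_le_sum fun j _ => by
        have h1 := hx j
        have h2 := hy j
        rw [Set.mem_Ico, add_mul, one_mul] at h1 h2
        rw [PiLp.sub_apply, Real.norm_eq_abs, abs_le]
        constructor <;> linarith [h1.1, h1.2, h2.1, h2.2]
    _ = d * ℓ := by simp

lemma gridCorner_mem {ℓ : ℝ} (hℓ : 0 < ℓ) (n : Fin d → ℤ) : gridCorner ℓ n ∈ gridCube ℓ n := by
  intro m
  simp [gridCorner, hℓ, add_mul]

lemma mem_gridCube_floor {ℓ : ℝ} (hℓ : 0 < ℓ) (x : Euc d) :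
    x ∈ gridCube ℓ fun m => ⌊x m / ℓ⌋ := (mem_gridCube_iff hℓ).2 fun _ => rfl

lemma gridCube_subset_of_mem {r : ℝ} (hr : 0 < r) {s t : ℕ} (hst : s ≤ t) {n n' : Fin d → ℤ}
    {x : Euc d} (hx : x ∈ gridCube (2 ^ s * r) n) (hx' : x ∈ gridCube (2 ^ t * r) n') :
    gridCube (2 ^ s * r) n ⊆ gridCube (2 ^ t * r) n' := by
  intro y hy
  have hs : 0 < 2 ^ s * r := by positivity
  have ht : 0 < 2 ^ t * r := by positivity
  rw [mem_gridCube_iff hs] at hx hy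
  rw [mem_gridCube_iff ht] at hx' ⊢
  intro m
  have key : ∀ z : ℝ, ⌊z / (2 ^ t * r)⌋ = ⌊z / (2 ^ s * r)⌋ / (2 ^ (t - s) : ℕ) := by
    intro z
    rw [← Int.floor_div_natCast]
    congr 1
    push_cast
    rw [div_div, mul_right_comm, ← pow_add, Nat.add_sub_cancel' hst]
  rw [← hx' m, key, key, hx m, hy m]

/-- Smooth cutoffs adapted to a cube, equal to one on all but a small part of it. -/
lemma exists_contDiff_cutoff {ℓ : ℝ} (hℓ : 0 < ℓ) (n : Fin d → ℤ) {δ : ℝ} (hδ : 0 < δ) :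
    ∃ (χ : Euc d → ℝ) (K : Set (Euc d)), ContDiff ℝ (⊤ : ℕ∞) χ ∧ MeasurableSet K ∧
      K ⊆ gridCube ℓ n ∧ (∀ x, 0 ≤ χ x) ∧ (∀ x, χ x ≤ 1) ∧ (∀ x ∈ K, χ x = 1) ∧
      (∀ x, χ x ≠ 0 → x ∈ gridCube ℓ n) ∧
      volume (gridCube ℓ n \ K) ≤ ENNReal.ofReal (δ * ℓ ^ d) := by
  have hℓd : 0 < ℓ ^ d := by positivity
  obtain ⟨K, hKU, hK, hKv⟩ := (isOpen_openGridCube ℓ n).exists_lt_isCompact (μ := volume)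
    (r := ENNReal.ofReal (ℓ ^ d - δ * ℓ ^ d)) (by
      rw [volume_openGridCube hℓ.le]
      exact (ENNReal.ofReal_lt_ofReal_iff hℓd).2 (by linarith [mul_pos hδ hℓd]))
  obtain ⟨χ, h0, h1, h01⟩ := exists_contMDiffMap_zero_one_of_isClosed (n := ⊤)
    (modelWithCornersSelf ℝ (Euc d))
    (isOpen_openGridCube ℓ n).isClosed_compl hK.isClosed
    (Set.disjoint_left.2 fun x hx hxK => hx (hKU hxK))
  refine ⟨χ, K, χ.contMDiff.contDiff, hK.measurableSet, hKU.trans (openGridCube_subset ℓ n),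
    fun x => (h01 x).1, fun x => (h01 x).2, fun x hx => h1 hx, fun x hx => ?_, ?_⟩
  · by_contra hxU
    exact hx (h0 fun h => hxU (openGridCube_subset ℓ n h))
  · rw [measure_sdiff (hKU.trans (openGridCube_subset ℓ n)) hK.measurableSet.nullMeasurableSet
      hK.measure_lt_top.ne, volume_gridCube hℓ.le, tsub_le_iff_right]
    calc ENNReal.ofReal (ℓ ^ d) = ENNReal.ofReal (δ * ℓ ^ d + (ℓ ^ d - δ * ℓ ^ d)) := by ring_nf
      _ ≤ ENNReal.ofReal (δ * ℓ ^ d) + ENNReal.ofReal (ℓ ^ d - δ * ℓ ^ d) := ENNReal.ofReal_add_le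
      _ ≤ _ := by gcongr

end

section

variable {d : ℕ}

/-- The stopping-time selection of cubes in the Calderón–Zygmund decomposition. -/
lemma exists_stopping_cubes (hd : d ≠ 0) {f : Euc d → ℂ} (hf : Continuous f)
    (hfc : HasCompactSupport f) {lam : ℝ} (hlam : 0 < lam) :
    ∃ (r : ℝ) (S : Finset (ℕ × (Fin d → ℤ))), 0 < r ∧
      (S : Set (ℕ × (Fin d → ℤ))).PairwiseDisjoint (fun i => gridCube (2 ^ i.1 * r) i.2) ∧
      (∀ i ∈ S, lam * (2 ^ i.1 * r) ^ d < ∫ y in gridCube (2 ^ i.1 * r) i.2, ‖f y‖) ∧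
      (∀ i ∈ S, ∫ y in gridCube (2 ^ i.1 * r) i.2, ‖f y‖ ≤ 2 ^ d * lam * (2 ^ i.1 * r) ^ d) ∧
      ∀ x, (∀ i ∈ S, x ∉ gridCube (2 ^ i.1 * r) i.2) → ‖f x‖ ≤ 2 * lam := by
  have hF : Integrable fun y => ‖f y‖ := (hf.integrable_of_hasCompactSupport hfc).norm
  obtain ⟨δ, hδ, hunif⟩ := Metric.uniformContinuous_iff.1
    (hfc.uniformContinuous_of_continuous hf) lam hlam
  set r : ℝ := δ / (d + 1) with hr
  have hr0 : 0 < r := by positivity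
  have hrδ : d * r < δ := by
    have : (d + 1) * r = δ := by rw [hr]; field_simp
    linarith
  have hside : ∀ s : ℕ, 0 < 2 ^ s * r := fun s => by positivity
  obtain ⟨J, hJ⟩ := pow_unbounded_of_one_lt ((∫ y, ‖f y‖) / (lam * r ^ d)) one_lt_two
  have htop : ∫ y, ‖f y‖ ≤ lam * (2 ^ J * r) ^ d := by
    rw [div_lt_iff₀ (by positivity)] at hJ
    calc _ ≤ 2 ^ J * (lam * r ^ d) := hJ.le
      _ ≤ (2 ^ J) ^ d * (lam * r ^ d) := by
        gcongr
        exact le_self_pow₀ (one_le_pow₀ one_le_two) hd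
      _ = _ := by ring
  let sel : Set (ℕ × (Fin d → ℤ)) := {i | i.1 ≤ J ∧
    lam * (2 ^ i.1 * r) ^ d < ∫ y in gridCube (2 ^ i.1 * r) i.2, ‖f y‖ ∧
    ∀ t n, i.1 < t → t ≤ J → (gridCube (2 ^ t * r) n ∩ gridCube (2 ^ i.1 * r) i.2).Nonempty →
      ∫ y in gridCube (2 ^ t * r) n, ‖f y‖ ≤ lam * (2 ^ t * r) ^ d}
  have hfin : sel.Finite := by
    obtain ⟨ρ, hρ⟩ := hfc.isCompact.isBounded.subset_closedBall (0 : Euc d)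
    refine ((Set.finite_Iic J).prod (Set.finite_Icc (fun _ : Fin d => -⌈ρ / r⌉)
      (fun _ => ⌈ρ / r⌉))).subset ?_
    rintro ⟨s, n⟩ ⟨hsJ, hlt, -⟩
    refine ⟨hsJ, ?_⟩
    obtain ⟨x, hxQ, hx⟩ : ∃ x ∈ gridCube (2 ^ s * r) n, f x ≠ 0 := by
      by_contra! hcon
      have h0 : ∫ y in gridCube (2 ^ s * r) n, ‖f y‖ = 0 := by
        rw [setIntegral_congr_fun (g := fun _ => (0 : ℝ)) (measurableSet_gridCube _ _)
          fun y hy => by simp [hcon y hy]]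
        simp
      have := mul_pos hlam (pow_pos (hside s) d)
      simp only [h0] at hlt
      linarith
    have hxρ : ‖x‖ ≤ ρ := by simpa using hρ (subset_tsupport f hx)
    rw [mem_gridCube_iff (hside s)] at hxQ
    have hxm : ∀ m, |x m / (2 ^ s * r)| ≤ ρ / r := fun m => by
      rw [abs_div, abs_of_pos (hside s)]
      have h1 : |x m| ≤ ρ := (PiLp.norm_apply_le x m).trans hxρ
      have h2 : r ≤ 2 ^ s * r := le_mul_of_one_le_left hr0.le (one_le_pow₀ one_le_two)
      exact div_le_div₀ ((abs_nonneg _).trans h1) h1 hr0 h2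
    refine ⟨fun m => ?_, fun m => ?_⟩
    · dsimp only
      rw [← hxQ m, Int.le_floor]
      push_cast
      linarith [(abs_le.1 (hxm m)).1, Int.le_ceil (ρ / r)]
    · dsimp only
      rw [← hxQ m]
      have h3 : ((⌊x m / (2 ^ s * r)⌋ : ℤ) : ℝ) ≤ (⌈ρ / r⌉ : ℤ) :=
        (Int.floor_le _).trans ((abs_le.1 (hxm m)).2.trans (Int.le_ceil _))
      exact Int.cast_le.1 h3
  refine ⟨r, hfin.toFinset, hr0, ?_, ?_, ?_, ?_⟩
  · intro i hi j hj hij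
    rw [Set.Finite.coe_toFinset] at hi hj
    refine Set.disjoint_left.2 fun x hxi hxj => ?_
    rcases lt_trichotomy i.1 j.1 with h | h | h
    · exact absurd hj.2.1 (not_lt.2 (hi.2.2 j.1 j.2 h hj.1 ⟨x, hxj, hxi⟩))
    · refine hij (Prod.ext h (funext fun m => ?_))
      rw [mem_gridCube_iff (hside _)] at hxi hxj
      rw [← hxi m, ← hxj m, h]
    · exact absurd hi.2.1 (not_lt.2 (hj.2.2 i.1 i.2 h hi.1 ⟨x, hxi, hxj⟩))
  · intro i hi
    exact ((Set.Finite.mem_toFinset _).1 hi).2.1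
  · intro i hi
    obtain ⟨hiJ, hlt, hanc⟩ := (Set.Finite.mem_toFinset _).1 hi
    have hiJ' : i.1 < J := by
      refine lt_of_le_of_ne hiJ fun h => ?_
      refine absurd hlt (not_lt.2 ?_)
      rw [h]
      exact (setIntegral_le_integral hF (ae_of_all _ fun _ => norm_nonneg _)).trans htop
    have hx := gridCorner_mem (hside i.1) i.2
    have hx' := mem_gridCube_floor (hside (i.1 + 1)) (gridCorner (2 ^ i.1 * r) i.2)
    calc _ ≤ _ := setIntegral_mono_set hF.integrableOn (ae_of_all _ fun _ => norm_nonneg _)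
            (gridCube_subset_of_mem hr0 (Nat.le_succ i.1) hx hx').eventuallyLE
      _ ≤ _ := hanc _ _ (Nat.lt_succ_self _) hiJ' ⟨_, hx', hx⟩
      _ = _ := by rw [pow_succ]; ring
  · intro x hx
    have hall : ∀ m s, s + m = J → ∫ y in gridCube (2 ^ s * r) (fun m => ⌊x m / (2 ^ s * r)⌋), ‖f y‖
        ≤ lam * (2 ^ s * r) ^ d := by
      intro m
      induction m using Nat.strong_induction_on with
      | _ m ih =>
        intro s hs
        by_contra hcon
        push Not at hcon
        have hxs := mem_gridCube_floor (hside s) x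
        refine hx (s, fun m => ⌊x m / (2 ^ s * r)⌋) ((Set.Finite.mem_toFinset _).2
          ⟨by dsimp only; lia, hcon, fun t n hst htJ hne => ?_⟩) hxs
        obtain ⟨z, hzt, hzs⟩ := hne
        have hxt := gridCube_subset_of_mem hr0 hst.le hzs hzt hxs
        have hn : n = fun m => ⌊x m / (2 ^ t * r)⌋ :=
          funext fun m => ((mem_gridCube_iff (hside t)).1 hxt m).symm
        rw [hn]
        dsimp only at hst
        exact ih (J - t) (by lia) t (by lia)
    have h0 := hall J 0 (zero_add J)
    set Q := gridCube (2 ^ 0 * r) (fun m => ⌊x m / (2 ^ 0 * r)⌋) with hQ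
    have hxQ : x ∈ Q := mem_gridCube_floor (hside 0) x
    have hvol : volume.real Q = (2 ^ 0 * r) ^ d := by
      rw [Measure.real, hQ, volume_gridCube (hside 0).le, ENNReal.toReal_ofReal (by positivity)]
    have hfin' : volume Q ≠ ∞ := by rw [hQ, volume_gridCube (hside 0).le]; exact ofReal_ne_top
    have hlow : ∫ _y in Q, (‖f x‖ - lam) ≤ ∫ y in Q, ‖f y‖ := by
      refine setIntegral_mono_on (integrableOn_const hfin') hF.integrableOn
        (measurableSet_gridCube _ _) fun y hy => ?_
      have h1 := norm_sub_le_of_mem_gridCube hxQ hy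
      have h2 := hunif (a := x) (b := y) (by rw [dist_eq_norm]; linarith [h1, hrδ])
      rw [dist_eq_norm] at h2
      linarith [norm_sub_norm_le (f x) (f y)]
    rw [setIntegral_const, hvol, smul_eq_mul] at hlow
    have hp : 0 < (2 ^ 0 * r) ^ d := by positivity
    have := le_of_mul_le_mul_left ((hlow.trans h0).trans_eq (mul_comm _ _)) hp
    linarith

end

section

variable {d : ℕ}

lemma gridCube_subset_closedBall {ℓ : ℝ} (hℓ : 0 < ℓ) (n : Fin d → ℤ) :
    gridCube ℓ n ⊆ closedBall (gridCorner ℓ n) (d * ℓ) := fun x hx => by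
  rw [mem_closedBall, dist_eq_norm]
  exact norm_sub_le_of_mem_gridCube hx (gridCorner_mem hℓ n)

/-- A smooth mean-zero function on a cube which differs from `f`, off a small subset of the cube,
by the average of `f`. -/
lemma exists_contDiff_atom {ℓ : ℝ} (hℓ : 0 < ℓ) (n : Fin d → ℤ) {f : Euc d → ℂ}
    (hf : ContDiff ℝ (⊤ : ℕ∞) f) (hfi : Integrable f) {lam F δ : ℝ} (hF : ∀ x, ‖f x‖ ≤ F)
    (havg : ∫ y in gridCube ℓ n, ‖f y‖ ≤ 2 ^ d * lam * ℓ ^ d) (hδ : 0 < δ) (hδ2 : δ ≤ 1 / 2) :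
    ∃ (b : Euc d → ℂ) (K : Set (Euc d)), ContDiff ℝ (⊤ : ℕ∞) b ∧ HasCompactSupport b ∧
      (∀ x, b x ≠ 0 → x ∈ gridCube ℓ n) ∧ ∫ y, b y = 0 ∧
      ∫ y, ‖b y‖ ≤ 3 * 2 ^ d * lam * ℓ ^ d ∧ MeasurableSet K ∧
      volume (gridCube ℓ n \ K) ≤ ENNReal.ofReal (δ * ℓ ^ d) ∧
      ∀ x ∈ gridCube ℓ n, ‖f x - b x‖ ^ 2 ≤
        (2 ^ (d + 1) * lam) ^ 2 + (gridCube ℓ n \ K).indicator (fun _ => F ^ 2) x := by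
  obtain ⟨χ, K, hχ, hK, hKQ, h0, h1, hχK, hχQ, hvol⟩ := exists_contDiff_cutoff hℓ n hδ
  set Q := gridCube ℓ n with hQ
  have hQm : MeasurableSet Q := measurableSet_gridCube ℓ n
  have hp : 0 < ℓ ^ d := by positivity
  have hQv : volume Q = ENNReal.ofReal (ℓ ^ d) := volume_gridCube hℓ.le n
  have hQr : volume.real Q = ℓ ^ d := by rw [Measure.real, hQv, ENNReal.toReal_ofReal hp.le]
  have hQf : volume Q ≠ ∞ := by rw [hQv]; exact ofReal_ne_top
  have hχc : HasCompactSupport χ := HasCompactSupport.of_support_subset_isCompact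
    (isCompact_closedBall _ _) fun x hx => gridCube_subset_closedBall hℓ n (hχQ x hx)
  have hχi : Integrable χ := hχ.continuous.integrable_of_hasCompactSupport hχc
  set m := ∫ y, χ y with hm
  have hmlow : ℓ ^ d / 2 ≤ m := by
    have e1 : volume.real K ≤ m := by
      calc volume.real K = ∫ _y in K, (1 : ℝ) := by simp
        _ = ∫ y in K, χ y := setIntegral_congr_fun hK fun y hy => (hχK y hy).symm
        _ ≤ m := setIntegral_le_integral hχi (ae_of_all _ h0)
    have e2 : volume.real Q ≤ volume.real (Q \ K) + volume.real K := by
      refine (measureReal_mono (s₂ := (Q \ K) ∪ K) (fun x hx => ?_)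
        (measure_ne_top_of_subset (Set.union_subset Set.sdiff_subset hKQ) hQf)).trans
        (measureReal_union_le _ _)
      by_cases hxK : x ∈ K
      · exact Or.inr hxK
      · exact Or.inl ⟨hx, hxK⟩
    have e3 : volume.real (Q \ K) ≤ δ * ℓ ^ d :=
      ENNReal.toReal_le_of_le_ofReal (by positivity) hvol
    have e4 : δ * ℓ ^ d ≤ 1 / 2 * ℓ ^ d := by gcongr
    linarith
  have hm0 : 0 < m := (half_pos hp).trans_le hmlow
  set c : ℂ := (∫ y, f y * χ y) / m with hc
  have hfχ : Integrable fun y => f y * (χ y : ℂ) :=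
    hfi.mul_bdd (c := 1) (by
      exact (Complex.continuous_ofReal.comp hχ.continuous).aestronglyMeasurable)
      (ae_of_all _ fun y => by
        rw [Complex.norm_real, Real.norm_eq_abs, abs_of_nonneg (h0 y)]; exact h1 y)
  have hcn : ‖c‖ ≤ 2 ^ (d + 1) * lam := by
    rw [hc, norm_div, Complex.norm_real, Real.norm_eq_abs, abs_of_pos hm0, div_le_iff₀ hm0]
    have e1 : ‖∫ y, f y * χ y‖ ≤ ∫ y in Q, ‖f y‖ := by
      rw [← integral_indicator hQm]
      refine norm_integral_le_of_norm_le (hfi.norm.indicator hQm) (ae_of_all _ fun y => ?_)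
      by_cases hy : y ∈ Q
      · rw [Set.indicator_of_mem hy, norm_mul, Complex.norm_real, Real.norm_eq_abs,
          abs_of_nonneg (h0 y)]
        exact mul_le_of_le_one_right (norm_nonneg _) (h1 y)
      · have : χ y = 0 := by
          by_contra h
          exact hy (hχQ y h)
        simp [this, hy]
    have hl : 0 ≤ 2 ^ d * lam := by
      have : 0 ≤ ∫ y in Q, ‖f y‖ := integral_nonneg fun _ => norm_nonneg _
      exact nonneg_of_mul_nonneg_left (this.trans havg) hp
    calc _ ≤ 2 ^ d * lam * ℓ ^ d := e1.trans havg
      _ = 2 ^ (d + 1) * lam * (ℓ ^ d / 2) := by ring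
      _ ≤ _ := by
        have : 0 ≤ 2 ^ (d + 1) * lam := by rw [pow_succ]; linarith
        gcongr
  have hb0 : ∀ x, (f x - c) * χ x ≠ 0 → x ∈ Q := fun x hx => hχQ x fun h => hx (by simp [h])
  refine ⟨fun x => (f x - c) * χ x, K, ?_, ?_, hb0, ?_, ?_, hK, hvol, ?_⟩
  · exact (hf.sub contDiff_const).mul (Complex.ofRealCLM.contDiff.comp hχ)
  · exact HasCompactSupport.of_support_subset_isCompact (isCompact_closedBall _ _)
      fun x hx => gridCube_subset_closedBall hℓ n (hb0 x hx)
  · simp only [sub_mul]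
    have hcχ : Integrable fun y => c * (χ y : ℂ) := hχi.ofReal.const_mul c
    rw [integral_sub hfχ hcχ, integral_const_mul, integral_complex_ofReal,
      ← hm, hc, div_mul_cancel₀ _ (Complex.ofReal_ne_zero.2 hm0.ne'), sub_self]
  · have hi : Integrable (Q.indicator fun y => ‖f y‖ + ‖c‖) :=
      (integrable_indicator_iff hQm).2 (hfi.norm.integrableOn.add (integrableOn_const hQf))
    calc ∫ y, ‖(f y - c) * χ y‖ ≤ ∫ y, Q.indicator (fun y => ‖f y‖ + ‖c‖) y := by
          refine integral_mono_of_nonneg (ae_of_all _ fun _ => norm_nonneg _) hi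
            (ae_of_all _ fun y => ?_)
          beta_reduce
          by_cases hy : (f y - c) * χ y = 0
          · rw [hy, norm_zero]
            exact Set.indicator_nonneg (fun _ _ => by positivity) _
          · rw [Set.indicator_of_mem (hb0 y hy), norm_mul, Complex.norm_real, Real.norm_eq_abs,
              abs_of_nonneg (h0 y)]
            exact (mul_le_of_le_one_right (norm_nonneg _) (h1 y)).trans (norm_sub_le _ _)
      _ = (∫ y in Q, ‖f y‖) + ‖c‖ * ℓ ^ d := by
          rw [integral_indicator hQm, integral_add hfi.norm.integrableOn (integrableOn_const hQf),
            setIntegral_const, hQr, smul_eq_mul, mul_comm]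
      _ ≤ 2 ^ d * lam * ℓ ^ d + 2 ^ (d + 1) * lam * ℓ ^ d := by gcongr
      _ = _ := by ring
  · intro x hx
    have hu : f x - (f x - c) * χ x = f x * ((1 - χ x : ℝ) : ℂ) + c * χ x := by push_cast; ring
    rw [hu]
    have hF0 : 0 ≤ F := (norm_nonneg _).trans (hF x)
    by_cases hxK : x ∈ K
    · rw [Set.indicator_of_notMem (fun h => h.2 hxK), hχK x hxK]
      simp only [sub_self, Complex.ofReal_zero, mul_zero, zero_add, Complex.ofReal_one, mul_one,
        add_zero]
      gcongr
    · rw [Set.indicator_of_mem (show x ∈ Q \ K from ⟨hx, hxK⟩)]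
      have e1 : ‖f x * ((1 - χ x : ℝ) : ℂ) + c * χ x‖ ≤ F * (1 - χ x) + ‖c‖ * χ x := by
        refine (norm_add_le _ _).trans ?_
        rw [norm_mul, norm_mul, Complex.norm_real, Complex.norm_real, Real.norm_eq_abs,
          Real.norm_eq_abs, abs_of_nonneg (h0 x), abs_of_nonneg (sub_nonneg.2 (h1 x))]
        have := sub_nonneg.2 (h1 x)
        gcongr
        exact hF x
      have e2 : (F * (1 - χ x) + ‖c‖ * χ x) ^ 2 ≤ ‖c‖ ^ 2 + F ^ 2 := by
        have h2 := h0 x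
        have h3 := sub_nonneg.2 (h1 x)
        have e : F ^ 2 * (1 - χ x) + ‖c‖ ^ 2 * χ x - (F * (1 - χ x) + ‖c‖ * χ x) ^ 2 =
          (1 - χ x) * χ x * (F - ‖c‖) ^ 2 := by ring
        nlinarith [mul_nonneg (mul_nonneg h3 h2) (sq_nonneg (F - ‖c‖)),
          mul_nonneg (sq_nonneg F) h2, mul_nonneg (sq_nonneg ‖c‖) h3]
      calc _ ≤ (F * (1 - χ x) + ‖c‖ * χ x) ^ 2 := by gcongr
        _ ≤ ‖c‖ ^ 2 + F ^ 2 := e2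
        _ ≤ _ := by gcongr

end

section

variable {d : ℕ}

/-- The Calderón–Zygmund decomposition with smooth bad functions. -/
lemma exists_isAtomFamily (hd : d ≠ 0) {f : Euc d → ℂ} (hf : ContDiff ℝ (⊤ : ℕ∞) f)
    (hfc : HasCompactSupport f) {lam : ℝ} (hlam : 0 < lam) :
    ∃ (S : Finset (ℕ × (Fin d → ℤ))) (b : ℕ × (Fin d → ℤ) → Euc d → ℂ)
      (c : ℕ × (Fin d → ℤ) → Euc d) (ℓ : ℕ × (Fin d → ℤ) → ℝ)
      (Q : ℕ × (Fin d → ℤ) → Set (Euc d)), IsAtomFamily S b c ℓ Q (3 * 2 ^ d * lam) ∧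
      (∀ i ∈ S, ContDiff ℝ (⊤ : ℕ∞) (b i) ∧ HasCompactSupport (b i)) ∧
      ∑ i ∈ S, volume (Q i) ≤ ENNReal.ofReal lam⁻¹ * ∫⁻ x, ‖f x‖ₑ ∧
      ∫⁻ x, ‖f x - ∑ i ∈ S, b i x‖ₑ ^ 2 ≤
        ENNReal.ofReal ((4 ^ (d + 1) + 3) * lam) * ∫⁻ x, ‖f x‖ₑ := by
  have hfi : Integrable f := hf.continuous.integrable_of_hasCompactSupport hfc
  obtain ⟨F, hF⟩ := hf.continuous.bounded_above_of_compact_support hfc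
  obtain ⟨r, S, hr, hdisj, hlow, hup, hout⟩ := exists_stopping_cubes hd hf.continuous hfc hlam
  let ℓ : ℕ × (Fin d → ℤ) → ℝ := fun i => 2 ^ i.1 * r
  have hℓ : ∀ i, 0 < ℓ i := fun i => by positivity
  let Q : ℕ × (Fin d → ℤ) → Set (Euc d) := fun i => gridCube (ℓ i) i.2
  have hQm : ∀ i, MeasurableSet (Q i) := fun i => measurableSet_gridCube _ _
  have hQv : ∀ i, volume (Q i) = ENNReal.ofReal (ℓ i ^ d) := fun i => volume_gridCube (hℓ i).le _
  set δ : ℝ := min (1 / 2) (lam ^ 2 / (F ^ 2 + 1)) with hδ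
  have hδ0 : 0 < δ := lt_min (by norm_num) (by positivity)
  have hδF : F ^ 2 * δ ≤ lam ^ 2 := by
    calc F ^ 2 * δ ≤ (F ^ 2 + 1) * (lam ^ 2 / (F ^ 2 + 1)) := by
          gcongr
          · linarith
          · exact min_le_right _ _
      _ = lam ^ 2 := by field_simp
  have hex : ∀ i, ∃ (b : Euc d → ℂ) (K : Set (Euc d)), i ∈ S → ContDiff ℝ (⊤ : ℕ∞) b ∧
      HasCompactSupport b ∧ (∀ x, b x ≠ 0 → x ∈ Q i) ∧ ∫ y, b y = 0 ∧
      ∫ y, ‖b y‖ ≤ 3 * 2 ^ d * lam * ℓ i ^ d ∧ MeasurableSet K ∧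
      volume (Q i \ K) ≤ ENNReal.ofReal (δ * ℓ i ^ d) ∧
      ∀ x ∈ Q i, ‖f x - b x‖ ^ 2 ≤
        (2 ^ (d + 1) * lam) ^ 2 + (Q i \ K).indicator (fun _ => F ^ 2) x := by
    intro i
    by_cases hi : i ∈ S
    · obtain ⟨b, K, h⟩ := exists_contDiff_atom (hℓ i) i.2 hf hfi hF (hup i hi) hδ0 (min_le_left _ _)
      exact ⟨b, K, fun _ => h⟩
    · exact ⟨0, ∅, fun h => absurd h hi⟩
  choose b K hbK using hex
  have hsum : ∑ i ∈ S, volume (Q i) ≤ ENNReal.ofReal lam⁻¹ * ∫⁻ x, ‖f x‖ₑ := by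
    have h1 : ∀ i ∈ S, volume (Q i) ≤ ENNReal.ofReal lam⁻¹ * ∫⁻ x in Q i, ‖f x‖ₑ := by
      intro i hi
      rw [← ofReal_integral_norm_eq_lintegral_enorm hfi.integrableOn, hQv i,
        ← ENNReal.ofReal_mul (inv_nonneg.2 hlam.le)]
      refine ENNReal.ofReal_le_ofReal ?_
      rw [inv_mul_eq_div, le_div_iff₀ hlam, mul_comm]
      exact (hlow i hi).le
    calc _ ≤ ∑ i ∈ S, ENNReal.ofReal lam⁻¹ * ∫⁻ x in Q i, ‖f x‖ₑ := Finset.sum_le_sum h1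
      _ = ENNReal.ofReal lam⁻¹ * ∫⁻ x in ⋃ i ∈ S, Q i, ‖f x‖ₑ := by
        rw [lintegral_biUnion_finset hdisj (fun i _ => hQm i), Finset.mul_sum]
      _ ≤ _ := mul_le_mul_right (setLIntegral_le_lintegral _ _) _
  refine ⟨S, b, fun i => gridCorner (ℓ i) i.2, ℓ, Q, ⟨fun i _ => hℓ i, fun i _ => hQm i, hdisj,
    fun i _ => hQv i, fun i _ x hx => norm_sub_le_of_mem_gridCube hx (gridCorner_mem (hℓ i) _),
    fun i hi => ?_, fun i hi => (hbK i hi).2.2.1, fun i hi => (hbK i hi).2.2.2.1,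
    fun i hi => (hbK i hi).2.2.2.2.1⟩, fun i hi => ⟨(hbK i hi).1, (hbK i hi).2.1⟩, hsum, ?_⟩
  · exact (hbK i hi).1.continuous.integrable_of_hasCompactSupport (hbK i hi).2.1
  set B : ℝ := (2 ^ (d + 1) * lam) ^ 2 with hB
  have hpt : ∀ x, ‖f x - ∑ i ∈ S, b i x‖ₑ ^ 2 ≤ ENNReal.ofReal (2 * lam) * ‖f x‖ₑ +
      ∑ i ∈ S, ((Q i).indicator (fun _ => ENNReal.ofReal B) x +
        (Q i \ K i).indicator (fun _ => ENNReal.ofReal (F ^ 2)) x) := by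
    intro x
    by_cases hx : ∃ i ∈ S, x ∈ Q i
    · obtain ⟨i, hi, hxi⟩ := hx
      have hs : ∑ j ∈ S, b j x = b i x := by
        refine Finset.sum_eq_single_of_mem i hi fun j hj hji => ?_
        by_contra hne
        exact Set.disjoint_left.1 (hdisj hj hi hji) ((hbK j hj).2.2.1 x hne) hxi
      refine le_add_left ?_
      refine le_trans ?_ (Finset.single_le_sum (f := fun i =>
        (Q i).indicator (fun _ => ENNReal.ofReal B) x +
        (Q i \ K i).indicator (fun _ => ENNReal.ofReal (F ^ 2)) x) (fun _ _ => zero_le) hi)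
      rw [hs, ← ofReal_norm, ← ENNReal.ofReal_pow (norm_nonneg _), Set.indicator_of_mem hxi]
      refine (ENNReal.ofReal_le_ofReal ((hbK i hi).2.2.2.2.2.2.2 x hxi)).trans ?_
      refine ENNReal.ofReal_add_le.trans (add_le_add le_rfl ?_)
      by_cases hxK : x ∈ Q i \ K i <;> simp [hxK]
    · push Not at hx
      have hs : ∑ j ∈ S, b j x = 0 := Finset.sum_eq_zero fun j hj => by
        by_contra hne
        exact hx j hj ((hbK j hj).2.2.1 x hne)
      rw [hs, sub_zero, sq]
      refine le_add_right (mul_le_mul_left ?_ _)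
      rw [← ofReal_norm]
      exact ENNReal.ofReal_le_ofReal (hout x hx)
  have h_int : ∀ i ∈ S, ∫⁻ x, ((Q i).indicator (fun _ => ENNReal.ofReal B) x +
      (Q i \ K i).indicator (fun _ => ENNReal.ofReal (F ^ 2)) x) ≤
      ENNReal.ofReal ((4 ^ (d + 1) + 1) * lam ^ 2) * volume (Q i) := by
    intro i hi
    rw [lintegral_add_left (measurable_const.indicator (hQm i)),
      lintegral_indicator_const (hQm i),
      lintegral_indicator_const ((hQm i).diff (hbK i hi).2.2.2.2.2.1)]
    have hp : 0 ≤ ℓ i ^ d := pow_nonneg (hℓ i).le d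
    calc _ ≤ ENNReal.ofReal B * volume (Q i) +
          ENNReal.ofReal (F ^ 2) * ENNReal.ofReal (δ * ℓ i ^ d) := by
          gcongr
          exact (hbK i hi).2.2.2.2.2.2.1
      _ = ENNReal.ofReal (B * ℓ i ^ d + F ^ 2 * (δ * ℓ i ^ d)) := by
          rw [hQv i, ← ENNReal.ofReal_mul (by positivity), ← ENNReal.ofReal_mul (by positivity),
            ← ENNReal.ofReal_add (by positivity) (by positivity)]
      _ ≤ ENNReal.ofReal ((4 ^ (d + 1) + 1) * lam ^ 2 * ℓ i ^ d) := by
          refine ENNReal.ofReal_le_ofReal ?_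
          have e : B = 4 ^ (d + 1) * lam ^ 2 := by
            rw [hB, mul_pow, ← pow_mul, mul_comm (d + 1) 2, pow_mul]; norm_num
          rw [e]
          nlinarith [mul_le_mul_of_nonneg_right hδF hp]
      _ = _ := by rw [ENNReal.ofReal_mul (by positivity), hQv i]
  calc _ ≤ ∫⁻ x, (ENNReal.ofReal (2 * lam) * ‖f x‖ₑ +
      ∑ i ∈ S, ((Q i).indicator (fun _ => ENNReal.ofReal B) x +
        (Q i \ K i).indicator (fun _ => ENNReal.ofReal (F ^ 2)) x)) := lintegral_mono hpt
    _ = ENNReal.ofReal (2 * lam) * (∫⁻ x, ‖f x‖ₑ) +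
        ∑ i ∈ S, ∫⁻ x, ((Q i).indicator (fun _ => ENNReal.ofReal B) x +
        (Q i \ K i).indicator (fun _ => ENNReal.ofReal (F ^ 2)) x) := by
      rw [lintegral_add_left' (hfi.1.enorm.const_mul _), lintegral_const_mul' _ _ ofReal_ne_top,
        lintegral_finsetSum' _ fun i hi => ?_]
      exact ((measurable_const.indicator (hQm i)).add (measurable_const.indicator
        ((hQm i).diff (hbK i hi).2.2.2.2.2.1))).aemeasurable
    _ ≤ ENNReal.ofReal (2 * lam) * (∫⁻ x, ‖f x‖ₑ) +
        ENNReal.ofReal ((4 ^ (d + 1) + 1) * lam ^ 2) *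
          (ENNReal.ofReal lam⁻¹ * ∫⁻ x, ‖f x‖ₑ) := by
      refine add_le_add le_rfl ((Finset.sum_le_sum h_int).trans ?_)
      rw [← Finset.mul_sum]
      gcongr
    _ = _ := by
      rw [← mul_assoc, ← ENNReal.ofReal_mul (by positivity), ← add_mul,
        ← ENNReal.ofReal_add (by positivity) (by positivity)]
      congr 2
      field_simp
      ring

end

section

variable {d : ℕ}

lemma measurable_calKer {ω A : Euc d → ℝ} (hω : Measurable ω) (hA : Measurable A) (k : ℕ) :
    Measurable (Function.uncurry (calKer ω A k)) := by
  have h1 : Measurable fun p : Euc d × Euc d => p.1 - p.2 := measurable_fst.sub measurable_snd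
  exact ((hω.comp h1).div (h1.norm.pow_const d)).mul
    ((((hA.comp measurable_fst).sub (hA.comp measurable_snd)).div h1.norm).pow_const k)

lemma abs_calKer_le {ω A : Euc d → ℝ} (hω1 : ∀ v, |ω v| ≤ 1)
    (hA : ∀ x y, |A x - A y| ≤ ‖x - y‖) (k : ℕ) {ε : ℝ} (hε : 0 < ε) {x y : Euc d}
    (h : ε < ‖x - y‖) : |calKer ω A k x y| ≤ 1 / ε ^ d := by
  have h0 : 0 < ‖x - y‖ := hε.trans h
  rw [calKer, abs_mul, abs_div, abs_pow, abs_pow, abs_div, abs_norm]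
  calc _ ≤ 1 / ε ^ d * 1 ^ k := by
        gcongr
        · exact hω1 _
        · exact (div_le_one h0).2 (hA x y)
    _ = _ := by rw [one_pow, mul_one]

lemma continuous_of_abs_sub_le {A : Euc d → ℝ} (hA : ∀ x y, |A x - A y| ≤ ‖x - y‖) :
    Continuous A :=
  (LipschitzWith.of_dist_le_mul (K := 1) fun x y => by
    rw [Real.dist_eq, dist_eq_norm, NNReal.coe_one, one_mul]; exact hA x y).continuous

lemma measurableSet_lt_norm_sub (ε : ℝ) (x : Euc d) : MeasurableSet {y : Euc d | ε < ‖x - y‖} :=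
  measurableSet_lt measurable_const (measurable_const.sub measurable_id).norm

lemma integrableOn_calKer_mul {ω A : Euc d → ℝ} (hω : Measurable ω) (hω1 : ∀ v, |ω v| ≤ 1)
    (hA : ∀ x y, |A x - A y| ≤ ‖x - y‖) (k : ℕ) {ε : ℝ} (hε : 0 < ε) (x : Euc d)
    {g : Euc d → ℂ} (hg : Integrable g) :
    IntegrableOn (fun y => (calKer ω A k x y : ℂ) * g y) {y | ε < ‖x - y‖} := by
  refine hg.integrableOn.bdd_mul (c := 1 / ε ^ d) ?_ ?_
  · exact (Complex.measurable_ofReal.comp ((measurable_calKer hω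
      (continuous_of_abs_sub_le hA).measurable k).comp
        (measurable_const.prodMk measurable_id))).aestronglyMeasurable
  · refine ae_restrict_of_forall_mem (measurableSet_lt_norm_sub ε x) fun y hy => ?_
    rw [Complex.norm_real]
    exact abs_calKer_le hω1 hA k hε hy

/-- Off the exceptional set, truncating the kernel has no effect on an atom. -/
lemma setIntegral_calKer_eq {ω A : Euc d → ℝ} {k : ℕ} {b : Euc d → ℂ} {Q : Set (Euc d)}
    {c x : Euc d} {ℓ ε : ℝ} (hb : ∀ y, b y ≠ 0 → y ∈ Q) (hQ : ∀ y ∈ Q, ‖y - c‖ ≤ d * ℓ)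
    (hx : (d + 1) * ℓ < ‖x - c‖) (hε : ε ≤ ℓ) :
    ∫ y in {y | ε < ‖x - y‖}, (calKer ω A k x y : ℂ) * b y = ∫ y, (calKer ω A k x y : ℂ) * b y := by
  refine setIntegral_eq_integral_of_forall_compl_eq_zero fun y hy => ?_
  by_contra hne
  refine hy ?_
  have h1 := hQ y (hb y (right_ne_zero_of_mul hne))
  have h2 : ‖x - c‖ ≤ ‖x - y‖ + ‖y - c‖ := by simpa using norm_add_le (x - y) (y - c)
  rw [Set.mem_ofPred_eq]
  linarith

lemma lintegral_sq_eq_eLpNorm (f : Euc d → ℂ) : ∫⁻ x, ‖f x‖ₑ ^ 2 = eLpNorm f 2 volume ^ 2 := by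
  have := eLpNorm_nnreal_pow_eq_lintegral (f := f) (μ := volume) (p := 2) two_ne_zero
  simpa using this.symm

/-- The principal value commutator is measurable. -/
lemma aestronglyMeasurable_of_tendsto_calKer {ω A : Euc d → ℝ} (hω : Measurable ω)
    (hA : Measurable A) {k : ℕ} {u g : Euc d → ℂ} (hu : Continuous u)
    (h : ∀ᵐ x, Tendsto (fun ε : ℝ => ∫ y in {y | ε < ‖x - y‖}, (calKer ω A k x y : ℂ) * u y)
      (𝓝[>] 0) (𝓝 (g x))) : AEStronglyMeasurable g := by
  have hseq : Tendsto (fun n : ℕ => 1 / ((n : ℝ) + 1)) atTop (𝓝[>] 0) :=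
    tendsto_nhdsWithin_iff.2 ⟨tendsto_one_div_add_atTop_nhds_zero_nat,
      Eventually.of_forall fun n => Set.mem_Ioi.2 (by positivity)⟩
  refine aestronglyMeasurable_of_tendsto_ae atTop
    (f := fun (n : ℕ) x => ∫ y in {y | 1 / ((n : ℝ) + 1) < ‖x - y‖}, (calKer ω A k x y : ℂ) * u y)
    (fun n => ?_) (h.mono fun x hx => hx.comp hseq)
  have hm : Measurable (Function.uncurry fun x y : Euc d =>
      ({y | 1 / ((n : ℝ) + 1) < ‖x - y‖}).indicator (fun y => (calKer ω A k x y : ℂ) * u y) y) := by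
    have hs : MeasurableSet {p : Euc d × Euc d | 1 / ((n : ℝ) + 1) < ‖p.1 - p.2‖} :=
      measurableSet_lt measurable_const (measurable_fst.sub measurable_snd).norm
    exact ((Complex.measurable_ofReal.comp (measurable_calKer hω hA k)).mul
      (hu.measurable.comp measurable_snd)).indicator
        hs
  have := (hm.stronglyMeasurable.integral_prod_right (ν := volume)).aestronglyMeasurable (μ := volume)
  refine this.congr (ae_of_all _ fun x => ?_)
  exact integral_indicator (measurableSet_lt_norm_sub _ x)

/-- The weak-type estimate for normalised data. -/
lemma exists_weak_type_normalized (hd : 2 ≤ d) {k : ℕ} (hk : 1 ≤ k) (A₀ : ℝ) :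
    ∃ C : ℝ, 0 < C ∧ ∀ (ω A : Euc d → ℝ) (T : (Euc d → ℂ) → Euc d → ℂ), Measurable ω →
      (∀ v, |ω v| ≤ 1) → (∀ t : ℝ, 0 < t → ∀ v, v ≠ 0 → ω (t • v) = ω v) →
      (∀ x y, |A x - A y| ≤ ‖x - y‖) →
      (∀ f : Euc d → ℂ, ContDiff ℝ (⊤ : ℕ∞) f → HasCompactSupport f → ∀ᵐ x,
        Tendsto (fun ε : ℝ => ∫ y in {y | ε < ‖x - y‖}, (calKer ω A k x y : ℂ) * f y)
          (𝓝[>] 0) (𝓝 (T f x))) →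
      (∀ f : Euc d → ℂ, ContDiff ℝ (⊤ : ℕ∞) f → HasCompactSupport f →
        eLpNorm (T f) 2 volume ≤ ENNReal.ofReal A₀ * eLpNorm f 2 volume) →
      ∀ lam : ℝ, 0 < lam → ∀ f : Euc d → ℂ, ContDiff ℝ (⊤ : ℕ∞) f → HasCompactSupport f →
        volume {x | lam < ‖T f x‖} ≤ ENNReal.ofReal (C * lam⁻¹) * eLpNorm f 1 volume := by
  obtain ⟨K, hK0, hK⟩ := exists_volume_sum_integral_calKer_le (ℕ × (Fin d → ℤ)) hd hk
  set X : ℝ := 6 * 2 ^ d with hX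
  have hu0 := unitVol_nonneg d
  set D₁ : ℝ := unitVol d * (d + 1) ^ d with hD₁
  set D₂ : ℝ := 4 * A₀ ^ 2 * (4 ^ (d + 1) + 3) with hD₂
  set D₃ : ℝ := K * (X + X ^ 2) with hD₃
  refine ⟨D₁ + D₂ + D₃ + 1, by positivity, ?_⟩
  intro ω A T hω hω1 hωh hA hpv hL2 lam hlam f hf hfc
  obtain ⟨S, b, c, ℓ, Q, hS, hb, hvol, hu⟩ := exists_isAtomFamily (by lia) hf hfc hlam
  set I := ∫⁻ x, ‖f x‖ₑ with hI
  set u : Euc d → ℂ := fun x => f x - ∑ i ∈ S, b i x with hu_def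
  have hus : ContDiff ℝ (⊤ : ℕ∞) u := hf.sub (ContDiff.sum fun i hi => (hb i hi).1)
  have huc : HasCompactSupport u := by
    have h1 : ∀ S' ⊆ S, HasCompactSupport fun x => ∑ i ∈ S', b i x := by
      intro S' hS'
      induction S' using Finset.induction_on with
      | empty => simp only [Finset.sum_empty]; exact HasCompactSupport.zero
      | insert i S'' hi ih =>
        simp only [Finset.sum_insert hi]
        exact (hb i (hS' (Finset.mem_insert_self i S''))).2.add
          (ih ((Finset.subset_insert i S'').trans hS'))
    exact hfc.sub (h1 S subset_rfl)
  have hui : Integrable u := hus.continuous.integrable_of_hasCompactSupport huc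
  have hTu : AEStronglyMeasurable (T u) :=
    aestronglyMeasurable_of_tendsto_calKer hω (continuous_of_abs_sub_le hA).measurable
      hus.continuous (hpv u hus huc)
  have hTu2 : ∫⁻ x, ‖T u x‖ₑ ^ 2 ≤ ENNReal.ofReal (A₀ ^ 2 * ((4 ^ (d + 1) + 3) * lam)) * I := by
    rw [lintegral_sq_eq_eLpNorm]
    calc _ ≤ (ENNReal.ofReal A₀ * eLpNorm u 2 volume) ^ 2 := by gcongr; exact hL2 u hus huc
      _ = ENNReal.ofReal A₀ ^ 2 * ∫⁻ x, ‖u x‖ₑ ^ 2 := by rw [mul_pow, lintegral_sq_eq_eLpNorm]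
      _ ≤ ENNReal.ofReal (A₀ ^ 2) * (ENNReal.ofReal ((4 ^ (d + 1) + 3) * lam) * I) := by
        gcongr
        rw [← sq_abs A₀, ENNReal.ofReal_pow (abs_nonneg _)]
        gcongr
        exact le_abs_self _
      _ = _ := by rw [← mul_assoc, ← ENNReal.ofReal_mul (by positivity)]
  have h2 := volume_lt_norm_le_of_lintegral_sq hTu (half_pos hlam) hTu2
  have h3 := hK S b c ℓ Q _ ω A (lam / 2) hS (by positivity) hA hω hω1 hωh (half_pos hlam)
  have hsub : ∀ᵐ x, lam < ‖T f x‖ → x ∈ (⋃ i ∈ S, closedBall (c i) ((d + 1) * ℓ i)) ∪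
      {x | lam / 2 ≤ ‖T u x‖} ∪ {x | (∀ i ∈ S, (d + 1) * ℓ i < ‖x - c i‖) ∧
        lam / 2 < ‖∑ i ∈ S, ∫ y, (calKer ω A k x y : ℂ) * b i y‖} := by
    filter_upwards [hpv f hf hfc, hpv u hus huc] with x hxf hxu hx
    by_cases hxc : ∀ i ∈ S, (d + 1) * ℓ i < ‖x - c i‖
    · have hT : T f x = T u x + ∑ i ∈ S, ∫ y, (calKer ω A k x y : ℂ) * b i y := by
        refine tendsto_nhds_unique hxf ((hxu.add_const _).congr' ?_)
        have hev : ∀ᶠ ε : ℝ in 𝓝[>] 0, ∀ i ∈ S, ε ≤ ℓ i :=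
          (Finset.eventually_all S).2 fun i hi => nhdsWithin_le_nhds
            ((eventually_lt_nhds (hS.side_pos i hi)).mono fun _ h => h.le)
        filter_upwards [hev, self_mem_nhdsWithin] with ε hε hε0
        have hi1 := integrableOn_calKer_mul hω hω1 hA k hε0 x hui
        have hi2 := fun i (hi : i ∈ S) =>
          integrableOn_calKer_mul hω hω1 hA k hε0 x (hS.integrable i hi)
        rw [Finset.sum_congr rfl fun i hi => (setIntegral_calKer_eq (ω := ω) (A := A) (k := k)
          (hS.supp i hi) (hS.norm_sub_le i hi) (hxc i hi) (hε i hi)).symm,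
          ← integral_finsetSum _ hi2, ← integral_add hi1 (integrable_finsetSum _ hi2)]
        refine integral_congr_ae (ae_of_all _ fun y => ?_)
        beta_reduce
        rw [← Finset.mul_sum, ← mul_add, hu_def]
        simp
      by_cases h : lam / 2 ≤ ‖T u x‖
      · exact Or.inl (Or.inr h)
      · refine Or.inr ⟨hxc, ?_⟩
        rw [hT] at hx
        have := norm_add_le (T u x) (∑ i ∈ S, ∫ y, (calKer ω A k x y : ℂ) * b i y)
        push Not at h
        linarith
    · push Not at hxc
      obtain ⟨i, hi, hxi⟩ := hxc
      refine Or.inl (Or.inl (Set.mem_biUnion hi ?_))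
      rwa [mem_closedBall, dist_eq_norm]
  have h1 : volume (⋃ i ∈ S, closedBall (c i) ((d + 1) * ℓ i)) ≤
      ENNReal.ofReal D₁ * ∑ i ∈ S, volume (Q i) := by
    refine (measure_biUnion_finset_le _ _).trans ?_
    rw [Finset.mul_sum]
    refine Finset.sum_le_sum fun i hi => le_of_eq ?_
    have := hS.side_pos i hi
    rw [volume_closedBall_eq _ (by positivity), hS.volume_eq i hi,
      ← ENNReal.ofReal_mul (by positivity), hD₁, mul_pow, mul_assoc]
  calc volume {x | lam < ‖T f x‖} ≤ volume ((⋃ i ∈ S, closedBall (c i) ((d + 1) * ℓ i)) ∪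
      {x | lam / 2 ≤ ‖T u x‖} ∪ {x | (∀ i ∈ S, (d + 1) * ℓ i < ‖x - c i‖) ∧
        lam / 2 < ‖∑ i ∈ S, ∫ y, (calKer ω A k x y : ℂ) * b i y‖}) := measure_mono_ae hsub
    _ ≤ ENNReal.ofReal D₁ * (ENNReal.ofReal lam⁻¹ * I) + ENNReal.ofReal (D₂ * lam⁻¹) * I +
        ENNReal.ofReal D₃ * (ENNReal.ofReal lam⁻¹ * I) := by
      refine (measure_union_le _ _).trans (add_le_add ((measure_union_le _ _).trans
        (add_le_add ?_ ?_)) ?_)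
      · exact h1.trans (by gcongr)
      · refine h2.trans (le_of_eq ?_)
        congr 2
        rw [hD₂]
        field_simp
        ring
      · refine h3.trans ?_
        have e : 3 * 2 ^ d * lam / (lam / 2) = X := by rw [hX]; field_simp; norm_num
        rw [e]
        gcongr
    _ = ENNReal.ofReal ((D₁ + D₂ + D₃) * lam⁻¹) * I := by
      have hl := inv_nonneg.2 hlam.le
      rw [← mul_assoc, ← mul_assoc, ← ENNReal.ofReal_mul (by positivity),
        ← ENNReal.ofReal_mul (by positivity), ← add_mul, ← add_mul,
        ← ENNReal.ofReal_add (by positivity) (by positivity),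
        ← ENNReal.ofReal_add (by positivity) (by positivity)]
      congr 2
      ring
    _ ≤ _ := by
      rw [eLpNorm_one_eq_lintegral_enorm]
      refine mul_le_mul_left (ENNReal.ofReal_le_ofReal ?_) _
      have hl := inv_nonneg.2 hlam.le
      nlinarith

end

section

variable {d : ℕ}

/-- A homogeneous function is almost everywhere bounded by its essential supremum on the sphere. -/
lemma ae_abs_le_sphLinf {Ω : Euc d → ℝ}
    (hΩh : ∀ r : ℝ, 0 < r → ∀ x : Euc d, x ≠ 0 → Ω (r • x) = Ω x) (hΩ : sphLinf d Ω ≠ ∞) :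
    ∀ᵐ v : Euc d, v ≠ 0 → |Ω v| ≤ (sphLinf d Ω).toReal := by
  have h1 : ∀ᵐ θ : sphere (0 : Euc d) 1 ∂(volume : Measure (Euc d)).toSphere,
      |Ω θ| ≤ (sphLinf d Ω).toReal := by
    filter_upwards [ae_le_eLpNormEssSup
      (f := fun θ : sphere (0 : Euc d) 1 => Ω θ) (μ := sphereMeasure d)] with θ hθ
    rw [← eLpNorm_exponent_top] at hθ
    simpa using ENNReal.toReal_mono hΩ hθ
  have h2 := (Measure.measurePreserving_homeomorphUnitSphereProd
    (volume : Measure (Euc d))).quasiMeasurePreserving.ae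
      (Measure.quasiMeasurePreserving_fst.ae h1)
  have h3 : ∀ᵐ v ∂(volume : Measure (Euc d)).restrict {0}ᶜ, |Ω v| ≤ (sphLinf d Ω).toReal := by
    rw [← Subtype.range_coe (s := ({0}ᶜ : Set (Euc d))), ← (MeasurableEmbedding.subtype_coe
      (measurableSet_singleton (0 : Euc d)).compl).map_comap, (MeasurableEmbedding.subtype_coe
      (measurableSet_singleton (0 : Euc d)).compl).ae_map_iff]
    filter_upwards [h2] with v hv
    have hv0 : (v : Euc d) ≠ 0 := v.2
    rw [homeomorphUnitSphereProd_apply_fst_coe, hΩh _ (inv_pos.2 (norm_pos_iff.2 hv0)) _ hv0] at hv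
    exact hv
  exact (ae_restrict_iff' (measurableSet_singleton (0 : Euc d)).compl).1 h3

/-- The weak-type estimate vanishes when the `L²` bound does. -/
lemma volume_lt_norm_eq_zero {g : Euc d → ℂ} (hg : AEStronglyMeasurable g)
    (h : eLpNorm g 2 volume = 0) {lam : ℝ} (hlam : 0 < lam) :
    volume {x | lam < ‖g x‖} = 0 := by
  have h0 := (eLpNorm_eq_zero_iff hg two_ne_zero).1 h
  have : ∀ᵐ x, ¬ lam < ‖g x‖ := by
    filter_upwards [h0] with x hx
    rw [hx]
    simpa using hlam.le
  simpa [ae_iff] using this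

/-- Rescaling the data of the commutator. -/
lemma calKer_div {Ω ω A : Euc d → ℝ} {W L : ℝ} {k : ℕ} {x y : Euc d}
    (h : ω (x - y) = Ω (x - y) / W) :
    calKer ω (fun z => A z / L) k x y = (W * L ^ k)⁻¹ * calKer Ω A k x y := by
  rw [calKer, calKer, h, ← sub_div, div_right_comm (A x - A y), div_pow _ L, mul_inv]
  ring

end

end CalderonCommutator

open CalderonCommutator

theorem higher_order_calderon_commutator_weak11
    (d : ℕ) (hd : 2 ≤ d) (k : ℕ) (hk : 1 ≤ k) (A₀ : ℝ) (hA₀ : 0 < A₀) :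
    ∃ C : ℝ, 0 < C ∧
      ∀ (Ω : EuclideanSpace ℝ (Fin d) → ℝ)
        (A : EuclideanSpace ℝ (Fin d) → ℝ) (L : NNReal)
        (T : (EuclideanSpace ℝ (Fin d) → ℂ) → EuclideanSpace ℝ (Fin d) → ℂ),
        -- Ω is measurable, homogeneous of degree zero, and Ω|_{S^{d-1}} ∈ L^∞(S^{d-1})
        Measurable Ω →
        (∀ r : ℝ, 0 < r → ∀ x : EuclideanSpace ℝ (Fin d), x ≠ 0 → Ω (r • x) = Ω x) →
        sphLinf d Ω ≠ ∞ →
        -- moment (cancellation) conditions: ∫ Ω(θ) θ^α dθ = 0 for all |α| = k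
        (∀ α : Fin d → ℕ, (∑ i, α i) = k →
          ∫ θ : sphere (0 : EuclideanSpace ℝ (Fin d)) 1,
            Ω θ * ∏ i, ((θ : EuclideanSpace ℝ (Fin d)) i) ^ (α i) ∂(sphereMeasure d) = 0) →
        -- A is Lipschitz with constant L = ‖∇A‖_∞
        LipschitzWith L A →
        -- T f is the a.e. principal value of the k-th order Calderón commutator
        (∀ f : EuclideanSpace ℝ (Fin d) → ℂ, ContDiff ℝ (⊤ : ℕ∞) f → HasCompactSupport f →
          ∀ᵐ x : EuclideanSpace ℝ (Fin d) ∂volume,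
            Tendsto (fun ε : ℝ =>
                ∫ y in {y : EuclideanSpace ℝ (Fin d) | ε < ‖x - y‖},
                  ((Ω (x - y) / ‖x - y‖ ^ d * ((A x - A y) / ‖x - y‖) ^ k : ℝ) : ℂ) * f y)
              (𝓝[>] 0) (𝓝 (T f x))) →
        -- Hofmann's L² bound (Theorem D)
        (∀ f : EuclideanSpace ℝ (Fin d) → ℂ, ContDiff ℝ (⊤ : ℕ∞) f → HasCompactSupport f →
          eLpNorm (T f) 2 volume ≤
            ENNReal.ofReal (A₀ * (sphLinf d Ω).toReal * (L : ℝ) ^ k) * eLpNorm f 2 volume) →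
        -- weak type (1,1) bound
        ∀ lam : ℝ, 0 < lam →
          ∀ f : EuclideanSpace ℝ (Fin d) → ℂ, ContDiff ℝ (⊤ : ℕ∞) f → HasCompactSupport f →
            volume {x : EuclideanSpace ℝ (Fin d) | lam < ‖T f x‖} ≤
              ENNReal.ofReal (C * lam⁻¹ * (sphLinf d Ω).toReal * (L : ℝ) ^ k) *
                eLpNorm f 1 volume := by
  obtain ⟨C, hC, hmain⟩ := exists_weak_type_normalized hd hk A₀
  refine ⟨C, hC, fun Ω A L T hΩ hΩh hΩb _ hA hpv hL2 lam hlam f hf hfc => ?_⟩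
  set W : ℝ := (sphLinf d Ω).toReal with hW
  have hW0 : 0 ≤ W := ENNReal.toReal_nonneg
  rcases eq_or_lt_of_le (show 0 ≤ W * (L : ℝ) ^ k by positivity) with hc | hc
  · have h2 := hL2 f hf hfc
    rw [mul_assoc, ← hc, mul_zero, ENNReal.ofReal_zero, zero_mul, nonpos_iff_eq_zero] at h2
    rw [volume_lt_norm_eq_zero (aestronglyMeasurable_of_tendsto_calKer hΩ
      hA.continuous.measurable hf.continuous (hpv f hf hfc)) h2 hlam]
    exact zero_le
  have hW1 : 0 < W := lt_of_le_of_ne hW0 fun h => by rw [← h, zero_mul] at hc; exact hc.ne rfl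
  have hL1 : (0 : ℝ) < L := by
    refine lt_of_le_of_ne L.2 fun h => ?_
    rw [← h, zero_pow (by lia), mul_zero] at hc
    exact hc.ne rfl
  set c : ℝ := W * (L : ℝ) ^ k with hc_def
  set ω : EuclideanSpace ℝ (Fin d) → ℝ := fun v => if |Ω v / W| ≤ 1 then Ω v / W else 0 with hω
  have hωae : ∀ᵐ v, v ≠ 0 → ω v = Ω v / W := by
    filter_upwards [ae_abs_le_sphLinf hΩh hΩb] with v hv hv0
    rw [hω]
    refine if_pos ?_
    rw [abs_div, abs_of_pos hW1]
    exact (div_le_one hW1).2 (hv hv0)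
  have key := hmain ω (fun z => A z / L) (fun g x => ((c⁻¹ : ℝ) : ℂ) * T g x) ?_ ?_ ?_ ?_ ?_ ?_
    (lam / c) (by positivity) f hf hfc
  · have hset : {x | lam / c < ‖((c⁻¹ : ℝ) : ℂ) * T f x‖} = {x | lam < ‖T f x‖} := by
      ext x
      rw [Set.mem_ofPred_eq, Set.mem_ofPred_eq, norm_mul, Complex.norm_real, Real.norm_eq_abs,
        abs_of_pos (inv_pos.2 hc), inv_mul_eq_div, div_lt_div_iff_of_pos_right hc]
    rw [hset] at key
    convert key using 3
    rw [inv_div, hc_def]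
    ring
  · exact Measurable.ite (measurableSet_le (hΩ.div_const W).abs measurable_const)
      (hΩ.div_const W) measurable_const
  · intro v
    simp only [hω]
    split_ifs with h
    · exact h
    · simp
  · intro t ht v hv
    simp only [hω, hΩh t ht v hv]
  · intro x y
    rw [← sub_div, abs_div, abs_of_pos hL1, div_le_iff₀ hL1, mul_comm]
    simpa [Real.dist_eq, dist_eq_norm] using hA.dist_le_mul x y
  · intro g hg hgc
    filter_upwards [hpv g hg hgc] with x hx
    refine (hx.const_mul ((c⁻¹ : ℝ) : ℂ)).congr' ?_
    filter_upwards [self_mem_nhdsWithin] with ε hε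
    rw [← integral_const_mul]
    have hq : ∀ᵐ y : EuclideanSpace ℝ (Fin d), x - y ≠ 0 → ω (x - y) = Ω (x - y) / W :=
      (Measure.measurePreserving_sub_left volume x).quasiMeasurePreserving.ae hωae
    refine setIntegral_congr_ae (measurableSet_lt_norm_sub ε x) ?_
    filter_upwards [hq] with y hy hyε
    have h0 : x - y ≠ 0 := norm_pos_iff.1 (lt_trans hε hyε)
    rw [calKer_div (hy h0), ← hc_def, Complex.ofReal_mul c⁻¹, mul_assoc]
    rfl
  · intro g hg hgc
    have h2 := eLpNorm_const_smul (((c⁻¹ : ℝ) : ℂ)) (T g) 2 (volume : Measure (EuclideanSpace ℝ (Fin d)))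
    have h3 : eLpNorm (fun x => ((c⁻¹ : ℝ) : ℂ) * T g x) 2 volume =
        ENNReal.ofReal c⁻¹ * eLpNorm (T g) 2 volume := by
      rw [show (fun x => ((c⁻¹ : ℝ) : ℂ) * T g x) = ((c⁻¹ : ℝ) : ℂ) • T g from rfl, h2,
        ← ofReal_norm, Complex.norm_real, Real.norm_eq_abs, abs_of_pos (inv_pos.2 hc)]
    rw [h3]
    calc _ ≤ ENNReal.ofReal c⁻¹ * (ENNReal.ofReal (A₀ * W * (L : ℝ) ^ k) * eLpNorm g 2 volume) := by
          gcongr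
          exact hL2 g hg hgc
      _ = _ := by
          rw [← mul_assoc, ← ENNReal.ofReal_mul (inv_pos.2 hc).le, mul_assoc A₀, ← hc_def,
            mul_comm A₀, inv_mul_cancel_left₀ hc.ne']

end
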